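/- arXiv:1202.4988 — 5 statements merged into one kernel-verified Lean document; each statement's English description precedes it below -/
import Mathlib

section
/- For every prime p, the group ℤ_2³ × ℤ_p is a CI-group with respect to color binary relational structures. -/
/-- `σ` is an isomorphism from the color binary relational structure `(V, E)`
to `(V, E')`. -/
def IsColorBinaryIso {V : Type*} {c : ℕ} (σ : Equiv.Perm V)
    (E E' : Fin c → Set (V × V)) : Prop :=
  ∀ i : Fin c, ∀ u v : V, (σ u, σ v) ∈ E' i ↔ (u, v) ∈ E i

/-- `(G, E)` is a Cayley color binary relational structure of `G`. -/
def IsCayleyColorBinary (G : Type*) [Group G] {c : ℕ}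
    (E : Fin c → Set (G × G)) : Prop :=
  ∀ g : G, IsColorBinaryIso (Equiv.mulLeft g) E E

/-- `G` is a CI-group with respect to color binary relational structures. -/
def IsCIGroupColorBinary (G : Type*) [Group G] : Prop :=
  ∀ (c : ℕ) (E E' : Fin c → Set (G × G)),
    Pairwise (Function.onFun Disjoint E) → Pairwise (Function.onFun Disjoint E') →
    IsCayleyColorBinary G E → IsCayleyColorBinary G E' →
    (∃ σ : Equiv.Perm G, IsColorBinaryIso σ E E') →
    ∃ φ : G ≃* G, IsColorBinaryIso φ.toEquiv E E'

/-- The colour sets `D` and `D'` are matched by `σ`: differences in `D` are exactly those that `σ`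
turns into differences in `D'`. -/
def PairedSets {V W : Type*} [AddGroup V] [AddGroup W] (σ : V ≃ W) (D : Set V) (D' : Set W) :
    Prop :=
  ∀ u v, v - u ∈ D ↔ σ v - σ u ∈ D'

/-- `x` and `y` belong to the same colours, for all colours matched by `σ`. -/
def SameColor {V W : Type*} [AddGroup V] [AddGroup W] (σ : V ≃ W) (x : V) (y : W) : Prop :=
  ∀ D D', PairedSets σ D D' → (x ∈ D ↔ y ∈ D')

/-- All colours matched by `σ` are matched by a single group isomorphism. -/
def HasCI {V W : Type*} [AddGroup V] [AddGroup W] (σ : V ≃ W) : Prop :=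
  ∃ φ : V ≃+ W, ∀ x, SameColor σ x (φ x)

section PGroups

theorem exists_conj_mem_pSubgroup {Γ A B : Type*} [Group Γ] [Finite Γ] [Group A] [Group B] {p : ℕ}
    [Fact p.Prime] (hA : IsPGroup p A) (hB : IsPGroup p B) (N : Subgroup Γ) (θ : A →* Γ)
    (η : B →* Γ) (hθ : ∀ a, θ a ∈ N) (hη : ∀ b, η b ∈ N) :
    ∃ S : Subgroup Γ, IsPGroup p S ∧ S ≤ N ∧ (∀ a, θ a ∈ S) ∧
      ∃ g ∈ N, ∀ b, g⁻¹ * η b * g ∈ S := by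
  let θ' : A →* N := θ.codRestrict N hθ
  let η' : B →* N := η.codRestrict N hη
  have h1 : IsPGroup p θ'.range := hA.of_surjective θ'.rangeRestrict θ'.rangeRestrict_surjective
  have h2 : IsPGroup p η'.range := hB.of_surjective η'.rangeRestrict η'.rangeRestrict_surjective
  obtain ⟨P, hP⟩ := h1.exists_le_sylow
  obtain ⟨P', hP'⟩ := h2.exists_le_sylow
  obtain ⟨g, hg⟩ := MulAction.exists_smul_eq N P' P
  refine ⟨(P : Subgroup N).map N.subtype, P.2.map _, ?_, ?_, (g⁻¹ : N), (g⁻¹).2, ?_⟩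
  · rintro _ ⟨x, -, rfl⟩
    exact x.2
  · intro a
    exact ⟨θ' a, hP ⟨a, rfl⟩, rfl⟩
  · intro b
    refine ⟨g * η' b * g⁻¹, ?_, by simp [η']⟩
    have : η' b ∈ (P' : Subgroup N) := hP' ⟨b, rfl⟩
    rw [← hg]
    exact Subgroup.smul_mem_pointwise_smul _ (MulAut.conj g) _ this

/-- A nontrivial central element of a `p`-group containing both regular translation groups is a
translation for both structures. -/
theorem exists_common_translation {V W Γ : Type*} [AddCommGroup V] [AddCommGroup W] [Finite V]
    [Nontrivial V] [Group Γ] [MulAction Γ V] {p : ℕ} [Fact p.Prime] (hΓ : IsPGroup p Γ)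
    (σ : V ≃ W) (hV : ∀ v : V, ∃ γ : Γ, ∀ x : V, γ • x = x + v)
    (hW : ∀ w : W, ∃ γ : Γ, ∀ x : V, σ (γ • x) = σ x + w) :
    ∃ e e', e ≠ 0 ∧ e' ≠ 0 ∧ (∀ x, σ (x + e) = σ x + e') ∧
      ∀ (γ : Γ) (x : V), γ • (x + e) = γ • x + e := by
  set R := (MulAction.toPermHom Γ V).range
  have hR : IsPGroup p R := hΓ.of_surjective _ (MonoidHom.rangeRestrict_surjective _)
  have hnt : Nontrivial R := by
    obtain ⟨v, hv⟩ := exists_ne (0 : V)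
    obtain ⟨γ, hγ⟩ := hV v
    refine ⟨⟨⟨MulAction.toPermHom Γ V γ, γ, rfl⟩, 1, fun h => hv ?_⟩⟩
    have := congrArg (fun r : R => (r : Equiv.Perm V) 0) h
    simpa [hγ] using this
  have := hR.center_nontrivial
  obtain ⟨⟨z, hz⟩, hz1⟩ := exists_ne (1 : Subgroup.center R)
  have hcomm : ∀ (γ : Γ) (x : V), γ • ((z : Equiv.Perm V) x) = (z : Equiv.Perm V) (γ • x) := by
    intro γ x
    have := Subgroup.mem_center_iff.1 hz ⟨MulAction.toPermHom Γ V γ, γ, rfl⟩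
    exact congrArg (fun r : R => (r : Equiv.Perm V) x) this
  have hze : ∀ x, (z : Equiv.Perm V) x = x + (z : Equiv.Perm V) 0 := by
    intro x
    obtain ⟨γ, hγ⟩ := hV x
    have := hcomm γ 0
    rw [hγ, hγ, zero_add] at this
    rw [← this, add_comm]
  set e := (z : Equiv.Perm V) 0
  have he : e ≠ 0 := by
    intro h0
    apply hz1
    ext x
    simp [hze, h0]
  have hσ : ∀ x, σ (x + e) = σ x + (σ e - σ 0) := by
    intro x
    obtain ⟨γ, hγ⟩ := hW (σ x - σ 0)
    have h0 : γ • (0 : V) = x := σ.injective (by rw [hγ]; abel)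
    have := hcomm γ 0
    rw [h0, hze x] at this
    rw [← this, hγ]
    simp only [e]
    abel
  refine ⟨e, σ e - σ 0, he, fun h => he (σ.injective (sub_eq_zero.1 h)), hσ, fun γ x => ?_⟩
  rw [← hze, ← hze, hcomm]

end PGroups

section Stabilizer

variable {V W : Type*} [AddCommGroup V] [AddCommGroup W]

/-- The permutations preserving all colours matched by `σ`. -/
def colorAut (σ : V ≃ W) : Subgroup (Equiv.Perm V) where
  carrier := {a | ∀ D D', PairedSets σ D D' → ∀ u v, a v - a u ∈ D ↔ v - u ∈ D}
  mul_mem' := by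
    intro a b ha hb D D' h u v
    exact (ha D D' h _ _).trans (hb D D' h _ _)
  one_mem' := by
    intro D D' _ u v
    rfl
  inv_mem' := by
    intro a ha D D' h u v
    simpa using (ha D D' h (a⁻¹ u) (a⁻¹ v)).symm

/-- Translations, as permutations. -/
def translationHom (V : Type*) [AddCommGroup V] : Multiplicative V →* Equiv.Perm V where
  toFun a := Equiv.addRight a.toAdd
  map_one' := by ext; simp
  map_mul' a b := by ext; simp; abel

/-- Translations of the codomain, transported to the domain. -/
def pulledTranslationHom (σ : V ≃ W) : Multiplicative W →* Equiv.Perm V where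
  toFun a := (σ.trans (Equiv.addRight a.toAdd)).trans σ.symm
  map_one' := by ext; simp
  map_mul' a b := by ext; simp; abel_nf

@[simp] theorem translationHom_apply (a : Multiplicative V) (x : V) :
    translationHom V a x = x + a.toAdd := rfl

omit [AddCommGroup V] in
@[simp] theorem pulledTranslationHom_apply (σ : V ≃ W) (a : Multiplicative W) (x : V) :
    pulledTranslationHom σ a x = σ.symm (σ x + a.toAdd) := rfl

theorem translationHom_mem_colorAut (σ : V ≃ W) (a : Multiplicative V) :
    translationHom V a ∈ colorAut σ := by
  intro D D' _ u v
  simp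

theorem pulledTranslationHom_mem_colorAut (σ : V ≃ W) (a : Multiplicative W) :
    pulledTranslationHom σ a ∈ colorAut σ := by
  intro D D' h u v
  simp [h u v, h _ _]

theorem PairedSets.comp_colorAut {σ : V ≃ W} {D : Set V} {D' : Set W} (h : PairedSets σ D D')
    {a : Equiv.Perm V} (ha : a ∈ colorAut σ) : PairedSets (a.trans σ) D D' := by
  intro u v
  rw [← ha D D' h u v]
  exact h _ _

theorem SameColor.of_comp_colorAut {σ : V ≃ W} {a : Equiv.Perm V} (ha : a ∈ colorAut σ) {x : V}
    {y : W} (h : SameColor (a.trans σ) x y) : SameColor σ x y :=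
  fun D D' hD => h D D' (hD.comp_colorAut ha)

theorem HasCI.of_comp_colorAut {σ : V ≃ W} {a : Equiv.Perm V} (ha : a ∈ colorAut σ)
    (h : HasCI (a.trans σ)) : HasCI σ := by
  obtain ⟨φ, hφ⟩ := h
  exact ⟨φ, fun x => (hφ x).of_comp_colorAut ha⟩

theorem sameColor_sub (σ : V ≃ W) (u v : V) : SameColor σ (v - u) (σ v - σ u) :=
  fun _ _ h => h u v

end Stabilizer

section ExponentTwo

theorem exists_functional {V : Type*} [AddCommGroup V] (h2 : ∀ x : V, x + x = 0)
    (K : AddSubgroup V) {q : V} (hq : q ∉ K) :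
    ∃ l : V →+ ZMod 2, (∀ x ∈ K, l x = 0) ∧ l q = 1 := by
  let _ : Module (ZMod 2) V := AddCommGroup.zmodModule fun x => by rw [two_nsmul, h2]
  obtain ⟨f, hf, hK⟩ := (K.toZModSubmodule 2).exists_le_ker_of_notMem (v := q) (by simpa using hq)
  refine ⟨f.toAddMonoidHom, fun x hx => ?_, ?_⟩
  · exact hK (show x ∈ K.toZModSubmodule 2 by simpa using hx)
  · have : ∀ a : ZMod 2, a ≠ 0 → a = 1 := by decide
    exact this _ hf

theorem map_add_of_card_le_four {V W : Type*} [AddCommGroup V] [AddCommGroup W] [Finite V]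
    (hV : ∀ x : V, x + x = 0) (hW : ∀ x : W, x + x = 0) (hcard : Nat.card V ≤ 4) (σ : V ≃ W)
    (h0 : σ 0 = 0) (x y : V) : σ (x + y) = σ x + σ y := by
  by_cases hx : x = 0
  · simp [hx, h0]
  by_cases hy : y = 0
  · simp [hy, h0]
  by_cases hxy : x = y
  · simp [hxy, hV, hW, h0]
  have key : ∀ t : V, t = 0 ∨ t = x ∨ t = y ∨ t = x + y := by
    classical
    have := Fintype.ofFinite V
    have hc : ({0, x, y, x + y} : Finset V).card = 4 := by
      have hs : x + y ≠ 0 := fun h => hxy (add_right_cancel (h.trans (hV y).symm))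
      rw [Finset.card_insert_of_notMem, Finset.card_insert_of_notMem,
        Finset.card_insert_of_notMem, Finset.card_singleton] <;>
        simp [hx, hy, hxy, Ne.symm hx, Ne.symm hy, Ne.symm hs]
    have : ({0, x, y, x + y} : Finset V) = Finset.univ := by
      apply Finset.eq_univ_of_card
      rw [Nat.card_eq_fintype_card] at hcard
      exact le_antisymm (Finset.card_le_univ _) (by omega)
    intro t
    have ht : t ∈ ({0, x, y, x + y} : Finset V) := by rw [this]; exact Finset.mem_univ t
    simpa using ht
  rcases key (σ.symm (σ x + σ y)) with h | h | h | h <;> rw [Equiv.symm_apply_eq] at h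
  · rw [h0] at h
    exact absurd (σ.injective (add_right_cancel (h.trans (hW (σ y)).symm))) hxy
  · exact absurd (σ.injective ((left_eq_add.1 h.symm).trans h0.symm)) hy
  · exact absurd (σ.injective ((right_eq_add.1 h.symm).trans h0.symm)) hx
  · exact h.symm

theorem neg_add_mem_zmultiples_iff {U : Type*} [AddCommGroup U] (h2 : ∀ x : U, x + x = 0)
    (d x y : U) : -x + y ∈ AddSubgroup.zmultiples d ↔ y = x ∨ y = x + d := by
  rw [AddSubgroup.mem_zmultiples_iff]
  constructor
  · rintro ⟨k, hk⟩
    have hy : y = x + k • d := by rw [hk]; abel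
    obtain ⟨m, rfl | rfl⟩ := Int.even_or_odd' k
    · left
      rw [hy, mul_comm, mul_zsmul, two_zsmul, h2, smul_zero, add_zero]
    · right
      rw [hy, add_zsmul, mul_comm, mul_zsmul, two_zsmul, h2, smul_zero, zero_add, one_zsmul]
  · rintro (rfl | rfl)
    · exact ⟨0, by simp⟩
    · exact ⟨1, by simp⟩

theorem eq_zero_of_snoc {U : Type*} [AddCommGroup U] (h2 : ∀ x : U, x + x = 0) {n : ℕ} {d : U}
    {l : U →+ ZMod 2} (hl : l d = 1) {a : Fin n → U ⧸ AddSubgroup.zmultiples d →+ ZMod 2}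
    (ha : ∀ x, (∀ i, a i x = 0) → x = 0) (x : U)
    (hx : ∀ i : Fin (n + 1), Fin.snoc (α := fun _ => U →+ ZMod 2)
      (fun i => (a i).comp (QuotientAddGroup.mk' _)) l i x = 0) : x = 0 := by
  have h1 : ((0 : U) : U ⧸ AddSubgroup.zmultiples d) = x := (ha _ fun i => by
    simpa using hx i.castSucc).symm
  have h3 := hx (Fin.last n)
  rw [Fin.snoc_last] at h3
  rw [QuotientAddGroup.eq, neg_add_mem_zmultiples_iff h2] at h1
  rcases h1 with rfl | rfl
  · rfl
  · simp [hl] at h3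

theorem exists_flag {Γ : Type*} [Group Γ] (hΓ : IsPGroup 2 Γ) (n : ℕ) :
    ∀ {V W : Type*} [AddCommGroup V] [AddCommGroup W] [MulAction Γ V] (σ : V ≃ W),
      (∀ x : V, x + x = 0) → (∀ x : W, x + x = 0) → Nat.card V = 2 ^ n →
      (∀ v : V, ∃ γ : Γ, ∀ x : V, γ • x = x + v) →
      (∀ w : W, ∃ γ : Γ, ∀ x : V, σ (γ • x) = σ x + w) →
      ∃ (a : Fin n → V →+ ZMod 2) (b : Fin n → W →+ ZMod 2), (∀ x, (∀ i, a i x = 0) → x = 0) ∧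
        (∀ x, (∀ i, b i x = 0) → x = 0) ∧
        ∀ i x y, (∀ j < i, a j x = a j y) → b i (σ x) - a i x = b i (σ y) - a i y := by
  induction n with
  | zero =>
    intro V W _ _ _ σ _ _ hcard _ _
    have hs : Subsingleton V := (Nat.card_eq_one_iff_unique.1 (by simpa using hcard)).1
    have hs' : Subsingleton W := σ.symm.subsingleton
    exact ⟨finZeroElim, finZeroElim, fun x _ => Subsingleton.elim _ _,
      fun x _ => Subsingleton.elim _ _, fun i => i.elim0⟩
  | succ n ih =>
    intro V W _ _ _ σ h2V h2W hcard hV hW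
    have hfin : Finite V := Nat.finite_of_card_ne_zero (by rw [hcard]; positivity)
    have hnt : Nontrivial V := by
      rw [← Finite.one_lt_card_iff_nontrivial, hcard]
      exact Nat.one_lt_two_pow (by omega)
    obtain ⟨e, e', he, he', hσ, hcomm⟩ := exists_common_translation hΓ σ hV hW
    let σ' : V ⧸ AddSubgroup.zmultiples e ≃ W ⧸ AddSubgroup.zmultiples e' :=
      Quotient.congr σ (by
        intro x y
        change QuotientAddGroup.leftRel _ x y ↔ QuotientAddGroup.leftRel _ (σ x) (σ y)
        rw [QuotientAddGroup.leftRel_apply, QuotientAddGroup.leftRel_apply,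
          neg_add_mem_zmultiples_iff h2V, neg_add_mem_zmultiples_iff h2W, ← hσ,
          σ.apply_eq_iff_eq, σ.apply_eq_iff_eq])
    have hσ' : ∀ x : V, σ' (x : V ⧸ AddSubgroup.zmultiples e) = (σ x : W ⧸ _) := fun x => rfl
    let _ : MulAction Γ (V ⧸ AddSubgroup.zmultiples e) :=
      { smul := fun γ => Quotient.map (γ • ·) (by
          intro x y h
          change QuotientAddGroup.leftRel _ x y at h
          change QuotientAddGroup.leftRel _ _ _
          rw [QuotientAddGroup.leftRel_apply, neg_add_mem_zmultiples_iff h2V] at h ⊢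
          rcases h with rfl | rfl
          · exact Or.inl rfl
          · exact Or.inr (hcomm _ _))
        one_smul := by
          rintro ⟨x⟩
          exact congrArg (QuotientAddGroup.mk) (one_smul Γ x)
        mul_smul := by
          rintro γ δ ⟨x⟩
          exact congrArg (QuotientAddGroup.mk) (mul_smul γ δ x) }
    have hsmul : ∀ (γ : Γ) (x : V),
        γ • (x : V ⧸ AddSubgroup.zmultiples e) = ((γ • x : V) : V ⧸ _) := fun _ _ => rfl
    have hcard' : Nat.card (V ⧸ AddSubgroup.zmultiples e) = 2 ^ n := by
      have h1 := AddSubgroup.card_eq_card_quotient_mul_card_addSubgroup (AddSubgroup.zmultiples e)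
      rw [Nat.card_zmultiples, addOrderOf_eq_prime (p := 2) (by rw [two_nsmul, h2V]) he, hcard] at h1
      rw [pow_succ] at h1
      omega
    obtain ⟨a, b, ha, hb, hab⟩ := ih σ' (by rintro ⟨x⟩; exact congrArg QuotientAddGroup.mk (h2V x))
      (by rintro ⟨x⟩; exact congrArg QuotientAddGroup.mk (h2W x)) hcard'
      (by
        rintro ⟨v⟩
        obtain ⟨γ, hγ⟩ := hV v
        exact ⟨γ, by rintro ⟨x⟩; exact congrArg QuotientAddGroup.mk (hγ x)⟩)
      (by
        rintro ⟨w⟩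
        obtain ⟨γ, hγ⟩ := hW w
        exact ⟨γ, by rintro ⟨x⟩; exact congrArg QuotientAddGroup.mk (hγ x)⟩)
    obtain ⟨l, -, hl⟩ := exists_functional h2V ⊥ (q := e) (by simpa using he)
    obtain ⟨l', -, hl'⟩ := exists_functional h2W ⊥ (q := e') (by simpa using he')
    refine ⟨Fin.snoc (α := fun _ => V →+ ZMod 2) (fun i => (a i).comp (QuotientAddGroup.mk' _)) l,
      Fin.snoc (α := fun _ => W →+ ZMod 2) (fun i => (b i).comp (QuotientAddGroup.mk' _)) l',
      eq_zero_of_snoc h2V hl ha, eq_zero_of_snoc h2W hl' hb, fun i => ?_⟩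
    refine Fin.lastCases (fun x y h => ?_) (fun i x y h => ?_) i
    · have h1 : (x : V ⧸ AddSubgroup.zmultiples e) = y := by
        rw [← sub_eq_zero]
        refine ha _ fun j => ?_
        have := h j.castSucc (Fin.castSucc_lt_last j)
        simpa [sub_eq_zero] using this
      rw [QuotientAddGroup.eq, neg_add_mem_zmultiples_iff h2V] at h1
      rcases h1 with rfl | rfl
      · rfl
      · simp [hσ, hl, hl']
    · have := hab i x y fun j hj => by
        simpa using h j.castSucc (Fin.castSucc_lt_castSucc_iff.2 hj)
      simpa [hσ'] using this

theorem exists_linear_shift : ∀ c g12 g13 g23 g : ZMod 2, ∃ d : ZMod 2, ∀ x0 x1 x2 : ZMod 2,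
    ∃ w0 w1 w2 : ZMod 2, c * ((x0 + w0) * (x1 + w1) - w0 * w1) = 0 ∧
      g12 * ((x0 + w0) * (x1 + w1) - w0 * w1) + g13 * ((x0 + w0) * (x2 + w2) - w0 * w2) +
        g23 * ((x1 + w1) * (x2 + w2) - w1 * w2) +
          g * ((x0 + w0) * (x1 + w1) * (x2 + w2) - w0 * w1 * w2) = d * x2 := by
  decide

theorem exists_poly_one (f : ZMod 2 → ZMod 2) : ∃ a c : ZMod 2, ∀ x, f x = c + a * x := by
  refine ⟨f 1 - f 0, f 0, fun x => ?_⟩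
  obtain rfl | rfl : x = 0 ∨ x = 1 := by revert x; decide
  · ring
  · ring

theorem exists_poly_two (f : ZMod 2 → ZMod 2 → ZMod 2) :
    ∃ c a b d : ZMod 2, ∀ x y, f x y = c + a * x + b * y + d * (x * y) := by
  choose a c h using fun x => exists_poly_one (f x)
  obtain ⟨a1, c1, h1⟩ := exists_poly_one a
  obtain ⟨a2, c2, h2⟩ := exists_poly_one c
  exact ⟨c2, a2, c1, a1, fun x y => by rw [h, h1, h2]; ring⟩

theorem exists_poly_three (f : ZMod 2 → ZMod 2 → ZMod 2 → ZMod 2) :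
    ∃ k a b c g12 g13 g23 g : ZMod 2, ∀ x y z, f x y z = k + a * x + b * y + c * z +
      g12 * (x * y) + g13 * (x * z) + g23 * (y * z) + g * (x * y * z) := by
  choose k a b d h using fun x => exists_poly_two (f x)
  obtain ⟨k1, k0, hk⟩ := exists_poly_one k
  obtain ⟨a1, a0, ha⟩ := exists_poly_one a
  obtain ⟨b1, b0, hb⟩ := exists_poly_one b
  obtain ⟨d1, d0, hd⟩ := exists_poly_one d
  exact ⟨k0, k1, a0, b0, a1, b1, d0, d1, fun x y z => by rw [h, hk, ha, hb, hd]; ring⟩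

theorem bijective_pi_of_injective {V : Type*} [AddCommGroup V] {n : ℕ} (hcard : Nat.card V = 2 ^ n)
    (a : Fin n → V →+ ZMod 2) (ha : ∀ x, (∀ i, a i x = 0) → x = 0) :
    Function.Bijective (fun x i => a i x) := by
  have hfin : Finite V := Nat.finite_of_card_ne_zero (by rw [hcard]; positivity)
  rw [Nat.bijective_iff_injective_and_card]
  refine ⟨fun x y h => ?_, by simp [hcard]⟩
  rw [← sub_eq_zero]
  exact ha _ fun i => by rw [map_sub, sub_eq_zero]; exact congrFun h i

theorem hasCI_of_triangular {V W : Type*} [AddCommGroup V] [AddCommGroup W] (σ : V ≃ W)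
    (hcard : Nat.card V = 2 ^ 4) (a : Fin 4 → V →+ ZMod 2) (b : Fin 4 → W →+ ZMod 2)
    (ha : ∀ x, (∀ i, a i x = 0) → x = 0) (hb : ∀ x, (∀ i, b i x = 0) → x = 0)
    (h : ∀ i x y, (∀ j < i, a j x = a j y) → b i (σ x) - a i x = b i (σ y) - a i y) :
    HasCI σ := by
  have hA := bijective_pi_of_injective hcard a ha
  have hB := bijective_pi_of_injective (Nat.card_congr σ ▸ hcard) b hb
  have hsurj : ∀ x : Fin 4 → ZMod 2, ∃ v, ∀ i, a i v = x i := fun x =>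
    (hA.2 x).imp fun v hv i => congrFun hv i
  choose lift hlift using hsurj
  have h0 : ∀ x, b 0 (σ x) = a 0 x + (b 0 (σ 0) - a 0 0) := fun x => by
    rw [← h 0 x 0 (by simp)]; ring
  have h1 : ∀ x, b 1 (σ x) = a 1 x + (fun x0 => b 1 (σ (lift ![x0, 0, 0, 0])) -
      a 1 (lift ![x0, 0, 0, 0])) (a 0 x) := fun x => by
    have := h 1 x (lift ![a 0 x, 0, 0, 0]) (by
      intro j hj
      obtain rfl : j = 0 := by revert j; decide
      exact (hlift ![a 0 x, 0, 0, 0] 0).symm)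
    linear_combination this
  have h2 : ∀ x, b 2 (σ x) = a 2 x + (fun x0 x1 => b 2 (σ (lift ![x0, x1, 0, 0])) -
      a 2 (lift ![x0, x1, 0, 0])) (a 0 x) (a 1 x) := fun x => by
    have := h 2 x (lift ![a 0 x, a 1 x, 0, 0]) (by
      intro j hj
      obtain rfl | rfl : j = 0 ∨ j = 1 := by revert j; decide
      exacts [(hlift ![a 0 x, a 1 x, 0, 0] 0).symm, (hlift ![a 0 x, a 1 x, 0, 0] 1).symm])
    linear_combination this
  have h3 : ∀ x, b 3 (σ x) = a 3 x + (fun x0 x1 x2 => b 3 (σ (lift ![x0, x1, x2, 0])) -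
      a 3 (lift ![x0, x1, x2, 0])) (a 0 x) (a 1 x) (a 2 x) := fun x => by
    have := h 3 x (lift ![a 0 x, a 1 x, a 2 x, 0]) (by
      intro j hj
      obtain rfl | rfl | rfl : j = 0 ∨ j = 1 ∨ j = 2 := by revert j; decide
      exacts [(hlift ![a 0 x, a 1 x, a 2 x, 0] 0).symm,
        (hlift ![a 0 x, a 1 x, a 2 x, 0] 1).symm, (hlift ![a 0 x, a 1 x, a 2 x, 0] 2).symm])
    linear_combination this
  generalize (fun x0 => b 1 (σ (lift ![x0, 0, 0, 0])) - a 1 (lift ![x0, 0, 0, 0])) = f1 at h1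
  generalize (fun x0 x1 => b 2 (σ (lift ![x0, x1, 0, 0])) - a 2 (lift ![x0, x1, 0, 0])) = f2 at h2
  generalize (fun x0 x1 x2 => b 3 (σ (lift ![x0, x1, x2, 0])) -
    a 3 (lift ![x0, x1, x2, 0])) = f3 at h3
  obtain ⟨p1, p0, hf1⟩ := exists_poly_one f1
  obtain ⟨q0, q1, q2, c, hf2⟩ := exists_poly_two f2
  obtain ⟨r0, r1, r2, r3, g12, g13, g23, g, hf3⟩ := exists_poly_three f3
  obtain ⟨d, hd⟩ := exists_linear_shift c g12 g13 g23 g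
  let M : V →+ (Fin 4 → ZMod 2) := AddMonoidHom.pi ![a 0, a 1 + (AddMonoidHom.mulLeft p1).comp (a 0),
    a 2 + (AddMonoidHom.mulLeft q1).comp (a 0) + (AddMonoidHom.mulLeft q2).comp (a 1),
    a 3 + (AddMonoidHom.mulLeft r1).comp (a 0) + (AddMonoidHom.mulLeft r2).comp (a 1) +
      (AddMonoidHom.mulLeft (r3 + d)).comp (a 2)]
  let B : W ≃+ (Fin 4 → ZMod 2) := AddEquiv.ofBijective (AddMonoidHom.pi b) hB
  have hfin : Finite V := Nat.finite_of_card_ne_zero (by rw [hcard]; positivity)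
  have hM : Function.Bijective M := by
    rw [Nat.bijective_iff_injective_and_card]
    refine ⟨(injective_iff_map_eq_zero M).2 fun x hx => ha x ?_, by simp [hcard]⟩
    have e0 : a 0 x = 0 := congrFun hx 0
    have e1 : a 1 x + p1 * a 0 x = 0 := congrFun hx 1
    have e2 : a 2 x + q1 * a 0 x + q2 * a 1 x = 0 := congrFun hx 2
    have e3 : a 3 x + r1 * a 0 x + r2 * a 1 x + (r3 + d) * a 2 x = 0 := congrFun hx 3
    simp only [e0, mul_zero, add_zero] at e1
    simp only [e0, e1, mul_zero, add_zero] at e2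
    simp only [e0, e1, e2, mul_zero, add_zero] at e3
    intro i
    fin_cases i <;> assumption
  refine ⟨(AddEquiv.ofBijective M hM).trans B.symm, fun x => ?_⟩
  obtain ⟨w0, w1, w2, hw1, hw2⟩ := hd (a 0 x) (a 1 x) (a 2 x)
  let w := lift ![w0, w1, w2, 0]
  have e0 : a 0 w = w0 := hlift _ 0
  have e1 : a 1 w = w1 := hlift _ 1
  have e2 : a 2 w = w2 := hlift _ 2
  have hx : B.symm (M x) = σ (x + w) - σ w := by
    rw [AddEquiv.symm_apply_eq]
    ext i
    change _ = b i (σ (x + w) - σ w)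
    rw [map_sub]
    fin_cases i
    · change a 0 x = b 0 (σ (x + w)) - b 0 (σ w)
      rw [h0, h0 w, map_add]; ring
    · change a 1 x + p1 * a 0 x = b 1 (σ (x + w)) - b 1 (σ w)
      rw [h1, h1 w, hf1, hf1, map_add, map_add]; ring
    · change a 2 x + q1 * a 0 x + q2 * a 1 x = b 2 (σ (x + w)) - b 2 (σ w)
      rw [h2, h2 w, hf2, hf2, map_add, map_add, map_add, e0, e1]
      linear_combination -hw1
    · change a 3 x + r1 * a 0 x + r2 * a 1 x + (r3 + d) * a 2 x = b 3 (σ (x + w)) - b 3 (σ w)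
      rw [h3, h3 w, hf3, hf3, map_add, map_add, map_add, map_add, e0, e1, e2]
      linear_combination -hw2
  change SameColor σ x (B.symm (M x))
  rw [hx]
  simpa using sameColor_sub σ w (x + w)

theorem HasCI.of_prod {V W : Type*} [AddCommGroup V] [AddCommGroup W] [Finite V] {σ : V ≃ W}
    (h : HasCI (σ.prodCongr (Equiv.refl (ZMod 2)))) : HasCI σ := by
  obtain ⟨φ, hφ⟩ := h
  let f : V →+ W := (AddMonoidHom.fst W (ZMod 2)).comp
    (φ.toAddMonoidHom.comp (AddMonoidHom.inl V (ZMod 2)))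
  have hD : ∀ {D D'}, PairedSets σ D D' →
      PairedSets (σ.prodCongr (Equiv.refl (ZMod 2))) (Prod.fst ⁻¹' D) (Prod.fst ⁻¹' D') := by
    intro D D' h u v
    exact h u.1 v.1
  have : Finite W := Finite.of_equiv V σ
  have hf : Function.Bijective f := by
    rw [Nat.bijective_iff_injective_and_card]
    refine ⟨(injective_iff_map_eq_zero f).2 fun x hx => ?_, Nat.card_congr σ⟩
    have h0 : PairedSets σ {0} {0} := fun u v => by
      simp only [Set.mem_singleton_iff, sub_eq_zero, σ.apply_eq_iff_eq]
    exact (hφ (x, 0) _ _ (hD h0)).2 hx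
  exact ⟨AddEquiv.ofBijective f hf, fun x D D' h => hφ (x, 0) _ _ (hD h)⟩

theorem hasCI_of_exponent_two {n : ℕ} (hn : n ≤ 4) : ∀ {V W : Type*} [AddCommGroup V]
    [AddCommGroup W] (σ : V ≃ W), (∀ x : V, x + x = 0) → (∀ x : W, x + x = 0) →
      Nat.card V = 2 ^ n → HasCI σ := by
  induction hn using Nat.decreasingInduction with
  | of_succ n hn ih =>
    intro V W _ _ σ hV hW hcard
    have hfin : Finite V := Nat.finite_of_card_ne_zero (by rw [hcard]; positivity)
    have h2 : ∀ x : ZMod 2, x + x = 0 := by decide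
    refine HasCI.of_prod (ih _ (fun x => Prod.ext (hV _) (h2 _)) (fun x => Prod.ext (hW _) (h2 _)) ?_)
    simp [hcard, pow_succ]
  | self =>
    intro V W _ _ σ hV hW hcard
    have hfin : Finite V := Nat.finite_of_card_ne_zero (by rw [hcard]; positivity)
    obtain ⟨S, hS, hSN, hθ, g, hg, hη⟩ := exists_conj_mem_pSubgroup (p := 2)
      (fun x => ⟨1, by rw [pow_one, pow_two]; exact congrArg Multiplicative.ofAdd (hV x.toAdd)⟩)
      (fun x => ⟨1, by rw [pow_one, pow_two]; exact congrArg Multiplicative.ofAdd (hW x.toAdd)⟩)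
      (colorAut σ) (translationHom V) (pulledTranslationHom σ) (translationHom_mem_colorAut σ)
      (pulledTranslationHom_mem_colorAut σ)
    apply HasCI.of_comp_colorAut hg
    obtain ⟨a, b, ha, hb, h⟩ := exists_flag hS 4 (g.trans σ) hV hW hcard
      (fun v => ⟨⟨_, hθ (Multiplicative.ofAdd v)⟩, fun x => rfl⟩)
      (fun w => ⟨⟨_, hη (Multiplicative.ofAdd w)⟩, fun x => by
        change σ (g (g⁻¹ (pulledTranslationHom σ _ (g x)))) = _
        simp⟩)
    exact hasCI_of_triangular _ hcard a b ha hb h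

end ExponentTwo

section PairedSets

variable {V W : Type*} [AddCommGroup V] [AddCommGroup W] {σ : V ≃ W}

theorem PairedSets.compl {D : Set V} {D' : Set W} (h : PairedSets σ D D') :
    PairedSets σ Dᶜ D'ᶜ := fun u v => not_congr (h u v)

theorem PairedSets.inter {D E : Set V} {D' E' : Set W} (h : PairedSets σ D D')
    (k : PairedSets σ E E') : PairedSets σ (D ∩ E) (D' ∩ E') :=
  fun u v => and_congr (h u v) (k u v)

theorem PairedSets.union {D E : Set V} {D' E' : Set W} (h : PairedSets σ D D')
    (k : PairedSets σ E E') : PairedSets σ (D ∪ E) (D' ∪ E') :=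
  fun u v => or_congr (h u v) (k u v)

theorem PairedSets.diff {D E : Set V} {D' E' : Set W} (h : PairedSets σ D D')
    (k : PairedSets σ E E') : PairedSets σ (D \ E) (D' \ E') :=
  h.inter k.compl

theorem PairedSets.mem_iff {D : Set V} {D' : Set W} (h : PairedSets σ D D') (h0 : σ 0 = 0)
    (x : V) : x ∈ D ↔ σ x ∈ D' := by
  simpa [h0] using h 0 x

theorem PairedSets.symm {D : Set V} {D' : Set W} (h : PairedSets σ D D') :
    PairedSets σ.symm D' D := fun u v => by
  simpa using (h (σ.symm u) (σ.symm v)).symm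

/-- The set of `y` with `y + z ∈ E` for some `z ∈ D`. -/
theorem PairedSets.exists_add_mem {D E : Set V} {D' E' : Set W} (h : PairedSets σ D D')
    (k : PairedSets σ E E') :
    PairedSets σ {y | ∃ z ∈ D, y + z ∈ E} {y | ∃ z ∈ D', y + z ∈ E'} := by
  intro u v
  constructor
  · rintro ⟨z, hz, hz'⟩
    refine ⟨σ (v + z) - σ v, (h _ _).1 (by simpa), ?_⟩
    rw [show σ v - σ u + (σ (v + z) - σ v) = σ (v + z) - σ u by abel]
    exact (k _ _).1 (by rwa [add_sub_right_comm])
  · rintro ⟨z, hz, hz'⟩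
    refine ⟨σ.symm (σ v + z) - v, (h _ _).2 (by simpa), ?_⟩
    rw [show v - u + (σ.symm (σ v + z) - v) = σ.symm (σ v + z) - u by abel]
    exact (k _ _).2 (by rw [Equiv.apply_symm_apply, add_sub_right_comm]; exact hz')

theorem PairedSets.mem_closure_of_mem {D : Set V} {D' : Set W} (h : PairedSets σ D D') {x : V}
    (hx : x ∈ AddSubgroup.closure D) (u : V) : σ (u + x) - σ u ∈ AddSubgroup.closure D' := by
  induction hx using AddSubgroup.closure_induction generalizing u with
  | mem x hx => exact AddSubgroup.subset_closure ((h _ _).1 (by simpa))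
  | zero => simp
  | add x y _ _ hx hy =>
    have := add_mem (hx u) (hy (u + x))
    rwa [show σ (u + x) - σ u + (σ (u + x + y) - σ (u + x)) = σ (u + x + y) - σ u by abel,
      add_assoc] at this
  | neg x _ hx =>
    have := neg_mem (hx (u + -x))
    rwa [neg_add_cancel_right, neg_sub] at this

theorem PairedSets.closure {D : Set V} {D' : Set W} (h : PairedSets σ D D') :
    PairedSets σ (AddSubgroup.closure D : Set V) (AddSubgroup.closure D' : Set W) := by
  intro u v
  constructor
  · intro hx
    simpa using h.mem_closure_of_mem hx u
  · intro hx
    simpa using h.symm.mem_closure_of_mem hx (σ u)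

/-- The additive stabilizer of a set. -/
def addStab (D : Set V) : AddSubgroup V where
  carrier := {g | ∀ d, d ∈ D ↔ g + d ∈ D}
  add_mem' := by
    intro a b ha hb d
    rw [hb d, ha, add_assoc]
  zero_mem' := by simp
  neg_mem' := by
    intro a ha d
    rw [ha (-a + d), add_neg_cancel_left]

theorem mem_addStab {D : Set V} {g : V} : g ∈ addStab D ↔ ∀ d, d ∈ D ↔ g + d ∈ D := Iff.rfl

theorem PairedSets.addStab {D : Set V} {D' : Set W} (h : PairedSets σ D D') :
    PairedSets σ (addStab D : Set V) (addStab D' : Set W) := by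
  intro u v
  simp only [SetLike.mem_coe, mem_addStab]
  constructor
  · intro hx d
    have := hx (σ.symm (d + σ v) - v)
    rw [add_comm (v - u), sub_add_sub_cancel, h, h, Equiv.apply_symm_apply] at this
    rwa [add_sub_cancel_right, add_comm d, add_sub_right_comm] at this
  · intro hx d
    have := hx (σ (d + v) - σ v)
    rw [add_comm (σ v - σ u), sub_add_sub_cancel, ← h, ← h] at this
    rwa [add_sub_cancel_right, add_comm d, add_sub_right_comm] at this

/-- `x` and `y` belong to the same colours of the domain. -/
def SameClass (σ : V ≃ W) (x y : V) : Prop :=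
  ∀ D D', PairedSets σ D D' → (x ∈ D ↔ y ∈ D)

theorem SameClass.symm {x y : V} (h : SameClass σ x y) : SameClass σ y x :=
  fun D D' hD => (h D D' hD).symm

theorem SameClass.trans {x y z : V} (h : SameClass σ x y) (k : SameClass σ y z) :
    SameClass σ x z :=
  fun D D' hD => (h D D' hD).trans (k D D' hD)

theorem SameClass.sameColor (h0 : σ 0 = 0) {x : V} {y : W} (h : SameClass σ x (σ.symm y)) :
    SameColor σ x y := by
  intro D D' hD
  rw [h D D' hD, hD.mem_iff h0, Equiv.apply_symm_apply]

theorem exists_pairedSets_class (σ : V ≃ W) (x : V) :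
    ∃ D', PairedSets σ {y | SameClass σ x y} D' := by
  refine ⟨{y | ∀ D D', PairedSets σ D D' → (x ∈ D ↔ y ∈ D')}, fun u v => ?_⟩
  refine forall_congr' fun D => forall_congr' fun D' => forall_congr' fun hD => ?_
  rw [hD u v]

theorem HasCI.of_sub_const {w : W} (h : HasCI (σ.trans (Equiv.subRight w))) : HasCI σ := by
  obtain ⟨φ, hφ⟩ := h
  refine ⟨φ, fun x D D' hD => hφ x D D' fun u v => ?_⟩
  simpa using hD u v

end PairedSets

section Frobenius

variable {V W : Type*} [AddCommGroup V] [AddCommGroup W] {σ : V ≃ W}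

theorem coeff_mul_sub {R : Type*} [Semiring R] [Fintype V] (f g : AddMonoidAlgebra R V)
    (u v : V) :
    (f * g).coeff (v - u) = ∑ w, f.coeff (w - u) * g.coeff (v - w) := by
  rw [AddMonoidAlgebra.coeff_mul_apply_left, Finsupp.sum_fintype _ _ (by simp),
    ← (Equiv.subRight u).sum_comp]
  refine Finset.sum_congr rfl fun w _ => ?_
  simp

theorem coeff_pow_sub_eq [Finite V] {R : Type*} [Semiring R] {f : AddMonoidAlgebra R V}
    {f' : AddMonoidAlgebra R W} (h : ∀ u v, f.coeff (v - u) = f'.coeff (σ v - σ u)) (n : ℕ)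
    (u v : V) : (f ^ n).coeff (v - u) = (f' ^ n).coeff (σ v - σ u) := by
  have := Fintype.ofFinite V
  have := Fintype.ofEquiv V σ
  classical
  induction n generalizing u v with
  | zero =>
    simp only [pow_zero, AddMonoidAlgebra.one_def, AddMonoidAlgebra.coeff_single, Finsupp.single_apply,
      eq_comm (a := (0 : V)), eq_comm (a := (0 : W)), sub_eq_zero, σ.apply_eq_iff_eq]
  | succ n ih =>
    rw [pow_succ, pow_succ, coeff_mul_sub, coeff_mul_sub, ← σ.sum_comp]
    exact Finset.sum_congr rfl fun w _ => by rw [ih, h]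

theorem coeff_sum_single_pow [Fintype V] (l : ℕ) [Fact l.Prime] (D : Set V) [DecidablePred (· ∈ D)]
    (x : V) : ((∑ d with d ∈ D, AddMonoidAlgebra.single d (1 : ZMod l)) ^ l).coeff x =
      ({d | d ∈ D ∧ l • d = x}.ncard : ZMod l) := by
  classical
  have : CharP (AddMonoidAlgebra (ZMod l) V) l := charP_of_injective_algebraMap' (ZMod l) l
  have : ExpChar (AddMonoidAlgebra (ZMod l) V) l := inferInstance
  rw [sum_pow_char l]
  simp only [AddMonoidAlgebra.single_pow, one_pow, AddMonoidAlgebra.coeff_sum,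
    AddMonoidAlgebra.coeff_single, Finsupp.finsetSum_apply, Finsupp.single_apply]
  rw [Finset.sum_boole, Finset.filter_filter, Set.ncard_eq_toFinset_card']
  simp

/-- Counting solutions of `l • d = x` in a colour modulo a prime `l` gives colours. -/
theorem PairedSets.frobenius [Finite V] {D : Set V} {D' : Set W} (h : PairedSets σ D D') {l : ℕ}
    (hl : l.Prime) : PairedSets σ {x | ¬ l ∣ {d | d ∈ D ∧ l • d = x}.ncard}
      {x | ¬ l ∣ {d | d ∈ D' ∧ l • d = x}.ncard} := by
  classical
  have := Fintype.ofFinite V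
  have := Fintype.ofEquiv V σ
  have := Fact.mk hl
  intro u v
  refine not_congr ?_
  rw [← ZMod.natCast_eq_zero_iff, ← ZMod.natCast_eq_zero_iff, ← coeff_sum_single_pow,
    ← coeff_sum_single_pow]
  rw [coeff_pow_sub_eq (σ := σ) (fun u v => ?_)]
  simp [Finsupp.finsetSum_apply, Finsupp.single_apply, h u v]

end Frobenius

section Product

variable {Q R : Type*} [AddCommGroup Q] [AddCommGroup R] {p : ℕ} [Fact p.Prime]
  {σ : Q × ZMod p ≃ R × ZMod p}

theorem odd_nsmul {V : Type*} [AddCommGroup V] (h2 : ∀ x : V, x + x = 0) {n : ℕ} (hn : Odd n)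
    (x : V) : n • x = x := by
  obtain ⟨k, rfl⟩ := hn
  rw [add_nsmul, mul_comm, mul_nsmul', two_nsmul, h2, smul_zero, zero_add, one_nsmul]

/-- The elements of a colour counted modulo `p` along the `ZMod p`-direction. -/
def fiberCount (D : Set (Q × ZMod p)) : Set (Q × ZMod p) :=
  {x | x.2 = 0 ∧ ¬ p ∣ {i | (x.1, i) ∈ D}.ncard}

theorem setOf_nsmul_prime_eq (hp : p ≠ 2) (h2 : ∀ x : Q, x + x = 0) (D : Set (Q × ZMod p)) :
    {x | ¬ p ∣ {d | d ∈ D ∧ p • d = x}.ncard} = fiberCount D := by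
  have hodd : Odd p := (Fact.out : p.Prime).odd_of_ne_two hp
  have hsmul : ∀ d : Q × ZMod p, p • d = (d.1, 0) := fun d =>
    Prod.ext (odd_nsmul h2 hodd _) (by simp)
  ext x
  by_cases hx : x.2 = 0
  · have : {d | d ∈ D ∧ p • d = x} = (fun i => (x.1, i)) '' {i | (x.1, i) ∈ D} := by
      ext ⟨q, i⟩
      simp only [hsmul, Set.mem_ofPred_eq, Set.mem_image, Prod.ext_iff, hx, and_true]
      constructor
      · rintro ⟨h, rfl⟩
        exact ⟨i, h, rfl, rfl⟩
      · rintro ⟨i, h, rfl, rfl⟩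
        exact ⟨h, rfl⟩
    simp [fiberCount, hx, this, Set.ncard_image_of_injective _ (Prod.mk_right_injective x.1)]
  · have : {d | d ∈ D ∧ p • d = x} = ∅ := by
      ext d
      simp only [hsmul, Set.mem_ofPred_eq, Set.mem_empty_iff_false, iff_false, not_and]
      rintro - rfl
      exact hx rfl
    simp [fiberCount, hx, this]

theorem PairedSets.fiberCount [Finite Q] (hp : p ≠ 2) (hQ : ∀ x : Q, x + x = 0)
    (hR : ∀ x : R, x + x = 0) {D : Set (Q × ZMod p)} {D' : Set (R × ZMod p)}
    (h : PairedSets σ D D') : PairedSets σ (fiberCount D) (fiberCount D') := by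
  rw [← setOf_nsmul_prime_eq hp hQ, ← setOf_nsmul_prime_eq hp hR]
  exact h.frobenius Fact.out

theorem setOf_nsmul_eq (h2 : ∀ x : Q, x + x = 0) {l : ℕ} (hl : l.Prime) (hodd : Odd l)
    {m : ZMod p} (hm : (l : ZMod p) * m = 1) (D : Set (Q × ZMod p)) :
    {x | ¬ l ∣ {d | d ∈ D ∧ l • d = x}.ncard} = {x | (x.1, m * x.2) ∈ D} := by
  have hsmul : ∀ d x : Q × ZMod p, l • d = x ↔ d = (x.1, m * x.2) := fun d x => by
    rw [Prod.ext_iff, Prod.ext_iff, Prod.smul_fst, Prod.smul_snd, odd_nsmul h2 hodd, nsmul_eq_mul]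
    refine and_congr_right fun _ => ⟨fun h => ?_, fun h => ?_⟩
    · rw [← h, ← mul_assoc, mul_comm m, hm, one_mul]
    · rw [h, ← mul_assoc, hm, one_mul]
  ext x
  simp only [hsmul, Set.mem_ofPred_eq]
  by_cases hx : (x.1, m * x.2) ∈ D
  · have : {d | d ∈ D ∧ d = (x.1, m * x.2)} = {(x.1, m * x.2)} := by
      ext d
      simp only [Set.mem_ofPred_eq, Set.mem_singleton_iff, and_iff_right_iff_imp]
      rintro rfl
      exact hx
    simp [hx, this, hl.ne_one]
  · have : {d | d ∈ D ∧ d = (x.1, m * x.2)} = ∅ := by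
      ext d
      simp only [Set.mem_ofPred_eq, Set.mem_empty_iff_false, iff_false, not_and]
      rintro h rfl
      exact hx h
    simp [hx, this]

theorem PairedSets.multiplier [Finite Q] (hQ : ∀ x : Q, x + x = 0)
    (hR : ∀ x : R, x + x = 0) {D : Set (Q × ZMod p)} {D' : Set (R × ZMod p)}
    (h : PairedSets σ D D') {m : ZMod p} (hm : m ≠ 0) :
    PairedSets σ {x | (x.1, m * x.2) ∈ D} {x | (x.1, m * x.2) ∈ D'} := by
  obtain ⟨l, hl2, hl, hlm⟩ := Nat.forall_exists_prime_gt_and_eq_mod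
    (IsUnit.mk0 m⁻¹ (inv_ne_zero hm)) 2
  have hodd : Odd l := hl.odd_of_ne_two (by omega)
  have hml : (l : ZMod p) * m = 1 := by rw [hlm, inv_mul_cancel₀ hm]
  rw [← setOf_nsmul_eq hQ hl hodd hml, ← setOf_nsmul_eq hR hl hodd hml]
  exact h.frobenius hl

theorem SameClass.multiplier [Finite Q] (hQ : ∀ x : Q, x + x = 0) (hR : ∀ x : R, x + x = 0)
    {x y : Q × ZMod p} (h : SameClass σ x y) {m : ZMod p} (hm : m ≠ 0) :
    SameClass σ (x.1, m * x.2) (y.1, m * y.2) :=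
  fun _ _ hD => h _ _ (hD.multiplier hQ hR hm)

theorem dvd_ncard_iff (s : Set (ZMod p)) : p ∣ s.ncard ↔ ∀ i j, i ∈ s → j ∈ s := by
  constructor
  · intro h i j hi
    have hle : s.ncard ≤ p := by simpa using Set.ncard_le_ncard (Set.subset_univ s)
    have hpos : 0 < s.ncard := (Set.ncard_pos).2 ⟨i, hi⟩
    have hs : s = Set.univ := by
      refine Set.eq_of_subset_of_ncard_le (Set.subset_univ s) ?_
      simpa using Nat.le_of_dvd hpos h
    simp [hs]
  · intro h
    obtain rfl | ⟨i, hi⟩ := s.eq_empty_or_nonempty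
    · simp
    · have : s = Set.univ := Set.eq_univ_of_forall fun j => h i j hi
      simp [this]

omit [AddCommGroup Q] in
theorem mem_fiberCount {D : Set (Q × ZMod p)} {x : Q × ZMod p} :
    x ∈ fiberCount D ↔ x.2 = 0 ∧ ∃ i j, (x.1, i) ∈ D ∧ (x.1, j) ∉ D := by
  rw [fiberCount, Set.mem_ofPred_eq, dvd_ncard_iff]
  simp

theorem AddSubgroup.eq_setOf_fst_mem_and (S : AddSubgroup (Q × ZMod p))
    (h : ∀ x ∈ S, x.2 = 0) : (S : Set (Q × ZMod p)) =
      {x | x.1 ∈ S.comap (AddMonoidHom.inl Q (ZMod p)) ∧ x.2 = 0} := by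
  ext ⟨q, i⟩
  simp only [SetLike.mem_coe, Set.mem_ofPred_eq, AddSubgroup.mem_comap, AddMonoidHom.inl_apply]
  constructor
  · intro hx
    obtain rfl : i = 0 := h _ hx
    exact ⟨hx, rfl⟩
  · rintro ⟨hx, rfl⟩
    exact hx

theorem AddSubgroup.eq_setOf_fst_mem (S : AddSubgroup (Q × ZMod p))
    (h : ∀ i, (0, i) ∈ S) : (S : Set (Q × ZMod p)) =
      {x | x.1 ∈ S.comap (AddMonoidHom.inl Q (ZMod p))} := by
  ext ⟨q, i⟩
  simp only [SetLike.mem_coe, Set.mem_ofPred_eq, AddSubgroup.mem_comap, AddMonoidHom.inl_apply]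
  simpa using S.add_mem_cancel_right (x := (0, i)) (y := (q, 0)) (h i)

theorem closure_snd_eq_zero {D : Set (Q × ZMod p)} (h : ∀ x ∈ D, x.2 = 0) :
    ∀ x ∈ AddSubgroup.closure D, x.2 = 0 := by
  have : AddSubgroup.closure D ≤ (AddMonoidHom.snd Q (ZMod p)).ker :=
    (AddSubgroup.closure_le _).2 fun x hx => h x hx
  exact fun x hx => this hx

/-- The largest matched subgroups inside the elementary abelian `2`-factors. -/
theorem exists_core (σ : Q × ZMod p ≃ R × ZMod p) :
    ∃ (H : AddSubgroup Q) (H' : AddSubgroup R),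
      PairedSets σ {x | x.1 ∈ H ∧ x.2 = 0} {x | x.1 ∈ H' ∧ x.2 = 0} ∧
      ∀ D D', PairedSets σ D D' → (∀ x ∈ D, x.2 = 0) → (∀ x ∈ D', x.2 = 0) →
        (∀ x ∈ D, x.1 ∈ H) ∧ ∀ x ∈ D', x.1 ∈ H' := by
  let Z : Set (Q × ZMod p) := {x | ∃ D D', PairedSets σ D D' ∧ (∀ x ∈ D, x.2 = 0) ∧
    (∀ x ∈ D', x.2 = 0) ∧ x ∈ D}
  let Z' : Set (R × ZMod p) := {x | ∃ D D', PairedSets σ D D' ∧ (∀ x ∈ D, x.2 = 0) ∧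
    (∀ x ∈ D', x.2 = 0) ∧ x ∈ D'}
  have hZ : PairedSets σ Z Z' := fun u v => exists_congr fun D => exists_congr fun D' =>
    and_congr_right fun h => and_congr_right fun _ => and_congr_right fun _ => h u v
  have h0 : ∀ x ∈ Z, x.2 = 0 := fun x ⟨_, _, _, h, _, hx⟩ => h x hx
  have h0' : ∀ x ∈ Z', x.2 = 0 := fun x ⟨_, _, _, _, h, hx⟩ => h x hx
  have hc := hZ.closure
  rw [AddSubgroup.eq_setOf_fst_mem_and _ (closure_snd_eq_zero h0),
    AddSubgroup.eq_setOf_fst_mem_and _ (closure_snd_eq_zero h0')] at hc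
  refine ⟨_, _, hc, fun D D' hD h h' => ⟨fun x hx => ?_, fun x hx => ?_⟩⟩
  · have : x ∈ (AddSubgroup.closure Z : Set _) :=
      AddSubgroup.subset_closure ⟨D, D', hD, h, h', hx⟩
    rw [AddSubgroup.eq_setOf_fst_mem_and _ (closure_snd_eq_zero h0)] at this
    exact this.1
  · have : x ∈ (AddSubgroup.closure Z' : Set _) :=
      AddSubgroup.subset_closure ⟨D, D', hD, h, h', hx⟩
    rw [AddSubgroup.eq_setOf_fst_mem_and _ (closure_snd_eq_zero h0')] at this
    exact this.1

section Core

variable [Finite Q] (hp : p ≠ 2) (hQ : ∀ x : Q, x + x = 0) (hR : ∀ x : R, x + x = 0)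
  {H : AddSubgroup Q} {H' : AddSubgroup R}
  (hmax : ∀ D D', PairedSets σ D D' → (∀ x ∈ D, x.2 = 0) → (∀ x ∈ D', x.2 = 0) →
    (∀ x ∈ D, x.1 ∈ H) ∧ ∀ x ∈ D', x.1 ∈ H')

include hp hQ hR hmax

/-- Outside the core, colours are unions of cosets of the `ZMod p`-factor. -/
theorem mem_of_notMem_core {D : Set (Q × ZMod p)} {D' : Set (R × ZMod p)} (h : PairedSets σ D D')
    {q : Q} (hq : q ∉ H) {i : ZMod p} (hi : (q, i) ∈ D) (j : ZMod p) : (q, j) ∈ D := by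
  by_contra hj
  exact hq ((hmax _ _ (h.fiberCount hp hQ hR) (fun x hx => hx.1) fun x hx => hx.1).1 (q, 0)
    (mem_fiberCount.2 ⟨rfl, i, j, hi, hj⟩))

omit hmax in
theorem zero_mem_of_paired_subgroup (h0 : σ 0 = 0) {S : AddSubgroup (Q × ZMod p)}
    {S' : AddSubgroup (R × ZMod p)}
    (h : PairedSets σ (S : Set (Q × ZMod p)) (S' : Set (R × ZMod p))) (hS : ∀ i, (0, i) ∈ S)
    (i : ZMod p) : (0, i) ∈ S' := by
  by_contra hi
  have hc := h.fiberCount hp hQ hR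
  have h1 : (0 : R × ZMod p) ∈ fiberCount (S' : Set (R × ZMod p)) :=
    mem_fiberCount.2 ⟨rfl, 0, i, S'.zero_mem, hi⟩
  rw [← h0, ← hc.mem_iff h0, mem_fiberCount] at h1
  obtain ⟨-, i, j, -, hj⟩ := h1
  exact hj (hS j)

omit hmax in
/-- The least matched subgroups containing the `ZMod p`-factors. -/
theorem exists_hull (h0 : σ 0 = 0) : ∃ (Y : AddSubgroup Q) (Y' : AddSubgroup R),
    PairedSets σ {x | x.1 ∈ Y} {x | x.1 ∈ Y'} ∧
    ∀ (S : AddSubgroup (Q × ZMod p)) (S' : AddSubgroup (R × ZMod p)),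
      PairedSets σ (S : Set (Q × ZMod p)) (S' : Set (R × ZMod p)) → (∀ i, (0, i) ∈ S) →
        ∀ x : Q × ZMod p, x.1 ∈ Y → x ∈ S := by
  let T : Set (AddSubgroup (Q × ZMod p) × AddSubgroup (R × ZMod p)) :=
    {S | PairedSets σ (S.1 : Set (Q × ZMod p)) (S.2 : Set (R × ZMod p)) ∧ ∀ i, (0, i) ∈ S.1}
  let L : AddSubgroup (Q × ZMod p) := ⨅ S ∈ T, S.1
  let L' : AddSubgroup (R × ZMod p) := ⨅ S ∈ T, S.2
  have hL : PairedSets σ (L : Set (Q × ZMod p)) (L' : Set (R × ZMod p)) := by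
    intro u v
    simp only [L, L', SetLike.mem_coe, AddSubgroup.mem_iInf]
    exact forall_congr' fun S => forall_congr' fun hS => hS.1 u v
  have h1 : ∀ i, (0, i) ∈ L := fun i => by
    simp only [L, AddSubgroup.mem_iInf]
    exact fun S hS => hS.2 i
  have h1' := zero_mem_of_paired_subgroup hp hQ hR h0 hL h1
  have hL' := hL
  rw [AddSubgroup.eq_setOf_fst_mem L h1, AddSubgroup.eq_setOf_fst_mem L' h1'] at hL'
  refine ⟨_, _, hL', fun S S' h hS x hx => ?_⟩
  have hxL : x ∈ (L : Set (Q × ZMod p)) := by rw [AddSubgroup.eq_setOf_fst_mem L h1]; exact hx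
  exact (iInf₂_le (S, S') (⟨h, hS⟩ : (S, S') ∈ T) : L ≤ S) hxL

end Core

end Product

section Lift

variable {Q R : Type*} [AddCommGroup Q] [AddCommGroup R]

theorem exists_hom_extend_one (hQ : ∀ x : Q, x + x = 0) (hR : ∀ x : R, x + x = 0) (K : AddSubgroup Q)
    (ψ : Q →+ R) (hinj : ∀ x ∈ K, ψ x = 0 → x = 0) {q : Q} (hq : q ∉ K) {r : R}
    (hr : ∀ x ∈ K, ψ x ≠ r) :
    ∃ ψ' : Q →+ R, (∀ x ∈ K, ψ' x = ψ x) ∧ ψ' q = r ∧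
      ∀ x, x ∈ K ∨ x - q ∈ K → ψ' x = 0 → x = 0 := by
  obtain ⟨l, hlK, hlq⟩ := exists_functional hQ K hq
  let _ : Module (ZMod 2) R := AddCommGroup.zmodModule fun x => by rw [two_nsmul, hR]
  let ψ' : Q →+ R := ψ + (LinearMap.toSpanSingleton (ZMod 2) R (r - ψ q)).toAddMonoidHom.comp l
  have hψ' : ∀ x, ψ' x = ψ x + l x • (r - ψ q) := fun x => rfl
  have h1 : ∀ x ∈ K, ψ' x = ψ x := fun x hx => by rw [hψ', hlK x hx, zero_smul, add_zero]
  have h2 : ψ' q = r := by rw [hψ', hlq, one_smul, add_sub_cancel]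
  refine ⟨ψ', h1, h2, ?_⟩
  rintro x (hx | hx) h
  · exact hinj x hx ((h1 x hx).symm.trans h)
  · refine absurd ?_ (hr (-(x - q)) (neg_mem hx))
    rw [← h1 _ (neg_mem hx), map_neg, map_sub, h, h2, zero_sub, neg_neg]

theorem exists_hom_extend (hQ : ∀ x : Q, x + x = 0) (hR : ∀ x : R, x + x = 0) (K : AddSubgroup Q)
    (ψ : K →+ R) : ∃ ψ' : Q →+ R, ∀ x : K, ψ' x = ψ x := by
  let _ : Module (ZMod 2) Q := AddCommGroup.zmodModule fun x => by rw [two_nsmul, hQ]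
  let _ : Module (ZMod 2) R := AddCommGroup.zmodModule fun x => by rw [two_nsmul, hR]
  let f : K.toZModSubmodule 2 →ₗ[ZMod 2] R :=
    AddMonoidHom.toZModLinearMap 2 (M := K.toZModSubmodule 2) (ψ : K →+ R)
  obtain ⟨g, hg⟩ := f.exists_extend
  exact ⟨g.toAddMonoidHom, fun x => LinearMap.congr_fun hg x⟩

theorem ncard_fiber {Z : Type*} [AddCommGroup Z] (π : Q →+ Z) (q : Q) :
    {x | π x = π q}.ncard = Nat.card π.ker := by
  rw [← Nat.card_coe_set_eq]
  refine Nat.card_congr ((Equiv.subRight q).subtypeEquiv fun x => ?_)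
  simp [sub_eq_zero]

/-- An injective partial lift of `π` through `π'` extends to an isomorphism. -/
theorem exists_lift [Finite Q] {Z : Type*} [AddCommGroup Z] (hQ : ∀ x : Q, x + x = 0)
    (hR : ∀ x : R, x + x = 0) (e : Q ≃ R) (π : Q →+ Z) (π' : R →+ Z)
    (hπ' : Function.Surjective π')
    (hker : Nat.card π.ker = Nat.card π'.ker) (K : AddSubgroup Q) (ψ : Q →+ R)
    (hinj : ∀ x ∈ K, ψ x = 0 → x = 0) (hψ : ∀ x ∈ K, π' (ψ x) = π x) :
    ∃ φ : Q ≃+ R, (∀ x ∈ K, φ x = ψ x) ∧ ∀ x, π' (φ x) = π x := by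
  have : Finite R := Finite.of_equiv Q e
  induction h : (Kᶜ : Set Q).ncard using Nat.strong_induction_on generalizing K ψ with
  | _ n ih =>
    subst h
    by_cases hK : K = ⊤
    · subst hK
      have hb : Function.Bijective ψ := by
        rw [Nat.bijective_iff_injective_and_card]
        exact ⟨(injective_iff_map_eq_zero ψ).2 fun x hx => hinj x trivial hx, Nat.card_congr e⟩
      exact ⟨AddEquiv.ofBijective ψ hb, fun x _ => rfl, fun x => hψ x trivial⟩
    · obtain ⟨q, hq⟩ : ∃ q, q ∉ K := by
        by_contra! hc
        exact hK (eq_top_iff.2 fun x _ => hc x)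
      have hinj' : Set.InjOn ψ K := fun x hx y hy hxy => by
        rw [← sub_eq_zero] at hxy ⊢
        exact hinj _ (sub_mem hx hy) (by rw [map_sub, hxy])
      obtain ⟨r, hr, hrK⟩ : ∃ r, π' r = π q ∧ ∀ x ∈ K, ψ x ≠ r := by
        by_contra! hc
        obtain ⟨r0, hr0⟩ := hπ' (π q)
        have hsub : {r | π' r = π' r0} ⊆ ψ '' ({x | π x = π q} \ {q}) := by
          intro r hr
          obtain ⟨x, hx, rfl⟩ := hc r (hr.trans hr0)
          refine ⟨x, ⟨?_, ?_⟩, rfl⟩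
          · rw [Set.mem_ofPred_eq, ← hψ x hx, ← hr0]
            exact hr
          · rintro rfl
            exact hq hx
        have h1 := Set.ncard_le_ncard hsub
        have h2 := Set.ncard_image_le (f := ψ) (Set.toFinite ({x | π x = π q} \ {q}))
        have h3 := Set.ncard_sdiff_singleton_lt_of_mem (s := {x | π x = π q}) (a := q) rfl
        rw [ncard_fiber, ← hker] at h1
        rw [ncard_fiber] at h3
        omega
      obtain ⟨ψ', h1, h2, h3⟩ := exists_hom_extend_one hQ hR K ψ hinj hq hrK
      have hK' : ∀ x, x ∈ K ⊔ AddSubgroup.zmultiples q → x ∈ K ∨ x - q ∈ K := by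
        intro x hx
        obtain ⟨y, hy, z, hz, rfl⟩ := AddSubgroup.mem_sup.1 hx
        have := (neg_add_mem_zmultiples_iff hQ q 0 z).1 (by simpa using hz)
        rcases this with rfl | rfl
        · left; simpa
        · right; simpa
      obtain ⟨φ, hφ, hφ'⟩ := ih _ (Set.ncard_lt_ncard (t := (Kᶜ : Set Q)) (by
          refine ⟨Set.compl_subset_compl.2 (SetLike.coe_subset_coe.2 le_sup_left), fun hc => ?_⟩
          exact hc hq ((le_sup_right : _ ≤ K ⊔ _) (AddSubgroup.mem_zmultiples q))))
        (K ⊔ AddSubgroup.zmultiples q) ψ' (fun x hx => h3 x (hK' x hx)) (fun x hx => by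
          rcases hK' x hx with hx | hx
          · rw [h1 x hx, hψ x hx]
          · have := hψ _ hx
            rw [← h1 _ hx, map_sub, map_sub, map_sub, h2, hr] at this
            exact sub_left_injective this) rfl
      exact ⟨φ, fun x hx => (hφ x ((le_sup_left : K ≤ _) hx)).trans (h1 x hx), hφ'⟩

end Lift

section FiberPreserving

variable {Q R : Type*} [AddCommGroup Q] [AddCommGroup R] {p : ℕ} [Fact p.Prime]
  {σ : Q × ZMod p ≃ R × ZMod p}

omit [AddCommGroup Q] in
theorem mem_fiberCount_inter (E : Set (Q × ZMod p)) (k : ZMod p) (x : Q) :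
    (x, 0) ∈ fiberCount (E ∩ {x | x.2 = k}) ↔ (x, k) ∈ E := by
  rw [mem_fiberCount]
  constructor
  · rintro ⟨-, i, j, ⟨hi, rfl⟩, -⟩
    exact hi
  · intro hx
    exact ⟨rfl, k, k + 1, ⟨hx, rfl⟩, fun hk => by simpa using hk.2⟩

/-- If `σ` acts on second coordinates as multiplication by `c`, then colour correspondences on the
zero fibre extend to all fibres. -/
theorem exists_zero_fiber_equiv [Finite Q] (hp : p ≠ 2) (hQ : ∀ x : Q, x + x = 0)
    (hR : ∀ x : R, x + x = 0) {c : ZMod p} (hc : c ≠ 0) (hσ : ∀ x, (σ x).2 = c * x.2) :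
    ∃ τ : Q ≃ R, (∀ q, σ (q, 0) = (τ q, 0)) ∧
      ∀ q r, SameColor τ q r → ∀ j, SameColor σ (q, j) (r, c * j) := by
  have hσ' : ∀ x, (σ.symm x).2 = c⁻¹ * x.2 := fun x => by
    rw [← σ.apply_symm_apply x, hσ, inv_mul_cancel_left₀ hc, Equiv.apply_symm_apply]
  have hz : ∀ q, σ (q, 0) = ((σ (q, 0)).1, 0) := fun q => Prod.ext rfl (by simp [hσ])
  have hz' : ∀ r, σ.symm (r, 0) = ((σ.symm (r, 0)).1, 0) := fun q => Prod.ext rfl (by simp [hσ'])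
  let τ : Q ≃ R :=
    { toFun := fun q => (σ (q, 0)).1
      invFun := fun r => (σ.symm (r, 0)).1
      left_inv := fun q => by
        change (σ.symm ((σ (q, 0)).1, 0)).1 = q
        rw [← hz, Equiv.symm_apply_apply]
      right_inv := fun r => by
        change (σ ((σ.symm (r, 0)).1, 0)).1 = r
        rw [← hz', Equiv.apply_symm_apply] }
  refine ⟨τ, hz, fun q r h j D D' hD => ?_⟩
  have hj : PairedSets σ {x | x.2 = j} {x | x.2 = c * j} := fun u v => by
    simp only [Set.mem_ofPred_eq, Prod.snd_sub, hσ, ← mul_sub]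
    exact (mul_right_injective₀ hc).eq_iff.symm
  have hF := (hD.inter hj).fiberCount hp hQ hR
  refine h {q | (q, j) ∈ D} {r | (r, c * j) ∈ D'} fun u v => ?_
  have := hF (u, 0) (v, 0)
  rw [show σ (u, 0) = (τ u, 0) from hz u, show σ (v, 0) = (τ v, 0) from hz v, Prod.mk_sub_mk,
    Prod.mk_sub_mk, sub_zero, mem_fiberCount_inter, mem_fiberCount_inter] at this
  exact this

theorem affine_of_map_add {f : ZMod p → ZMod p} {e e' : ZMod p} (he : e ≠ 0)
    (h : ∀ x, f (x + e) = f x + e') (x : ZMod p) : f x = e' / e * x + f 0 := by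
  have key : ∀ n : ℕ, f (n * e) = n * e' + f 0 := by
    intro n
    induction n with
    | zero => simp
    | succ n ih => rw [Nat.cast_succ, add_one_mul, h, ih]; ring
  have := key (x / e).val
  rw [ZMod.natCast_zmod_val, div_mul_cancel₀ x he] at this
  rw [this]
  ring

theorem exists_affine_colorAut [Finite Q] (hsnd : PairedSets σ {x | x.2 = 0} {x | x.2 = 0})
    {Y : AddSubgroup Q} {Y' : AddSubgroup R} (hY : PairedSets σ {x | x.1 ∈ Y} {x | x.1 ∈ Y'}) :
    ∃ a ∈ colorAut σ, (∀ x, (a x).1 - x.1 ∈ Y) ∧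
      ∃ c d : ZMod p, c ≠ 0 ∧ ∀ x, (σ (a x)).2 = c * x.2 + d := by
  let N : Subgroup (Equiv.Perm (Q × ZMod p)) := colorAut σ ⊓
    { carrier := {a | ∀ x, (a x).1 - x.1 ∈ Y}
      one_mem' := fun x => by simp
      mul_mem' := fun {a b} ha hb x => by
        have := add_mem (ha (b x)) (hb x)
        rwa [sub_add_sub_cancel] at this
      inv_mem' := fun {a} ha x => by
        have := neg_mem (ha (a⁻¹ x))
        rwa [neg_sub, show a (a⁻¹ x) = x from a.apply_symm_apply x] at this }
  have hpP : IsPGroup p (Multiplicative (ZMod p)) := IsPGroup.of_card (n := 1) (by simp)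
  let θ : Multiplicative (ZMod p) →* Equiv.Perm (Q × ZMod p) :=
    (translationHom _).comp (AddMonoidHom.inr Q (ZMod p)).toMultiplicative
  let η : Multiplicative (ZMod p) →* Equiv.Perm (Q × ZMod p) :=
    (pulledTranslationHom σ).comp (AddMonoidHom.inr R (ZMod p)).toMultiplicative
  have hθ : ∀ i x, θ i x = x + (0, i.toAdd) := fun i x => rfl
  have hη : ∀ i x, σ (η i x) = σ x + (0, i.toAdd) := fun i x => σ.apply_symm_apply _
  obtain ⟨S, hS, hSN, hθS, g, hg, hηS⟩ := exists_conj_mem_pSubgroup hpP hpP N θ η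
    (fun i => ⟨translationHom_mem_colorAut σ _, fun x => by simp [hθ]⟩)
    (fun i => ⟨pulledTranslationHom_mem_colorAut σ _, fun x => by
      have := (hY x (η i x)).2 (by rw [hη]; simp)
      exact this⟩)
  have hsnd' : ∀ a ∈ N, ∀ x y, (a x).2 = (a y).2 ↔ x.2 = y.2 := by
    intro a ha x y
    have := ha.1 _ _ hsnd y x
    simpa only [Set.mem_ofPred_eq, Prod.snd_sub, sub_eq_zero] using this
  let _ : MulAction S (ZMod p) :=
    { smul := fun s i => ((s : Equiv.Perm (Q × ZMod p)) (0, i)).2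
      one_smul := fun i => by
        change (((1 : S) : Equiv.Perm (Q × ZMod p)) (0, i)).2 = i
        rw [OneMemClass.coe_one, Equiv.Perm.one_apply]
      mul_smul := fun s t i =>
        (hsnd' _ (hSN s.2) ((t : Equiv.Perm (Q × ZMod p)) (0, i))
          (0, ((t : Equiv.Perm (Q × ZMod p)) (0, i)).2)).2 rfl }
  have hsmul : ∀ (s : S) i, s • i = ((s : Equiv.Perm (Q × ZMod p)) (0, i)).2 := fun _ _ => rfl
  have hσg : ∀ x y, (σ (g x)).2 = (σ (g y)).2 ↔ x.2 = y.2 := by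
    intro x y
    rw [← hsnd' g hg]
    have := hsnd (g y) (g x)
    simpa only [Set.mem_ofPred_eq, Prod.snd_sub, sub_eq_zero] using this.symm
  let f : ZMod p ≃ ZMod p := Equiv.ofBijective (fun i => (σ (g (0, i))).2)
    (Finite.injective_iff_bijective.1 fun i j hij => (hσg _ _).1 hij)
  have hf : ∀ x : Q × ZMod p, f x.2 = (σ (g x)).2 := fun x => (hσg _ _).2 rfl
  obtain ⟨e, e', he, he', hfe, -⟩ := exists_common_translation hS f
    (fun v => ⟨⟨θ (Multiplicative.ofAdd v), hθS _⟩, fun x => by simp [hsmul, hθ]⟩)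
    (fun w => ⟨⟨_, hηS (Multiplicative.ofAdd w)⟩, fun x => by
      rw [hsmul, hf]
      simp only [Equiv.Perm.mul_apply]
      rw [show ∀ y, g (g⁻¹ y) = y from g.apply_symm_apply, hη]
      exact congrArg (· + w) (hf (0, x)).symm⟩)
  refine ⟨g, hg.1, hg.2, e' / e, f 0, div_ne_zero he' he, fun x => ?_⟩
  rw [← hf, affine_of_map_add he hfe]

end FiberPreserving

section Quotients

variable {Q R : Type*} [AddCommGroup Q] [AddCommGroup R] {p : ℕ} [Fact p.Prime]
  {σ : Q × ZMod p ≃ R × ZMod p} {Y : AddSubgroup Q} {Y' : AddSubgroup R}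

theorem exists_quotient_equiv (hY : PairedSets σ {x | x.1 ∈ Y} {x | x.1 ∈ Y'}) :
    ∃ τ : Q ⧸ Y ≃ R ⧸ Y', ∀ x : Q × ZMod p, τ (x.1 : Q ⧸ Y) = ((σ x).1 : R ⧸ Y') := by
  have key : ∀ x y : Q × ZMod p,
      (x.1 : Q ⧸ Y) = (y.1 : Q ⧸ Y) ↔ ((σ x).1 : R ⧸ Y') = ((σ y).1 : R ⧸ Y') := fun x y => by
    rw [QuotientAddGroup.eq_iff_sub_mem, QuotientAddGroup.eq_iff_sub_mem]
    exact hY y x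
  let f : Q ⧸ Y → R ⧸ Y' := fun z => ((σ (z.out, 0)).1 : R ⧸ Y')
  have hf : ∀ x : Q × ZMod p, f (x.1 : Q ⧸ Y) = ((σ x).1 : R ⧸ Y') := fun x =>
    (key _ x).1 (QuotientAddGroup.out_eq' _)
  refine ⟨Equiv.ofBijective f ⟨?_, fun z => ?_⟩, hf⟩
  · intro z z'
    induction z using QuotientAddGroup.induction_on with | H z => ?_
    induction z' using QuotientAddGroup.induction_on with | H z' => ?_
    intro h
    rw [hf (z, 0), hf (z', 0)] at h
    exact (key _ _).2 h
  · induction z using QuotientAddGroup.induction_on with | H z => ?_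
    exact ⟨((σ.symm (z, 0)).1 : Q ⧸ Y), by rw [hf, Equiv.apply_symm_apply]⟩

omit [AddCommGroup Q] [AddCommGroup R] in
theorem card_eq_of_equiv_prod_zmod (σ : Q × ZMod p ≃ R × ZMod p) : Nat.card Q = Nat.card R := by
  have h := Nat.card_congr σ
  rw [Nat.card_prod, Nat.card_prod, Nat.card_zmod] at h
  exact Nat.eq_of_mul_eq_mul_right (Fact.out : p.Prime).pos h

theorem exists_lift_quotient [Finite Q] (hQ : ∀ x : Q, x + x = 0) (hR : ∀ x : R, x + x = 0)
    (e : Q ≃ R) (f : Q ⧸ Y ≃+ R ⧸ Y') (K : AddSubgroup Q) (ψ : Q →+ R)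
    (hinj : ∀ x ∈ K, ψ x = 0 → x = 0) (hψ : ∀ x ∈ K, (ψ x : R ⧸ Y') = f (x : Q ⧸ Y)) :
    ∃ φ : Q ≃+ R, (∀ x ∈ K, φ x = ψ x) ∧ ∀ x, (φ x : R ⧸ Y') = f (x : Q ⧸ Y) := by
  have : Finite R := Finite.of_equiv Q e
  refine exists_lift hQ hR e ((f : Q ⧸ Y →+ R ⧸ Y').comp (QuotientAddGroup.mk' Y))
    (QuotientAddGroup.mk' Y') (QuotientAddGroup.mk'_surjective Y') ?_ K ψ hinj hψ
  have h1 : ((f : Q ⧸ Y →+ R ⧸ Y').comp (QuotientAddGroup.mk' Y)).ker = Y := by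
    ext x
    simp
  have hY := AddSubgroup.card_eq_card_quotient_mul_card_addSubgroup Y
  have hY' := AddSubgroup.card_eq_card_quotient_mul_card_addSubgroup Y'
  rw [← Nat.card_congr e, ← Nat.card_congr f.toEquiv, hY] at hY'
  rw [h1, QuotientAddGroup.ker_mk']
  exact Nat.eq_of_mul_eq_mul_left Nat.card_pos hY'

theorem exists_core_equiv {H : AddSubgroup Q} {H' : AddSubgroup R} (h0 : σ 0 = 0)
    (hcore : PairedSets σ {x | x.1 ∈ H ∧ x.2 = 0} {x | x.1 ∈ H' ∧ x.2 = 0}) :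
    ∃ τ : H ≃ H', ∀ h : H, σ (h, 0) = ((τ h : R), 0) := by
  have key := hcore.mem_iff h0
  have h1 : ∀ h : H, σ (h, 0) ∈ {x : R × ZMod p | x.1 ∈ H' ∧ x.2 = 0} := fun h =>
    (key _).1 ⟨h.2, rfl⟩
  have hz : ∀ h : H, σ (h, 0) = ((σ (h, 0)).1, 0) := fun h => Prod.ext rfl (h1 h).2
  refine ⟨Equiv.ofBijective (fun h => ⟨(σ (h, 0)).1, (h1 h).1⟩) ⟨fun h k hk => ?_, fun r => ?_⟩, hz⟩
  · have hhk : (σ (h, 0)).1 = (σ (k, 0)).1 := Subtype.ext_iff.1 hk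
    have := σ.injective ((hz h).trans (by rw [hhk, ← hz]))
    exact Subtype.ext (Prod.ext_iff.1 this).1
  · have hr : σ.symm (r, 0) ∈ {x : Q × ZMod p | x.1 ∈ H ∧ x.2 = 0} :=
      (key _).2 (by rw [Equiv.apply_symm_apply]; exact ⟨r.2, rfl⟩)
    refine ⟨⟨_, hr.1⟩, Subtype.ext ?_⟩
    have : ((σ.symm (r, 0)).1, (0 : ZMod p)) = σ.symm (r, 0) := Prod.ext rfl hr.2.symm
    simp [this]

end Quotients

section Hull

variable {Q R : Type*} [AddCommGroup Q] [AddCommGroup R] {p : ℕ} [Fact p.Prime]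
  {σ : Q × ZMod p ≃ R × ZMod p} {H Y : AddSubgroup Q} {H' Y' : AddSubgroup R}
  (hmin : ∀ (S : AddSubgroup (Q × ZMod p)) (S' : AddSubgroup (R × ZMod p)),
    PairedSets σ (S : Set (Q × ZMod p)) (S' : Set (R × ZMod p)) → (∀ i, (0, i) ∈ S) →
      ∀ x : Q × ZMod p, x.1 ∈ Y → x ∈ S)

include hmin

theorem mem_iff_of_sub_mem_hull {D : Set (Q × ZMod p)} {D' : Set (R × ZMod p)}
    (hD : PairedSets σ D D') (hinv : ∀ x ∈ D, ∀ y : Q × ZMod p, y.1 = x.1 → y ∈ D)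
    {x y : Q × ZMod p} (hxy : y.1 - x.1 ∈ Y) : x ∈ D ↔ y ∈ D := by
  have := hmin _ _ hD.addStab (fun i d => ⟨fun hd => hinv d hd _ (by simp), fun hd =>
    hinv _ hd d (by simp)⟩) (y - x) hxy
  rw [mem_addStab.1 this x, sub_add_cancel]

theorem exists_sameClass_of_notMem_core {q : Q} (hqY : q ∈ Y) (hqH : q ∉ H) :
    ∃ y : Q × ZMod p, y.1 ∉ H ∧ SameClass σ (0, 1) y := by
  by_contra! hcon
  obtain ⟨D', hD'⟩ := exists_pairedSets_class σ (0, 1)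
  have hq : (q, 0) ∈ AddSubgroup.closure {y | SameClass σ (0, 1) y} :=
    hmin _ _ hD'.closure (fun i => by
      have h1 : ((0, 1) : Q × ZMod p) ∈ AddSubgroup.closure {y | SameClass σ (0, 1) y} :=
        AddSubgroup.subset_closure fun _ _ _ => Iff.rfl
      simpa using nsmul_mem h1 i.val) (q, 0) hqY
  have hle : AddSubgroup.closure {y | SameClass σ (0, 1) y} ≤
      H.comap (AddMonoidHom.fst Q (ZMod p)) :=
    (AddSubgroup.closure_le _).2 fun y hy => by
      by_contra h
      exact hcon y h hy
  exact hqH (hle hq)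

variable [Finite Q] (hp : p ≠ 2) (hQ : ∀ x : Q, x + x = 0) (hR : ∀ x : R, x + x = 0)
  (hcore : PairedSets σ {x | x.1 ∈ H ∧ x.2 = 0} {x | x.1 ∈ H' ∧ x.2 = 0})
  (hmax : ∀ D D', PairedSets σ D D' → (∀ x ∈ D, x.2 = 0) → (∀ x ∈ D', x.2 = 0) →
    (∀ x ∈ D, x.1 ∈ H) ∧ ∀ x ∈ D', x.1 ∈ H')

include hp hQ hR hcore hmax

theorem sameClass_of_mem_core {t : Q} (htY : t ∈ Y) (htH : t ∉ H) {q : Q} (hq : q ∈ H)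
    {i j : ZMod p} (hi : i ≠ 0) (hj : j ≠ 0) : SameClass σ (q, i) (q, j) := by
  obtain ⟨y, hyH, hy⟩ := exists_sameClass_of_notMem_core hmin htY htH
  obtain ⟨A', hA⟩ := exists_pairedSets_class σ (q, 0)
  obtain ⟨B', hB⟩ := exists_pairedSets_class σ (q, i)
  have hyi := hy.multiplier hQ hR hi
  rw [mul_one] at hyi
  obtain ⟨z, hz, hzq⟩ := (hyi _ _ (hA.exists_add_mem hB)).1
    ⟨(q, 0), fun _ _ _ => Iff.rfl, by
      rw [Prod.mk_add_mk, zero_add, add_zero]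
      exact fun _ _ _ => Iff.rfl⟩
  have hzH : z.1 ∈ H := ((hz _ _ hcore).1 ⟨hq, rfl⟩).1
  have hr : y.1 + z.1 ∉ H := fun h => hyH ((H.add_mem_cancel_right hzH).1 h)
  have h1 : SameClass σ (q, i) (y.1 + z.1, i * y.2 + z.2) := hzq
  have h2 := h1.multiplier hQ hR (div_ne_zero hj hi)
  rw [div_mul_cancel₀ j hi] at h2
  exact (h1.trans fun D D' hD => ⟨fun h => mem_of_notMem_core hp hQ hR hmax hD hr h _,
    fun h => mem_of_notMem_core hp hQ hR hmax hD hr h _⟩).trans h2.symm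

theorem mem_of_sub_mem_hull {t : Q} (htY : t ∈ Y) (htH : t ∉ H) {x y : Q × ZMod p}
    (hx : ¬ (x.1 ∈ H ∧ x.2 = 0)) (hy : ¬ (y.1 ∈ H ∧ y.2 = 0)) (hxy : y.1 - x.1 ∈ Y)
    {D : Set (Q × ZMod p)} {D' : Set (R × ZMod p)} (hD : PairedSets σ D D') (hxD : x ∈ D) :
    y ∈ D := by
  set D₀ := D \ {x | x.1 ∈ H ∧ x.2 = 0} with hD₀
  have h0 := hD.diff hcore
  rw [← hD₀] at h0
  have hinv : ∀ x ∈ D₀, ∀ y : Q × ZMod p, y.1 = x.1 → y ∈ D₀ ∪ fiberCount D₀ := by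
    rintro ⟨q, i⟩ hq ⟨r, j⟩ hr
    obtain rfl : r = q := hr
    by_cases hqH : r ∈ H
    · have hi : i ≠ 0 := fun h => hq.2 ⟨hqH, h⟩
      by_cases hj : j = 0
      · exact Or.inr (mem_fiberCount.2 ⟨hj, i, 0, hq, fun h => h.2 ⟨hqH, rfl⟩⟩)
      · exact Or.inl ((sameClass_of_mem_core hmin hp hQ hR hcore hmax htY htH hqH hi hj _ _ h0).1 hq)
    · exact Or.inl (mem_of_notMem_core hp hQ hR hmax h0 hqH hq j)
  have h1 := (mem_iff_of_sub_mem_hull hmin (h0.union (h0.fiberCount hp hQ hR)) (by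
    rintro x (hx | hx) y hxy
    · exact hinv x hx y hxy
    · obtain ⟨-, i, -, hi, -⟩ := mem_fiberCount.1 hx
      exact hinv _ hi y hxy) hxy).1 (Or.inl ⟨hxD, hx⟩)
  obtain h1 | h1 := h1
  · exact h1.1
  · obtain ⟨hy2, i, -, hi, -⟩ := mem_fiberCount.1 h1
    exact mem_of_notMem_core hp hQ hR hmax hD (fun h => hy ⟨h, hy2⟩) hi.1 y.2

theorem hasCI_of_not_hull_le_core (hY : PairedSets σ {x | x.1 ∈ Y} {x | x.1 ∈ Y'})
    (h0 : σ 0 = 0) (hcard : Nat.card Q = 8) {t : Q} (htY : t ∈ Y) (htH : t ∉ H) : HasCI σ := by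
  have hcardQR := card_eq_of_equiv_prod_zmod σ
  have : Finite R := Nat.finite_of_card_ne_zero (by omega)
  have hsame : ∀ {x y : Q × ZMod p}, ¬ (x.1 ∈ H ∧ x.2 = 0) → ¬ (y.1 ∈ H ∧ y.2 = 0) →
      y.1 - x.1 ∈ Y → SameClass σ x y := fun hx hy hxy _ _ hD =>
    ⟨mem_of_sub_mem_hull hmin hp hQ hR hcore hmax htY htH hx hy hxy hD,
      mem_of_sub_mem_hull hmin hp hQ hR hcore hmax htY htH hy hx
        (by rw [← neg_sub]; exact neg_mem hxy) hD⟩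
  obtain ⟨τ, hτ⟩ := exists_core_equiv h0 hcore
  obtain ⟨f, hf⟩ := exists_quotient_equiv hY
  have hτ0 : τ 0 = 0 := by
    have := (hτ 0).symm.trans h0
    exact Subtype.ext (Prod.ext_iff.1 this).1
  have hf0 : f 0 = 0 := by
    have := hf 0
    rw [h0] at this
    exact this
  have hH4 : Nat.card H ≤ 4 := by
    have h1 := AddSubgroup.card_eq_card_quotient_mul_card_addSubgroup H
    have h2 : Nat.card (Q ⧸ H) ≠ 1 := fun h => htH (by
      rw [AddSubgroup.index_eq_one.1 h]
      trivial)
    have h3 : 0 < Nat.card (Q ⧸ H) := Nat.card_pos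
    nlinarith [show 2 ≤ Nat.card (Q ⧸ H) by omega]
  have hY4 : Nat.card (Q ⧸ Y) ≤ 4 := by
    have h1 := AddSubgroup.card_eq_card_quotient_mul_card_addSubgroup Y
    have h2 : Nat.card Y ≠ 1 := fun h => htH (by
      rw [AddSubgroup.card_eq_one.1 h] at htY
      rw [AddSubgroup.mem_bot.1 htY]
      exact H.zero_mem)
    have h3 : 0 < Nat.card Y := Nat.card_pos
    nlinarith [show 2 ≤ Nat.card Y by omega]
  let τ' : H ≃+ H' := ⟨τ, map_add_of_card_le_four (fun x => Subtype.ext (hQ x))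
    (fun x => Subtype.ext (hR x)) hH4 τ hτ0⟩
  let f' : Q ⧸ Y ≃+ R ⧸ Y' := ⟨f, map_add_of_card_le_four
    (fun x => QuotientAddGroup.induction_on x fun x => congrArg _ (hQ x))
    (fun x => QuotientAddGroup.induction_on x fun x => congrArg _ (hR x)) hY4 f hf0⟩
  obtain ⟨ψ, hψ⟩ := exists_hom_extend hQ hR H (H'.subtype.comp (τ' : H →+ H'))
  replace hψ : ∀ h (hh : h ∈ H), ψ h = τ ⟨h, hh⟩ := fun h hh => hψ ⟨h, hh⟩
  obtain ⟨φ, hφH, hφ⟩ := exists_lift_quotient hQ hR (Finite.card_eq.1 hcardQR).some f' H ψ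
    (fun x hx h => by
      rw [hψ x hx] at h
      have : τ ⟨x, hx⟩ = τ 0 := by rw [hτ0]; exact Subtype.ext h
      exact Subtype.ext_iff.1 (τ.injective this))
    (fun x hx => by
      rw [hψ x hx]
      exact ((hf (x, 0)).trans (by rw [hτ ⟨x, hx⟩])).symm)
  refine ⟨φ.prodCongr (AddEquiv.refl _), fun x => SameClass.sameColor h0 ?_⟩
  have hφx : φ.prodCongr (AddEquiv.refl (ZMod p)) x = (φ x.1, x.2) := rfl
  rw [hφx]
  by_cases hx : x.1 ∈ H ∧ x.2 = 0
  · have : σ.symm (φ x.1, x.2) = x := by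
      rw [Equiv.symm_apply_eq, hφH _ hx.1, hψ _ hx.1,
        (congrArg σ (show x = (x.1, 0) from Prod.ext rfl hx.2)).trans (hτ ⟨x.1, hx.1⟩)]
      exact Prod.ext rfl hx.2
    rw [this]
    exact fun _ _ _ => Iff.rfl
  · refine hsame hx (fun hy => hx ?_) ?_
    · have := (hcore.mem_iff h0 _).1 hy
      rw [Equiv.apply_symm_apply] at this
      obtain ⟨h, hh⟩ := τ.surjective ⟨_, this.1⟩
      have h1 : φ h = φ x.1 := by rw [hφH h h.2, hψ h h.2, hh]
      exact ⟨φ.injective h1 ▸ h.2, this.2⟩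
    · rw [← QuotientAddGroup.eq_iff_sub_mem]
      apply f.injective
      rw [hf, Equiv.apply_symm_apply]
      exact hφ x.1

end Hull

section Restriction

variable {Q R : Type*} [AddCommGroup Q] [AddCommGroup R] {p : ℕ}
  {σ : Q × ZMod p ≃ R × ZMod p} {H : AddSubgroup Q} {H' : AddSubgroup R}

theorem exists_restrict (hU : PairedSets σ {x | x.1 ∈ H} {x | x.1 ∈ H'}) (e : Q × ZMod p) :
    ∃ τ : H × ZMod p ≃ H' × ZMod p, ∀ u : H × ZMod p,
      (((τ u).1 : R), (τ u).2) = σ (((u.1 : Q), u.2) + e) - σ e := by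
  have hmem : ∀ u : H × ZMod p, (σ (((u.1 : Q), u.2) + e) - σ e).1 ∈ H' := fun u =>
    (hU _ _).1 (by simp)
  refine ⟨Equiv.ofBijective (fun u => (⟨_, hmem u⟩, (σ (((u.1 : Q), u.2) + e) - σ e).2))
    ⟨fun u v huv => ?_, fun w => ?_⟩, fun u => rfl⟩
  · have h1 : σ (((u.1 : Q), u.2) + e) - σ e = σ (((v.1 : Q), v.2) + e) - σ e :=
      Prod.ext (Subtype.ext_iff.1 (Prod.ext_iff.1 huv).1) (Prod.ext_iff.1 huv).2
    have h2 := add_right_cancel (σ.injective (sub_left_injective h1))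
    exact Prod.ext (Subtype.ext (Prod.ext_iff.1 h2).1) (Prod.ext_iff.1 h2).2
  · obtain ⟨x, hx⟩ := σ.surjective (((w.1 : R), w.2) + σ e)
    have hxe : (x - e).1 ∈ H := (hU e x).2 (by rw [hx, add_sub_cancel_right]; exact w.1.2)
    refine ⟨(⟨_, hxe⟩, (x - e).2), ?_⟩
    have : σ (((x - e).1, (x - e).2) + e) - σ e = ((w.1 : R), w.2) := by
      rw [Prod.mk.eta, sub_add_cancel, hx, add_sub_cancel_right]
    exact Prod.ext (Subtype.ext (Prod.ext_iff.1 this).1) (Prod.ext_iff.1 this).2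

theorem PairedSets.restrict {e : Q × ZMod p} {τ : H × ZMod p ≃ H' × ZMod p}
    (hτ : ∀ u : H × ZMod p, (((τ u).1 : R), (τ u).2) = σ (((u.1 : Q), u.2) + e) - σ e)
    {D : Set (Q × ZMod p)} {D' : Set (R × ZMod p)} (h : PairedSets σ D D') :
    PairedSets τ {u | ((u.1 : Q), u.2) ∈ D} {u | ((u.1 : R), u.2) ∈ D'} := fun u v => by
  have h1 : (((v - u).1 : Q), (v - u).2) = ((v.1 : Q), v.2) + e - (((u.1 : Q), u.2) + e) := by
    rw [add_sub_add_right_eq_sub]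
    rfl
  have h2 : (((τ v - τ u).1 : R), (τ v - τ u).2) =
      σ (((v.1 : Q), v.2) + e) - σ (((u.1 : Q), u.2) + e) := by
    rw [← sub_sub_sub_cancel_right _ _ (σ e), ← hτ, ← hτ]
    rfl
  rw [Set.mem_ofPred_eq, Set.mem_ofPred_eq, h1, h2]
  exact h _ _

end Restriction

section Restriction

variable {Q R : Type*} [AddCommGroup Q] [AddCommGroup R] [Finite Q] {p : ℕ} [Fact p.Prime]
  {σ : Q × ZMod p ≃ R × ZMod p} {H Y : AddSubgroup Q} {H' Y' : AddSubgroup R}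

theorem exists_core_affine (hp : p ≠ 2) (hQ : ∀ x : Q, x + x = 0) (hR : ∀ x : R, x + x = 0)
    (hcore : PairedSets σ {x | x.1 ∈ H ∧ x.2 = 0} {x | x.1 ∈ H' ∧ x.2 = 0})
    (hU : PairedSets σ {x | x.1 ∈ H} {x | x.1 ∈ H'})
    (hY : PairedSets σ {x | x.1 ∈ Y} {x | x.1 ∈ Y'}) (e : Q × ZMod p) :
    ∃ (τ : H ≃ H') (c : ZMod p), c ≠ 0 ∧ τ 0 = 0 ∧
      (∀ h r, SameColor τ h r → ∀ j, SameColor σ (h, j) (r, c * j)) ∧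
      ∀ u : H × ZMod p, (τ u.1 - (σ (((u.1 : Q), u.2) + e) - σ e).1 : R) ∈ Y' := by
  obtain ⟨τ, hτ⟩ := exists_restrict hU e
  have hsnd : PairedSets τ {x | x.2 = 0} {x | x.2 = 0} := by
    simpa using hcore.restrict hτ
  have hYτ : PairedSets τ {x | x.1 ∈ Y.addSubgroupOf H} {x | x.1 ∈ Y'.addSubgroupOf H'} :=
    hY.restrict hτ
  obtain ⟨a, ha, haY, c, d, hc, hcd⟩ := exists_affine_colorAut hsnd hYτ
  let τ₂ := (a.trans τ).trans (Equiv.subRight (τ (a 0)))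
  have hτ₂ : ∀ x, τ₂ x = τ (a x) - τ (a 0) := fun x => rfl
  obtain ⟨τ₀, hz, hcol⟩ := exists_zero_fiber_equiv hp (fun x => Subtype.ext (hQ x))
    (fun x => Subtype.ext (hR x)) hc (fun x => show (τ₂ x).2 = c * x.2 by simp [hτ₂, hcd])
  have hτ00 : τ 0 = 0 := by
    have := hτ 0
    rw [show (((0 : H × ZMod p).1 : Q), (0 : H × ZMod p).2) = 0 from rfl, zero_add, sub_self] at this
    exact Prod.ext (Subtype.ext (Prod.ext_iff.1 this).1) (Prod.ext_iff.1 this).2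
  refine ⟨τ₀, c, hc, ?_, fun h r hr j D D' hD => ?_, fun u => ?_⟩
  · have := (hz 0).symm.trans (hτ₂ 0)
    rw [sub_self] at this
    exact (Prod.ext_iff.1 this).1
  · have h1 : SameColor (a.trans τ) (h, j) (r, c * j) := fun E E' hE =>
      hcol h r hr j E E' fun u v => by
        rw [hτ₂, hτ₂, sub_sub_sub_cancel_right]
        exact hE u v
    exact h1.of_comp_colorAut ha _ _ (hD.restrict hτ)
  · have h1 : ((τ (a (u.1, 0)) - τ u).1 : R) ∈ Y' := (hYτ u (a (u.1, 0))).1 (haY (u.1, 0))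
    have h2 : ((τ (a 0) - τ 0).1 : R) ∈ Y' := (hYτ 0 (a 0)).1 (haY 0)
    rw [hτ00, sub_zero] at h2
    have h3 : (τ₀ u.1, 0) = τ (a (u.1, 0)) - τ (a 0) := (hz u.1).symm.trans (hτ₂ _)
    rw [← hτ u, show τ₀ u.1 = (τ (a (u.1, 0)) - τ (a 0)).1 from (Prod.ext_iff.1 h3).1]
    have h4 := sub_mem h1 h2
    rw [← AddSubgroup.coe_sub, ← Prod.fst_sub, sub_right_comm] at h4
    exact h4

end Restriction

section CoreAboveHull

variable {Q R : Type*} [AddCommGroup Q] [AddCommGroup R] {p : ℕ} [Fact p.Prime]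
  {σ : Q × ZMod p ≃ R × ZMod p} {H Y : AddSubgroup Q} {H' Y' : AddSubgroup R}

theorem hasCI_of_mul_snd (φ : Q ≃+ R) {c : ZMod p} (hc : c ≠ 0)
    (h : ∀ q i, SameColor σ (q, i) (φ q, c * i)) : HasCI σ :=
  ⟨φ.prodCongr (AddAut.mulLeft (Units.mk0 c hc)), fun x => h x.1 x.2⟩

theorem setOf_exists_core_add_mem (hYH : Y ≤ H) :
    {y : Q × ZMod p | ∃ z ∈ {x : Q × ZMod p | x.1 ∈ H ∧ x.2 = 0}, y + z ∈ {x | x.1 ∈ Y}} =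
      {x | x.1 ∈ H} := by
  ext y
  constructor
  · rintro ⟨z, hz, hyz⟩
    exact (H.add_mem_cancel_right hz.1).1 (hYH hyz)
  · intro hy
    refine ⟨(-y.1, 0), ⟨neg_mem hy, rfl⟩, ?_⟩
    simp

theorem pairedSets_setOf_fst_mem (hYH : Y ≤ H) (hYH' : Y' ≤ H')
    (hcore : PairedSets σ {x | x.1 ∈ H ∧ x.2 = 0} {x | x.1 ∈ H' ∧ x.2 = 0})
    (hY : PairedSets σ {x | x.1 ∈ Y} {x | x.1 ∈ Y'}) :
    PairedSets σ {x | x.1 ∈ H} {x | x.1 ∈ H'} := by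
  rw [← setOf_exists_core_add_mem hYH, ← setOf_exists_core_add_mem hYH']
  exact hcore.exists_add_mem hY

theorem hull_le_core [Finite Q] (h0 : σ 0 = 0) (hYH : Y ≤ H)
    (hcore : PairedSets σ {x | x.1 ∈ H ∧ x.2 = 0} {x | x.1 ∈ H' ∧ x.2 = 0})
    (hY : PairedSets σ {x | x.1 ∈ Y} {x | x.1 ∈ Y'}) : Y' ≤ H' := by
  have hQR := card_eq_of_equiv_prod_zmod σ
  have : Finite R := Nat.finite_of_card_ne_zero (hQR ▸ Nat.card_pos.ne')
  obtain ⟨f, -⟩ := exists_quotient_equiv hY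
  have h1 := AddSubgroup.card_eq_card_quotient_mul_card_addSubgroup Y
  have h2 := AddSubgroup.card_eq_card_quotient_mul_card_addSubgroup Y'
  rw [← hQR, ← Nat.card_congr f, h1] at h2
  have h3 := Nat.eq_of_mul_eq_mul_left Nat.card_pos h2
  have hpair : PairedSets σ {x | x.1 ∈ Y ∧ x.2 = 0} {x | x.1 ∈ H' ⊓ Y' ∧ x.2 = 0} := by
    have e1 : ({x | x.1 ∈ H ∧ x.2 = 0} ∩ {x | x.1 ∈ Y} : Set (Q × ZMod p)) =
        {x | x.1 ∈ Y ∧ x.2 = 0} := by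
      ext x
      exact ⟨fun h => ⟨h.2, h.1.2⟩, fun h => ⟨⟨hYH h.1, h.2⟩, h.1⟩⟩
    have e2 : ({x | x.1 ∈ H' ∧ x.2 = 0} ∩ {x | x.1 ∈ Y'} : Set (R × ZMod p)) =
        {x | x.1 ∈ H' ⊓ Y' ∧ x.2 = 0} := by
      ext x
      exact ⟨fun h => ⟨⟨h.1.1, h.2⟩, h.1.2⟩, fun h => ⟨⟨h.1.1, h.2⟩, h.1.2⟩⟩
    rw [← e1, ← e2]
    exact hcore.inter hY
  obtain ⟨τ, -⟩ := exists_core_equiv h0 hpair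
  have h4 : H' ⊓ Y' = Y' := AddSubgroup.eq_of_le_of_card_ge inf_le_right
    (by rw [← Nat.card_congr τ, h3])
  rw [← h4]
  exact inf_le_left

theorem mem_iff_of_sub_mem_right (h0 : σ 0 = 0)
    (hY : PairedSets σ {x | x.1 ∈ Y} {x | x.1 ∈ Y'}) {D : Set (Q × ZMod p)}
    {D' : Set (R × ZMod p)} (hD : PairedSets σ D D')
    (hsat : ∀ x y : Q × ZMod p, y.1 - x.1 ∈ Y → (x ∈ D ↔ y ∈ D)) (x y : R × ZMod p)
    (hxy : y.1 - x.1 ∈ Y') : x ∈ D' ↔ y ∈ D' := by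
  have h1 := hsat (σ.symm x) (σ.symm y) ((hY _ _).2 (by simpa using hxy))
  rwa [hD.mem_iff h0, hD.mem_iff h0, Equiv.apply_symm_apply, Equiv.apply_symm_apply] at h1

/-- Colours that are unions of `Y`-cosets are respected by any map respecting colours modulo
`Y`. -/
theorem mem_iff_of_sameColor_quotient (h0 : σ 0 = 0)
    (hY : PairedSets σ {x | x.1 ∈ Y} {x | x.1 ∈ Y'}) {f : Q ⧸ Y ≃ R ⧸ Y'}
    (hf : ∀ x : Q × ZMod p, f (x.1 : Q ⧸ Y) = ((σ x).1 : R ⧸ Y')) {D : Set (Q × ZMod p)}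
    {D' : Set (R × ZMod p)} (hD : PairedSets σ D D')
    (hsat : ∀ x y : Q × ZMod p, y.1 - x.1 ∈ Y → (x ∈ D ↔ y ∈ D)) {x : Q × ZMod p}
    {y : R × ZMod p} (hxy : SameColor f (x.1 : Q ⧸ Y) (y.1 : R ⧸ Y')) : x ∈ D ↔ y ∈ D' := by
  have hsat' := mem_iff_of_sub_mem_right h0 hY hD hsat
  have h1 : ∀ x : Q × ZMod p,
      (x.1 : Q ⧸ Y) ∈ {z : Q ⧸ Y | ∃ w ∈ D, (w.1 : Q ⧸ Y) = z} ↔ x ∈ D := fun x =>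
    ⟨fun ⟨w, hw, h⟩ => (hsat w x (QuotientAddGroup.eq_iff_sub_mem.1 h.symm)).1 hw,
      fun h => ⟨x, h, rfl⟩⟩
  have h2 : ∀ x : R × ZMod p,
      (x.1 : R ⧸ Y') ∈ {z : R ⧸ Y' | ∃ w ∈ D', (w.1 : R ⧸ Y') = z} ↔ x ∈ D' := fun x =>
    ⟨fun ⟨w, hw, h⟩ => (hsat' w x (QuotientAddGroup.eq_iff_sub_mem.1 h.symm)).1 hw,
      fun h => ⟨x, h, rfl⟩⟩
  rw [← h1, ← h2]
  refine hxy _ _ fun u v => ?_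
  induction u using QuotientAddGroup.induction_on with | H u => ?_
  induction v using QuotientAddGroup.induction_on with | H v => ?_
  rw [hf (u, 0), hf (v, 0)]
  exact (h1 ((v, 0) - (u, 0))).trans ((hD _ _).trans (h2 _).symm)

theorem eq_of_card_le_two {K : Type*} [AddCommGroup K] [Finite K] (hK : Nat.card K ≤ 2) {a b : K}
    (ha : a ≠ 0) (hb : b ≠ 0) : a = b := by
  have h1 : Nat.card K ≠ 1 := fun h => ha (by
    have := (Nat.card_eq_one_iff_unique.1 h).1
    exact Subsingleton.elim _ _)
  have h2 : 0 < Nat.card K := Nat.card_pos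
  obtain ⟨y, -, hy⟩ := (Nat.card_eq_two_iff' (0 : K)).1 (by omega)
  rw [hy a ha, hy b hb]

variable [Finite Q] (hp : p ≠ 2) (hQ : ∀ x : Q, x + x = 0) (hR : ∀ x : R, x + x = 0)
  (h0 : σ 0 = 0) (hcard : Nat.card Q = 8)
  (hcore : PairedSets σ {x | x.1 ∈ H ∧ x.2 = 0} {x | x.1 ∈ H' ∧ x.2 = 0})
  (hU : PairedSets σ {x | x.1 ∈ H} {x | x.1 ∈ H'})
  (hY : PairedSets σ {x | x.1 ∈ Y} {x | x.1 ∈ Y'})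

include hp hQ hR h0 hcore hU hY

include hcard in
theorem hasCI_of_core_eq_top (hH : H = ⊤) : HasCI σ := by
  obtain ⟨τ, c, hc, -, hcol, -⟩ := exists_core_affine hp hQ hR hcore hU hY 0
  subst hH
  have hH' : H' = ⊤ := by
    rw [eq_top_iff]
    intro r _
    have := (hU.mem_iff h0 (σ.symm (r, 0))).1 trivial
    rwa [Equiv.apply_symm_apply] at this
  subst hH'
  obtain ⟨φ, hφ⟩ := hasCI_of_exponent_two (n := 3) (by norm_num) τ (fun x => Subtype.ext (hQ x))
    (fun x => Subtype.ext (hR x)) (by rw [AddSubgroup.card_top, hcard]; norm_num)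
  exact hasCI_of_mul_snd ((AddSubgroup.topEquiv.symm.trans φ).trans AddSubgroup.topEquiv) hc
    fun q i => hcol ⟨q, trivial⟩ _ (hφ _) i

omit h0 in
theorem exists_core_addEquiv (hH : Nat.card H ≤ 4) (e : Q × ZMod p) :
    ∃ (φ : H ≃+ H') (c : ZMod p), c ≠ 0 ∧
      (∀ (h : H) j, SameColor σ (h, j) (φ h, c * j)) ∧
      ∀ u : H × ZMod p, (φ u.1 - (σ (((u.1 : Q), u.2) + e) - σ e).1 : R) ∈ Y' := by
  obtain ⟨τ, c, hc, hτ0, hcol, hτ⟩ := exists_core_affine hp hQ hR hcore hU hY e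
  exact ⟨⟨τ, map_add_of_card_le_four (fun x => Subtype.ext (hQ x))
    (fun x => Subtype.ext (hR x)) hH τ hτ0⟩, c, hc,
    fun h j => hcol h (τ h) (fun D D' hD => hD.mem_iff hτ0 h) j, hτ⟩

variable (hout : ∀ x y : Q × ZMod p, x.1 ∉ H → y.1 - x.1 ∈ Y → SameClass σ x y)

include hout hcard

theorem hasCI_of_card_core_eq_four (hH : Nat.card H = 4) : HasCI σ := by
  have hQR := card_eq_of_equiv_prod_zmod σ
  have : Finite R := Nat.finite_of_card_ne_zero (by omega)
  have hindex : H.index = 2 := by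
    have := H.card_mul_index
    rw [hcard, hH] at this
    omega
  obtain ⟨q, hq⟩ : ∃ q, q ∉ H := by
    by_contra! h
    rw [AddSubgroup.index_eq_one.2 ((AddSubgroup.eq_top_iff' H).2 h)] at hindex
    omega
  obtain ⟨φ₀, c, hc, hcol, hφ₀⟩ := exists_core_addEquiv hp hQ hR hcore hU hY hH.le (q, 0)
  obtain ⟨ψ, hψ⟩ := exists_hom_extend hQ hR H (H'.subtype.comp (φ₀ : H →+ H'))
  replace hψ : ∀ h (hh : h ∈ H), ψ h = φ₀ ⟨h, hh⟩ := fun h hh => hψ ⟨h, hh⟩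
  have hr : (σ (q, 0)).1 ∉ H' := fun h => hq ((hU.mem_iff h0 _).2 h)
  obtain ⟨ψ', hψ'H, hψ'q, hinj⟩ := exists_hom_extend_one hQ hR H ψ
    (fun x hx h => by
      rw [hψ x hx] at h
      exact Subtype.ext_iff.1 (φ₀.injective ((Subtype.ext h).trans (map_zero φ₀).symm) :
        (⟨x, hx⟩ : H) = 0)) hq (r := (σ (q, 0)).1)
    (fun x hx h => hr (by
      rw [← h, hψ x hx]
      exact (φ₀ ⟨x, hx⟩).2))
  have hcoset : ∀ x, x ∉ H → x - q ∈ H := fun x hx => by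
    rw [sub_eq_add_neg, AddSubgroup.add_mem_iff_of_index_two hindex, neg_mem_iff]
    exact iff_of_false hx hq
  have hbij : Function.Bijective ψ' := by
    have hi : Function.Injective ψ' := (injective_iff_map_eq_zero _).2 fun x hx =>
      hinj x ((em (x ∈ H)).imp_right (hcoset x)) hx
    exact (Nat.bijective_iff_injective_and_card _).2 ⟨hi, hQR⟩
  refine hasCI_of_mul_snd (AddEquiv.ofBijective ψ' hbij) hc fun x i => ?_
  rw [AddEquiv.ofBijective_apply]
  by_cases hx : x ∈ H
  · rw [hψ'H x hx, hψ x hx]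
    exact hcol ⟨x, hx⟩ i
  · refine SameClass.sameColor h0 (hout _ _ hx ((hY _ _).2 ?_))
    rw [Equiv.apply_symm_apply]
    have h1 := hφ₀ (⟨_, hcoset x hx⟩, i)
    simp only [Prod.mk_add_mk, sub_add_cancel, add_zero] at h1
    rw [← hψ, ← hψ'H _ (hcoset x hx), map_sub, hψ'q, Prod.fst_sub, sub_sub_sub_cancel_right] at h1
    exact h1

theorem hasCI_of_card_core_le_two (hYH : Y ≤ H) (hH : Nat.card H ≤ 2) : HasCI σ := by
  have hQR := card_eq_of_equiv_prod_zmod σ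
  have : Finite R := Nat.finite_of_card_ne_zero (by omega)
  obtain ⟨φ₀, c, hc, hcol, -⟩ := exists_core_addEquiv hp hQ hR hcore hU hY (by omega) 0
  obtain ⟨f, hf⟩ := exists_quotient_equiv hY
  obtain ⟨n, hn, hcardY⟩ := (Nat.dvd_prime_pow Nat.prime_two).1
    (show Nat.card (Q ⧸ Y) ∣ 2 ^ 3 by
      rw [show 2 ^ 3 = Nat.card Q by omega]
      exact AddSubgroup.card_quotient_dvd_card Y)
  obtain ⟨f', hf'⟩ := hasCI_of_exponent_two (by omega : n ≤ 4) f
    (fun x => QuotientAddGroup.induction_on x fun x => congrArg _ (hQ x))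
    (fun x => QuotientAddGroup.induction_on x fun x => congrArg _ (hR x)) hcardY
  obtain ⟨φ, -, hφ⟩ := exists_lift_quotient hQ hR (Finite.card_eq.1 hQR).some f' ⊥ 0
    (fun x hx _ => AddSubgroup.mem_bot.1 hx) (fun x hx => by
      rw [AddSubgroup.mem_bot.1 hx]
      simp)
  have hφcol : ∀ x : Q, SameColor f (x : Q ⧸ Y) (φ x : R ⧸ Y') := fun x => hφ x ▸ hf' _
  have hsatU : ∀ x y : Q × ZMod p, y.1 - x.1 ∈ Y → (x.1 ∈ H ↔ y.1 ∈ H) := fun x y hxy => by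
    rw [← H.add_mem_cancel_left (hYH hxy), sub_add_cancel]
  have hφH : ∀ q, q ∈ H ↔ φ q ∈ H' := fun q =>
    mem_iff_of_sameColor_quotient h0 hY hf hU hsatU (x := (q, 0)) (y := (φ q, 0)) (hφcol q)
  have hφφ₀ : ∀ (q : Q) (hq : q ∈ H), φ q = φ₀ ⟨q, hq⟩ := by
    intro q hq
    by_cases hq0 : q = 0
    · subst hq0
      rw [map_zero, show (⟨0, hq⟩ : H) = 0 from rfl, map_zero, AddSubgroup.coe_zero]
    · have := eq_of_card_le_two (a := ⟨φ q, (hφH q).1 hq⟩) (b := φ₀ ⟨q, hq⟩)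
        (by rwa [← Nat.card_congr φ₀.toEquiv])
        (fun h => hq0 ((map_eq_zero_iff φ φ.injective).1 (Subtype.ext_iff.1 h)))
        (fun h => hq0 (Subtype.ext_iff.1 ((map_eq_zero_iff φ₀ φ₀.injective).1 h)))
      exact Subtype.ext_iff.1 this
  refine hasCI_of_mul_snd φ hc fun q i => ?_
  by_cases hq : q ∈ H
  · rw [hφφ₀ q hq]
    exact hcol ⟨q, hq⟩ i
  · intro D D' hD
    have h1 := mem_iff_of_sameColor_quotient h0 hY hf (hD.diff hU)
      (fun x y hxy => by
        by_cases hx : x.1 ∈ H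
        · exact iff_of_false (fun h => h.2 hx) (fun h => h.2 ((hsatU x y hxy).1 hx))
        · exact hout x y hx hxy _ _ (hD.diff hU))
      (x := (q, i)) (y := (φ q, c * i)) (hφcol q)
    exact ⟨fun h => (h1.1 ⟨h, hq⟩).1, fun h => (h1.2 ⟨h, fun h' => hq ((hφH q).2 h')⟩).1⟩

end CoreAboveHull

section Main

theorem hasCI_prod_zmod {Q R : Type*} [AddCommGroup Q] [AddCommGroup R] {p : ℕ} [Fact p.Prime]
    (hp : p ≠ 2) (hQ : ∀ x : Q, x + x = 0) (hR : ∀ x : R, x + x = 0) (hcard : Nat.card Q = 8)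
    (σ : Q × ZMod p ≃ R × ZMod p) : HasCI σ := by
  have : Finite Q := Nat.finite_of_card_ne_zero (by omega)
  apply HasCI.of_sub_const (w := σ 0)
  have h0 : σ.trans (Equiv.subRight (σ 0)) 0 = 0 := by simp
  generalize σ.trans (Equiv.subRight (σ 0)) = σ at h0
  obtain ⟨H, H', hcore, hmax⟩ := exists_core σ
  obtain ⟨Y, Y', hY, hmin⟩ := exists_hull hp hQ hR h0
  by_cases hYH : Y ≤ H
  · have hU := pairedSets_setOf_fst_mem hYH (hull_le_core h0 hYH hcore hY) hcore hY
    have hout : ∀ x y : Q × ZMod p, x.1 ∉ H → y.1 - x.1 ∈ Y → SameClass σ x y := by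
      intro x y hx hxy D D' hD
      have hy : y.1 ∉ H := fun h => hx (by simpa using sub_mem h (hYH hxy))
      have := mem_iff_of_sub_mem_hull hmin (hD.diff hU) (fun x hx y hxy =>
        ⟨by
          have := mem_of_notMem_core hp hQ hR hmax hD hx.2 hx.1 y.2
          rwa [← hxy] at this, by
          rw [Set.mem_ofPred_eq, hxy]
          exact hx.2⟩) hxy
      exact ⟨fun h => (this.1 ⟨h, hx⟩).1, fun h => (this.2 ⟨h, hy⟩).1⟩
    obtain ⟨n, hn, hH⟩ := (Nat.dvd_prime_pow Nat.prime_two).1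
      (show Nat.card H ∣ 2 ^ 3 by
        rw [show 2 ^ 3 = Nat.card Q by omega]
        exact AddSubgroup.card_addSubgroup_dvd_card H)
    by_cases hn1 : n ≤ 1
    · refine hasCI_of_card_core_le_two hp hQ hR h0 hcard hcore hU hY hout hYH ?_
      interval_cases n <;> omega
    · by_cases hn2 : n = 2
      · subst hn2
        exact hasCI_of_card_core_eq_four hp hQ hR h0 hcard hcore hU hY hout hH
      · obtain rfl : n = 3 := by omega
        exact hasCI_of_core_eq_top hp hQ hR h0 hcard hcore hU hY
          (AddSubgroup.eq_top_of_card_eq H (by omega))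
  · obtain ⟨t, htY, htH⟩ := SetLike.not_le_iff_exists.1 hYH
    exact hasCI_of_not_hull_le_core hmin hp hQ hR hcore hmax hY h0 hcard htY htH

theorem isCIGroupColorBinary_of_hasCI {V : Type*} [AddCommGroup V]
    (h : ∀ σ : V ≃ V, HasCI σ) : IsCIGroupColorBinary (Multiplicative V) := by
  intro c E E' _ _ hE hE' ⟨σ, hσ⟩
  have key : ∀ {F : Fin c → Set (Multiplicative V × Multiplicative V)},
      IsCayleyColorBinary (Multiplicative V) F → ∀ i u v, (u, v) ∈ F i ↔ (1, u⁻¹ * v) ∈ F i := by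
    intro F hF i u v
    rw [← hF u⁻¹ i u v, Equiv.coe_mulLeft]
    simp only [inv_mul_cancel]
  let σ' : V ≃ V := Multiplicative.ofAdd.trans (σ.trans Multiplicative.toAdd)
  obtain ⟨φ, hφ⟩ := h σ'
  have hpair : ∀ i, PairedSets σ' {x | (1, Multiplicative.ofAdd x) ∈ E i}
      {x | (1, Multiplicative.ofAdd x) ∈ E' i} := by
    intro i u v
    have h1 := key hE i (Multiplicative.ofAdd u) (Multiplicative.ofAdd v)
    have h2 := key hE' i (σ (Multiplicative.ofAdd u)) (σ (Multiplicative.ofAdd v))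
    have h3 := (h1.symm.trans ((hσ i _ _).symm.trans h2))
    rw [sub_eq_neg_add, sub_eq_neg_add]
    exact h3
  refine ⟨AddEquiv.toMultiplicative φ, fun i u v => ?_⟩
  rw [key hE', key hE]
  have h1 := hφ (-u.toAdd + v.toAdd) _ _ (hpair i)
  rw [map_add, map_neg] at h1
  exact h1.symm

end Main

theorem statement_14 (p : ℕ) (hp : p.Prime) :
    IsCIGroupColorBinary (Multiplicative ((ZMod 2 × ZMod 2 × ZMod 2) × ZMod p)) := by
  have h2 : ∀ x : ZMod 2, x + x = 0 := by decide
  have hQ : ∀ x : ZMod 2 × ZMod 2 × ZMod 2, x + x = 0 := fun x =>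
    Prod.ext (h2 _) (Prod.ext (h2 _) (h2 _))
  have : Fact p.Prime := ⟨hp⟩
  refine isCIGroupColorBinary_of_hasCI fun σ => ?_
  by_cases hp2 : p = 2
  · subst hp2
    have hV : ∀ x : (ZMod 2 × ZMod 2 × ZMod 2) × ZMod 2, x + x = 0 := fun x =>
      Prod.ext (hQ _) (h2 _)
    exact hasCI_of_exponent_two (n := 4) le_rfl σ hV hV (by simp)
  · exact hasCI_prod_zmod hp2 hQ hQ (by simp) σ
end

section
/- For every prime p, the group ℤ_2² × ℤ_p is a CI-group with respect to color ternary relational structures if and only if p ≠ 3. -/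
/-- `σ` is an isomorphism from the color ternary relational structure `(V, E)`
to `(V, E')`. -/
def IsColorTernaryIso {V : Type*} {c : ℕ} (σ : Equiv.Perm V)
    (E E' : Fin c → Set (V × V × V)) : Prop :=
  ∀ i : Fin c, ∀ u v w : V, (σ u, σ v, σ w) ∈ E' i ↔ (u, v, w) ∈ E i

/-- `(G, E)` is a Cayley color ternary relational structure of `G`, i.e. the left
regular representation of `G` consists of automorphisms. -/
def IsCayleyColorTernary (G : Type*) [Group G] {c : ℕ}
    (E : Fin c → Set (G × G × G)) : Prop :=
  ∀ g : G, IsColorTernaryIso (Equiv.mulLeft g) E E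

/-- `G` is a CI-group with respect to color ternary relational structures. -/
def IsCIGroupColorTernary (G : Type*) [Group G] : Prop :=
  ∀ (c : ℕ) (E E' : Fin c → Set (G × G × G)),
    Pairwise (Function.onFun Disjoint E) → Pairwise (Function.onFun Disjoint E') →
    IsCayleyColorTernary G E → IsCayleyColorTernary G E' →
    (∃ σ : Equiv.Perm G, IsColorTernaryIso σ E E') →
    ∃ φ : G ≃* G, IsColorTernaryIso φ.toEquiv E E'

open Equiv

/-- A permutation group is closed under the ternary relations it preserves. -/
def IsThreeClosed {X : Type*} (A : Subgroup (Perm X)) : Prop :=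
  ∀ σ : Perm X, (∀ u v w, ∃ a ∈ A, a u = σ u ∧ a v = σ v ∧ a w = σ w) → σ ∈ A

/-- The automorphism group of a color ternary relational structure. -/
def colorTernaryAut {X : Type*} {c : ℕ} (E : Fin c → Set (X × X × X)) : Subgroup (Perm X) where
  carrier := {σ | IsColorTernaryIso σ E E}
  mul_mem' {a b} ha hb i u v w := by
    rw [Perm.mul_apply, Perm.mul_apply, Perm.mul_apply, ha, hb]
  one_mem' i u v w := Iff.rfl
  inv_mem' {a} ha i u v w := by
    rw [← ha]; simp

theorem isThreeClosed_colorTernaryAut {X : Type*} {c : ℕ} (E : Fin c → Set (X × X × X)) :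
    IsThreeClosed (colorTernaryAut E) := by
  intro σ h i u v w
  obtain ⟨a, ha, hu, hv, hw⟩ := h u v w
  rw [← hu, ← hv, ← hw]
  exact ha i u v w

/-- The group-theoretic form of the CI property for ternary structures on an additive group:
two regular copies in a three-closed group are conjugate in that group. -/
def IsConjugating {X : Type*} [AddGroup X] (A : Subgroup (Perm X)) (σ : Perm X) : Prop :=
  ∃ T ∈ A, ∀ g, ∃ h, T * Equiv.addLeft g = σ⁻¹ * Equiv.addLeft h * σ * T

theorem conj_mem_colorTernaryAut {X : Type*} {c : ℕ} {E E' : Fin c → Set (X × X × X)}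
    {σ τ : Perm X} (hτ : IsColorTernaryIso τ E' E') (hσ : IsColorTernaryIso σ E E') :
    σ⁻¹ * τ * σ ∈ colorTernaryAut E := by
  intro i u v w
  rw [← hσ i u v w, ← hτ i (σ u) (σ v) (σ w), ← hσ]
  simp

theorem exists_addEquiv_isColorTernaryIso {X : Type*} [AddCommGroup X] {c : ℕ}
    {E E' : Fin c → Set (X × X × X)} (hE' : ∀ g, IsColorTernaryIso (Equiv.addLeft g) E' E')
    {σ : Perm X} (hσ : IsColorTernaryIso σ E E') (H : IsConjugating (colorTernaryAut E) σ) :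
    ∃ φ : X ≃+ X, IsColorTernaryIso φ.toEquiv E E' := by
  obtain ⟨T, hT, hT'⟩ := H
  have key (g x : X) : σ (T (g + x)) = σ (T g) - σ (T 0) + σ (T x) := by
    obtain ⟨h, hh⟩ := hT' g
    have h3 : ∀ x, σ (T (g + x)) = h + σ (T x) := fun x => by
      have := congrArg (fun f : Perm X => σ (f x)) hh
      simpa using this
    have h0 := h3 0
    rw [add_zero] at h0
    rw [h3 x, h0, add_sub_cancel_right]
  let φ : X ≃+ X :=
    { (T.trans σ).trans (Equiv.subRight (σ (T 0))) with
      map_add' := fun g x => by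
        simp only [Equiv.toFun_as_coe, Equiv.trans_apply, Equiv.subRight_apply, key g x]
        abel }
  refine ⟨φ, fun i u v w => ?_⟩
  have e2 (x : X) : φ.toEquiv x = Equiv.addLeft (-σ (T 0)) (σ (T x)) := by
    change σ (T x) - σ (T 0) = -σ (T 0) + σ (T x)
    rw [neg_add_eq_sub]
  rw [e2, e2, e2, hE', hσ]
  exact hT i u v w

theorem isCIGroupColorTernary_of_isConjugating {X : Type*} [AddCommGroup X]
    (H : ∀ A : Subgroup (Perm X), IsThreeClosed A → (∀ g, Equiv.addLeft g ∈ A) →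
      ∀ σ : Perm X, (∀ g, σ⁻¹ * Equiv.addLeft g * σ ∈ A) → IsConjugating A σ) :
    IsCIGroupColorTernary (Multiplicative X) := by
  intro c E E' _ _ hE hE' ⟨σ, hσ⟩
  obtain ⟨φ, hφ⟩ := exists_addEquiv_isColorTernaryIso (X := X) (E := E) (E' := E') (σ := σ)
    (fun g => hE' (Multiplicative.ofAdd g)) hσ
    (H _ (isThreeClosed_colorTernaryAut _) (fun g => hE (Multiplicative.ofAdd g)) σ
      (fun g => conj_mem_colorTernaryAut (hE' (Multiplicative.ofAdd g)) hσ))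
  exact ⟨AddEquiv.toMultiplicative φ, hφ⟩

theorem IsConjugating.of_mul {X : Type*} [AddGroup X] {A : Subgroup (Perm X)} {σ a : Perm X}
    (ha : a ∈ A) (h : IsConjugating A (σ * a)) : IsConjugating A σ := by
  obtain ⟨T, hT, hT'⟩ := h
  refine ⟨a * T, A.mul_mem ha hT, fun g => ?_⟩
  obtain ⟨h, hh⟩ := hT' g
  refine ⟨h, ?_⟩
  rw [mul_assoc, hh]
  group

theorem exists_conj_mem_isPGroup {G : Type*} [Group G] [Finite G] (p : ℕ) [Fact p.Prime]
    (A Q R : Subgroup G) (hQ : Q ≤ A) (hR : R ≤ A) (hQp : IsPGroup p Q) (hRp : IsPGroup p R) :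
    ∃ a ∈ A, ∃ P : Subgroup G, P ≤ A ∧ IsPGroup p P ∧ Q ≤ P ∧ ∀ r ∈ R, a⁻¹ * r * a ∈ P := by
  have hQ' : IsPGroup p (Q.subgroupOf A) := hQp.of_equiv (Subgroup.subgroupOfEquivOfLe hQ).symm
  have hR' : IsPGroup p (R.subgroupOf A) := hRp.of_equiv (Subgroup.subgroupOfEquivOfLe hR).symm
  obtain ⟨S, hS⟩ := hQ'.exists_le_sylow
  obtain ⟨S', hS'⟩ := hR'.exists_le_sylow
  obtain ⟨a, ha⟩ := MulAction.exists_smul_eq A S S'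
  refine ⟨a, a.2, (S : Subgroup A).map A.subtype, Subgroup.map_subtype_le _, S.2.map _, ?_, ?_⟩
  · intro q hq
    exact ⟨⟨q, hQ hq⟩, hS hq, rfl⟩
  · intro r hr
    have h1 : (⟨r, hR hr⟩ : A) ∈ a • S := by
      rw [ha]; exact hS' hr
    refine ⟨a⁻¹ * ⟨r, hR hr⟩ * a, ?_, rfl⟩
    rw [← SetLike.mem_coe, Sylow.coe_smul, Set.mem_smul_set_iff_inv_smul_mem] at h1
    simpa [MulAut.smul_def] using h1

/-- The predicate `y = (N v, 0)`, `x = (v, 0)` or `x = (v, 1)`, `y = (N ^ e v, 2)`, where `N` is an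
automorphism of order 3 of the Klein four-group and `e` is 2 or 1 according to `b`. -/
def twistRel (b : Bool) (x y : (ZMod 2 × ZMod 2) × ZMod 3) : Prop :=
  (x.2 = 0 ∧ y = ((x.1.1 + x.1.2, x.1.1), 0)) ∨
    (x.2 = 1 ∧ y = (bif b then (x.1.2, x.1.1 + x.1.2) else (x.1.1 + x.1.2, x.1.1), 2))

instance (b : Bool) (x y : (ZMod 2 × ZMod 2) × ZMod 3) : Decidable (twistRel b x y) :=
  inferInstanceAs (Decidable (_ ∨ _))

/-- The permutation `(v, k) ↦ (N ^ (2 * k) v, k)`. -/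
def twistFun (x : (ZMod 2 × ZMod 2) × ZMod 3) : (ZMod 2 × ZMod 2) × ZMod 3 :=
  if x.2 = 0 then x else
    if x.2 = 1 then ((x.1.2, x.1.1 + x.1.2), 1) else ((x.1.1 + x.1.2, x.1.1), 2)

theorem twistFun_injective : Function.Injective twistFun := by
  unfold Function.Injective
  decide +kernel

theorem twistRel_twistFun (u v w : (ZMod 2 × ZMod 2) × ZMod 3) :
    twistRel false (twistFun v - twistFun u) (twistFun w - twistFun u) ↔
      twistRel true (v - u) (w - u) := by
  revert u v w
  decide +kernel

theorem not_twistRel_false : ∀ a b c : (ZMod 2 × ZMod 2) × ZMod 3, a ≠ 0 →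
    twistRel false a (a + b) → twistRel false b a → twistRel false c (c + c) →
    twistRel false (c + a) (c + c + b) → False := by
  decide +kernel

theorem not_isCIGroupColorTernary_three :
    ¬ IsCIGroupColorTernary (Multiplicative ((ZMod 2 × ZMod 2) × ZMod 3)) := by
  intro H
  let S (b : Bool) (_ : Fin 1) : Set (Multiplicative ((ZMod 2 × ZMod 2) × ZMod 3) ×
      Multiplicative ((ZMod 2 × ZMod 2) × ZMod 3) × Multiplicative ((ZMod 2 × ZMod 2) × ZMod 3)) :=
    {t | twistRel b (t.2.1.toAdd - t.1.toAdd) (t.2.2.toAdd - t.1.toAdd)}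
  have hdisj (b : Bool) : Pairwise (Function.onFun Disjoint (S b)) :=
    fun i j hij => absurd (Subsingleton.elim i j) hij
  have hcay (b : Bool) : IsCayleyColorTernary _ (S b) := by
    intro g i u v w
    simp [S]
  obtain ⟨φ, hφ⟩ := H 1 (S true) (S false) (hdisj _) (hdisj _) (hcay _) (hcay _)
    ⟨(Equiv.ofBijective twistFun (Finite.injective_iff_bijective.1 twistFun_injective) :
      Perm ((ZMod 2 × ZMod 2) × ZMod 3)), fun i u v w => twistRel_twistFun u v w⟩
  let ψ : (ZMod 2 × ZMod 2) × ZMod 3 ≃+ (ZMod 2 × ZMod 2) × ZMod 3 := MulEquiv.toAdditive φ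
  have h (v w) : twistRel false (ψ v) (ψ w) ↔ twistRel true v w := by
    have := hφ 0 1 (Multiplicative.ofAdd v) (Multiplicative.ofAdd w)
    simp [S] at this
    exact this
  refine not_twistRel_false (ψ ((1, 0), 0)) (ψ ((0, 1), 0)) (ψ ((0, 0), 1)) ?_ ?_ ?_ ?_ ?_
  · rw [Ne, EmbeddingLike.map_eq_zero_iff]
    decide
  all_goals
    simp only [← map_add, h]
    decide

/-- The sign characters of the Klein four-group. -/
def kleinChar (m i : ZMod 2 × ZMod 2) : ℤ :=
  if m.1 * i.1 + m.2 * i.2 = 0 then 1 else -1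

theorem kleinChar_add : ∀ m i j, kleinChar m (i + j) = kleinChar m i * kleinChar m j := by
  decide +kernel

theorem kleinChar_mul_self : ∀ m i, kleinChar m i * kleinChar m i = 1 := by
  decide +kernel

theorem kleinChar_eq_or_neg : ∀ m i j,
    kleinChar m i = kleinChar m j ∨ kleinChar m i = -kleinChar m j := by
  decide +kernel

theorem sum_kleinChar_mul : ∀ t i,
    ∑ m, kleinChar m t * kleinChar m i = if t = i then 4 else 0 := by
  decide +kernel

theorem four_mul_eq_sum_kleinChar {R : Type*} [CommRing R] (b : ZMod 2 × ZMod 2 → R)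
    (i : ZMod 2 × ZMod 2) :
    4 * b i = ∑ m, (∑ t, (kleinChar m t : R) * b t) * kleinChar m i := by
  have h (t) : ∑ m, (kleinChar m t : R) * kleinChar m i = if t = i then 4 else 0 := by
    exact_mod_cast congrArg (Int.cast (R := R)) (sum_kleinChar_mul t i)
  simp only [Finset.sum_mul]
  rw [Finset.sum_comm]
  have h' (t m) : (kleinChar m t : R) * b t * kleinChar m i =
      b t * (kleinChar m t * kleinChar m i) := by ring
  simp only [h', ← Finset.mul_sum, h]
  simp [mul_comm]

section Separation

variable {p : ℕ} [Fact p.Prime] {C : Submodule (ZMod p) (ZMod 2 × ZMod 2 → ZMod p)}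

theorem sum_smul_kleinChar_mem (hC : ∀ b ∈ C, ∀ t, (fun i => b (i + t)) ∈ C)
    {b : ZMod 2 × ZMod 2 → ZMod p} (hb : b ∈ C) (m : ZMod 2 × ZMod 2) :
    (∑ t, (kleinChar m t : ZMod p) * b t) • (fun i => (kleinChar m i : ZMod p)) ∈ C := by
  have h : (∑ t, (kleinChar m t : ZMod p) * b t) • (fun i => (kleinChar m i : ZMod p)) =
      ∑ t, (kleinChar m t : ZMod p) • fun i => b (i + t) := by
    ext i
    simp only [Pi.smul_apply, smul_eq_mul, Finset.sum_apply]
    rw [Finset.sum_mul, ← Equiv.sum_comp (Equiv.addLeft i)]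
    refine Finset.sum_congr rfl fun t _ => ?_
    have hs : (kleinChar m i : ZMod p) * kleinChar m i = 1 := by
      exact_mod_cast congrArg (Int.cast (R := ZMod p)) (kleinChar_mul_self m i)
    simp only [Equiv.coe_addLeft, kleinChar_add, Int.cast_mul]
    linear_combination (kleinChar m t * b (i + t)) * hs
  rw [h]
  exact C.sum_mem fun t _ => C.smul_mem _ (hC b hb t)

theorem exists_kleinChar_mem_ne (hp : p ≠ 2) (hC : ∀ b ∈ C, ∀ t, (fun i => b (i + t)) ∈ C)
    {i j : ZMod 2 × ZMod 2} (h : ∃ b ∈ C, b i ≠ b j) :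
    ∃ m, (fun i => (kleinChar m i : ZMod p)) ∈ C ∧ kleinChar m i = -kleinChar m j := by
  obtain ⟨b, hb, hij⟩ := h
  by_contra! hcon
  have h4 : (4 : ZMod p) ≠ 0 := by
    have : (2 : ZMod p) ≠ 0 := Ring.two_ne_zero (by rwa [ZMod.ringChar_zmod_n])
    have h22 : (4 : ZMod p) = 2 * 2 := by norm_num
    rw [h22]
    exact mul_ne_zero this this
  refine hij (mul_left_cancel₀ h4 ?_)
  rw [four_mul_eq_sum_kleinChar, four_mul_eq_sum_kleinChar]
  refine Finset.sum_congr rfl fun m _ => ?_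
  by_cases hs : ∑ t, (kleinChar m t : ZMod p) * b t = 0
  · simp [hs]
  · rw [(kleinChar_eq_or_neg m i j).resolve_right
      (hcon m ((C.smul_mem_iff hs).1 (sum_smul_kleinChar_mem hC hb m)))]

theorem exists_mem_eq_zero_eq_one (hp : p ≠ 2)
    (hC : ∀ b ∈ C, ∀ t, (fun i => b (i + t)) ∈ C) (h1 : (fun _ => 1) ∈ C)
    {i j k : ZMod 2 × ZMod 2} (hik : ∃ b ∈ C, b i ≠ b k) (hjk : ∃ b ∈ C, b j ≠ b k) :
    ∃ b ∈ C, b i = 0 ∧ b j = 0 ∧ b k = 1 := by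
  suffices ∃ b ∈ C, b i = b j ∧ b k - b i ≠ 0 by
    obtain ⟨b, hb, hij, hne⟩ := this
    refine ⟨(b k - b i)⁻¹ • (b - b i • fun _ => 1),
      C.smul_mem _ (C.sub_mem hb (C.smul_mem _ h1)), ?_, ?_, ?_⟩
    · simp
    · simp [hij]
    · simpa using inv_mul_cancel₀ hne
  obtain ⟨m, hm, hmik⟩ := exists_kleinChar_mem_ne hp hC hik
  obtain ⟨n, hn, hnjk⟩ := exists_kleinChar_mem_ne hp hC hjk
  have h2 : (2 : ZMod p) ≠ 0 := Ring.two_ne_zero (by rwa [ZMod.ringChar_zmod_n])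
  have hsq (m i) : (kleinChar m i : ZMod p) * kleinChar m i = 1 := by
    exact_mod_cast congrArg (Int.cast (R := ZMod p)) (kleinChar_mul_self m i)
  have hne {m i j} (h : kleinChar m i = -kleinChar m j) :
      (kleinChar m j : ZMod p) - kleinChar m i ≠ 0 := by
    intro h0
    have h' : (kleinChar m i : ZMod p) = -kleinChar m j := by exact_mod_cast congrArg _ h
    refine h2 ?_
    linear_combination (kleinChar m j : ZMod p) * h0 + kleinChar m j * h' - 2 * hsq m j
  obtain e1 | e1 := kleinChar_eq_or_neg m i j
  · exact ⟨_, hm, congrArg _ e1, hne hmik⟩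
  obtain e2 | e2 := kleinChar_eq_or_neg n j i
  · exact ⟨_, hn, congrArg _ e2.symm, hne (e2 ▸ hnjk)⟩
  refine ⟨(kleinChar m j : ZMod p) • (fun i => (kleinChar m i : ZMod p)) +
    (kleinChar n i : ZMod p) • (fun i => (kleinChar n i : ZMod p)),
    C.add_mem (C.smul_mem _ hm) (C.smul_mem _ hn), ?_, ?_⟩
  · simp only [Pi.add_apply, Pi.smul_apply, smul_eq_mul, e1, e2]
    push_cast
    linear_combination -2 * hsq m j + 2 * hsq n i
  · have e3 : kleinChar m k = kleinChar m j := by omega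
    have e4 : kleinChar n k = kleinChar n i := by omega
    simp only [Pi.add_apply, Pi.smul_apply, smul_eq_mul, e1, e3, e4]
    intro h0
    refine h2 ?_
    push_cast at h0
    linear_combination h0 - 2 * hsq m j

end Separation
/-- The permutation of `I × M` translating the fiber over `i` by `b i`. -/
def fiberShift {I M : Type*} [AddCommGroup M] (b : I → M) : Perm (I × M) :=
  Equiv.prodShear (Equiv.refl I) fun i => Equiv.addRight (b i)

@[simp]
theorem fiberShift_apply {I M : Type*} [AddCommGroup M] (b : I → M) (x : I × M) :
    fiberShift b x = (x.1, x.2 + b x.1) :=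
  rfl

/-- The functions `b` for which `fiberShift b` lies in `A`. -/
def fiberShiftSubgroup {I M : Type*} [AddCommGroup M] (A : Subgroup (Perm (I × M))) :
    AddSubgroup (I → M) where
  carrier := {b | fiberShift b ∈ A}
  add_mem' {a b} ha hb := by
    have h : fiberShift (a + b) = fiberShift b * fiberShift a := by
      ext x <;> simp [add_assoc]
    simpa only [Set.mem_ofPred_eq, h] using A.mul_mem hb ha
  zero_mem' := by
    have h : fiberShift (0 : I → M) = 1 := by
      ext x <;> simp
    simpa only [Set.mem_ofPred_eq, h] using A.one_mem
  neg_mem' {b} hb := by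
    have h : fiberShift (-b) = (fiberShift b)⁻¹ := by
      rw [eq_inv_iff_mul_eq_one]
      ext x <;> simp
    simpa only [Set.mem_ofPred_eq, h] using A.inv_mem hb

theorem mem_fiberShiftSubgroup {I M : Type*} [AddCommGroup M] {A : Subgroup (Perm (I × M))}
    {b : I → M} : b ∈ fiberShiftSubgroup A ↔ fiberShift b ∈ A :=
  Iff.rfl

theorem fiberShift_const {I M : Type*} [AddCommGroup I] [AddCommGroup M] (y : M) :
    (fiberShift fun _ : I => y) = Equiv.addLeft (0, y) := by
  ext x <;> simp [add_comm]

theorem fiberShift_translate_mem {I M : Type*} [AddCommGroup I] [AddCommGroup M]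
    {A : Subgroup (Perm (I × M))} (hL : ∀ g, Equiv.addLeft g ∈ A) {b : I → M}
    (hb : fiberShift b ∈ A) (t : I) : (fiberShift fun i => b (i + t)) ∈ A := by
  have h : (fiberShift fun i => b (i + t)) =
      Equiv.addLeft (-t, 0) * fiberShift b * Equiv.addLeft (t, 0) := by
    ext x <;> simp [add_comm]
  rw [h]
  exact A.mul_mem (A.mul_mem (hL _) hb) (hL _)

theorem exists_nsmul_eq {p : ℕ} [Fact p.Prime] {a : ZMod p} (ha : a ≠ 0) (x : ZMod p) :
    ∃ n : ℕ, x = n • a := by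
  refine ⟨(x * a⁻¹).val, ?_⟩
  rw [nsmul_eq_mul, ZMod.natCast_zmod_val, inv_mul_cancel_right₀ ha]

theorem fiberShift_pow {I M : Type*} [AddCommGroup M] (b : I → M) (n : ℕ) :
    fiberShift b ^ n = fiberShift (n • b) := by
  induction n with
  | zero => ext x <;> simp
  | succ n ih => rw [pow_succ, ih]; ext x <;> simp [add_smul, add_assoc, add_comm]

section Core

variable {p : ℕ} [Fact p.Prime] {A : Subgroup (Perm ((ZMod 2 × ZMod 2) × ZMod p))}
  {a : ZMod 2 × ZMod 2 → ZMod p} {w : ZMod 2 × ZMod 2 → Perm ((ZMod 2 × ZMod 2) × ZMod p)}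

theorem apply_eq_add_of_translate_eq (hp : p ≠ 2) (hL : ∀ g, Equiv.addLeft g ∈ A)
    (ha : ∀ i, a i ≠ 0) (hwA : ∀ t, w t ∈ A)
    (haA : fiberShift a ∈ A) (hmul : ∀ s t, w (s + t) = w s * w t)
    (hcomm : ∀ t, Commute (w t) (fiberShift a)) (hw : ∀ t x, (w t x).1 = x.1 + t)
    {d : ZMod 2 × ZMod 2} (hd : ∀ b, fiberShift b ∈ A → ∀ i, b (i + d) = b i)
    (x : (ZMod 2 × ZMod 2) × ZMod p) : w d x = (d, 0) + x := by
  have hdd : d + d = 0 := (by decide : ∀ d : ZMod 2 × ZMod 2, d + d = 0) d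
  set e : ZMod 2 × ZMod 2 → ZMod p := fun i => (w d (i, 0)).2 with he
  have hform (i y) : w d (i, y) = (i + d, y + e i) := by
    obtain ⟨n, rfl⟩ := exists_nsmul_eq (ha i) y
    have h1 := congrArg (fun f : Perm _ => f (i, 0)) ((hcomm d).pow_right n).eq
    simp only [Perm.mul_apply, fiberShift_pow, fiberShift_apply, Pi.smul_apply, zero_add,
      hw d] at h1
    rw [h1, hd a haA i, add_comm (n • a i)]
  have hshift : fiberShift e ∈ A := by
    have h : fiberShift e = Equiv.addLeft (-d, 0) * w d := by
      ext ⟨i, y⟩ <;> simp [hform]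
    rw [h]
    exact A.mul_mem (hL _) (hwA d)
  have h0 : w 0 = 1 := by
    have := hmul 0 0
    rwa [add_zero, eq_comm, mul_eq_left] at this
  have he0 (i) : e i = 0 := by
    have h1 := congrArg (fun f : Perm _ => (f (i, 0)).2) (hmul d d)
    simp only [hdd, h0, Perm.mul_apply, hform, hd e hshift, Perm.one_apply, zero_add] at h1
    have h2 : (2 : ZMod p) ≠ 0 := Ring.two_ne_zero (by rwa [ZMod.ringChar_zmod_n])
    exact (mul_eq_zero_iff_left h2).1 (by rw [two_mul, ← h1])
  obtain ⟨i, y⟩ := x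
  simp [hform, he0, add_comm]

theorem exists_mem_agree_of_separated {A : Subgroup (Perm ((ZMod 2 × ZMod 2) × ZMod p))}
    (hp : p ≠ 2) (hL : ∀ g, Equiv.addLeft g ∈ A) {T f : Perm ((ZMod 2 × ZMod 2) × ZMod p)}
    (hT : ∀ x, (T x).1 = x.1) (hf : f ∈ A) (hf1 : ∀ x, (f x).1 = x.1)
    {u v z : (ZMod 2 × ZMod 2) × ZMod p}
    (huz : ∃ b, fiberShift b ∈ A ∧ b u.1 ≠ b z.1) (hvz : ∃ b, fiberShift b ∈ A ∧ b v.1 ≠ b z.1) :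
    ∃ g ∈ A, (∀ x, (g x).1 = x.1) ∧ g u = f u ∧ g v = f v ∧ g z = T z := by
  obtain ⟨b, hb, hbu, hbv, hbz⟩ := exists_mem_eq_zero_eq_one
    (C := AddSubgroup.toZModSubmodule p (fiberShiftSubgroup A)) hp
    (fun b hb t => fiberShift_translate_mem hL hb t)
    (mem_fiberShiftSubgroup.2 (by rw [fiberShift_const]; exact hL _)) huz hvz
  have hb' : ((T z).2 - (f z).2) • b ∈ AddSubgroup.toZModSubmodule p (fiberShiftSubgroup A) :=
    Submodule.smul_mem _ _ hb
  refine ⟨fiberShift (((T z).2 - (f z).2) • b) * f, A.mul_mem hb' hf, fun x => ?_, ?_, ?_, ?_⟩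
  · simp [hf1]
  · ext <;> simp [hf1, hbu]
  · ext <;> simp [hf1, hbv]
  · ext <;> simp [hf1, hbz, hT]

theorem exists_mem_apply_eq (hp : p ≠ 2) (hA : IsThreeClosed A) (hL : ∀ g, Equiv.addLeft g ∈ A)
    (ha : ∀ i, a i ≠ 0) (hwA : ∀ t, w t ∈ A)
    (haA : fiberShift a ∈ A) (hmul : ∀ s t, w (s + t) = w s * w t)
    (hcomm : ∀ t, Commute (w t) (fiberShift a)) (hw : ∀ t x, (w t x).1 = x.1 + t) :
    ∃ T ∈ A, ∀ x, T x = w x.1 (0, x.2) := by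
  let T : Perm ((ZMod 2 × ZMod 2) × ZMod p) :=
    Equiv.ofBijective (fun x => w x.1 (0, x.2)) <| by
      refine Finite.injective_iff_bijective.1 ?_
      rintro ⟨i, y⟩ ⟨j, z⟩ h
      have hij : i = j := by simpa [hw] using congrArg Prod.fst h
      subst hij
      simpa using h
  have hT (x) : T x = w x.1 (0, x.2) := rfl
  have hT1 (x) : (T x).1 = x.1 := by simp [hT, hw]
  refine ⟨T, hA _ ?_, hT⟩
  let m (i : ZMod 2 × ZMod 2) := w i * Equiv.addLeft (-i, (0 : ZMod p))
  have hm (i) : m i ∈ A := A.mul_mem (hwA i) (hL _)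
  have hm1 (i x) : (m i x).1 = x.1 := by simp [m, hw]
  have hmT' {i : ZMod 2 × ZMod 2} {x : (ZMod 2 × ZMod 2) × ZMod p}
      (h : ¬ ∃ b, fiberShift b ∈ A ∧ b i ≠ b x.1) : m i x = T x := by
    push Not at h
    have hd := apply_eq_add_of_translate_eq hp hL ha hwA haA hmul hcomm hw (d := x.1 - i)
      (fun b hb j => by
        have := h _ (fiberShift_translate_mem hL hb (j - i))
        simp only [add_sub_cancel] at this
        rw [this]
        congr 1
        abel) (0, x.2)
    have hwx : w x.1 = w i * w (x.1 - i) := by rw [← hmul, add_sub_cancel]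
    rw [hT, hwx, Perm.mul_apply, Perm.mul_apply, hd]
    congr 1
    ext <;> simp [sub_eq_neg_add]
  have hmT (x) : m x.1 x = T x := hmT' (by simp)
  intro u v z
  by_cases huv : ∃ b, fiberShift b ∈ A ∧ b u.1 ≠ b v.1
  · have hvu : ∃ b, fiberShift b ∈ A ∧ b v.1 ≠ b u.1 := huv.imp fun _ h => ⟨h.1, h.2.symm⟩
    by_cases huz : ∃ b, fiberShift b ∈ A ∧ b u.1 ≠ b z.1
    · have hzu : ∃ b, fiberShift b ∈ A ∧ b z.1 ≠ b u.1 := huz.imp fun _ h => ⟨h.1, h.2.symm⟩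
      by_cases hvz : ∃ b, fiberShift b ∈ A ∧ b v.1 ≠ b z.1
      · have hzv : ∃ b, fiberShift b ∈ A ∧ b z.1 ≠ b v.1 := hvz.imp fun _ h => ⟨h.1, h.2.symm⟩
        obtain ⟨f, hf, hf1, hfu, -, hfv⟩ :=
          exists_mem_agree_of_separated hp hL hT1 (hm u.1) (hm1 u.1) huv hzv
        obtain ⟨g, hg, -, hgu, hgv, hgz⟩ :=
          exists_mem_agree_of_separated hp hL hT1 hf hf1 huz hvz
        exact ⟨g, hg, by rw [hgu, hfu, hmT], by rw [hgv, hfv], hgz⟩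
      · obtain ⟨g, hg, -, hgv, hgz, hgu⟩ :=
          exists_mem_agree_of_separated hp hL hT1 (hm v.1) (hm1 v.1) hvu hzu
        exact ⟨g, hg, hgu, by rw [hgv, hmT], by rw [hgz, hmT' hvz]⟩
    · by_cases hzv : ∃ b, fiberShift b ∈ A ∧ b z.1 ≠ b v.1
      · obtain ⟨g, hg, -, hgu, hgz, hgv⟩ :=
          exists_mem_agree_of_separated hp hL hT1 (hm u.1) (hm1 u.1) huv hzv
        exact ⟨g, hg, by rw [hgu, hmT], hgv, by rw [hgz, hmT' huz]⟩
      · refine absurd huv ?_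
        push Not at huz hzv ⊢
        exact fun b hb => (huz b hb).trans (hzv b hb)
  · by_cases huz : ∃ b, fiberShift b ∈ A ∧ b u.1 ≠ b z.1
    · obtain ⟨b, hb, hne⟩ := huz
      obtain ⟨g, hg, -, hgu, hgv, hgz⟩ :=
        exists_mem_agree_of_separated (u := u) (v := v) (z := z) hp hL hT1 (hm u.1) (hm1 u.1)
          ⟨b, hb, hne⟩ ⟨b, hb, by push Not at huv; rwa [← huv b hb]⟩
      exact ⟨g, hg, by rw [hgu, hmT], by rw [hgv, hmT' huv], hgz⟩
    · exact ⟨m u.1, hm _, hmT _, hmT' huv, hmT' huz⟩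

end Core

section Translation

variable {X : Type*} [AddCommGroup X]

/-- The conjugate by `σ` of the left translation by `g`. -/
def conjTranslation (σ : Perm X) (g : X) : Perm X :=
  σ⁻¹ * Equiv.addLeft g * σ

theorem conjTranslation_add (σ : Perm X) (g h : X) :
    conjTranslation σ (g + h) = conjTranslation σ g * conjTranslation σ h := by
  ext x
  simp [conjTranslation, add_assoc]

theorem conjTranslation_zero (σ : Perm X) : conjTranslation σ 0 = 1 := by
  ext x
  simp [conjTranslation]

theorem conjTranslation_nsmul (σ : Perm X) (n : ℕ) (g : X) :
    conjTranslation σ (n • g) = conjTranslation σ g ^ n := by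
  induction n with
  | zero => simp [conjTranslation_zero]
  | succ n ih => rw [succ_nsmul, conjTranslation_add, ih, pow_succ]

theorem conjTranslation_one (g : X) : conjTranslation 1 g = Equiv.addLeft g := by
  simp [conjTranslation]

theorem conjTranslation_mul (σ a : Perm X) (g : X) :
    conjTranslation (σ * a) g = a⁻¹ * conjTranslation σ g * a := by
  simp [conjTranslation, mul_assoc]

theorem commute_conjTranslation (σ : Perm X) (g h : X) :
    Commute (conjTranslation σ g) (conjTranslation σ h) := by
  rw [commute_iff_eq, ← conjTranslation_add, ← conjTranslation_add, add_comm]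

theorem eq_of_conjTranslation_apply_eq {σ : Perm X} {g h x : X}
    (H : conjTranslation σ g x = conjTranslation σ h x) : g = h := by
  simpa [conjTranslation] using H

theorem exists_conjTranslation_apply_eq (σ : Perm X) (x y : X) :
    ∃ g, conjTranslation σ g x = y :=
  ⟨σ y - σ x, by simp [conjTranslation]⟩

theorem isConjugating_of_conjTranslation {A : Subgroup (Perm X)} {σ T : Perm X} (hT : T ∈ A)
    (h : ∀ g, ∃ h, T * Equiv.addLeft g = conjTranslation σ h * T) : IsConjugating A σ :=
  ⟨T, hT, h⟩

theorem exists_eq_conjTranslation {σ z : Perm X} (hz : ∀ g, Commute z (conjTranslation σ g)) :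
    ∃ h, z = conjTranslation σ h := by
  obtain ⟨h, hh⟩ := exists_conjTranslation_apply_eq σ 0 (z 0)
  refine ⟨h, Equiv.ext fun x => ?_⟩
  obtain ⟨g, rfl⟩ := exists_conjTranslation_apply_eq σ 0 x
  rw [← Perm.mul_apply, (hz g).eq, Perm.mul_apply, ← hh, ← Perm.mul_apply, ← Perm.mul_apply,
    (commute_conjTranslation σ g h).eq]

end Translation

section Blocks

variable {p : ℕ} [Fact p.Prime] {a : ZMod 2 × ZMod 2 → ZMod p}
  {σ : Perm ((ZMod 2 × ZMod 2) × ZMod p)} {h₀ h : (ZMod 2 × ZMod 2) × ZMod p}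

theorem exists_eq_nsmul_of_fst_apply_eq (ha : ∀ i, a i ≠ 0)
    (hσ : conjTranslation σ h₀ = fiberShift a) {x : (ZMod 2 × ZMod 2) × ZMod p}
    (hx : (conjTranslation σ h x).1 = x.1) : ∃ n : ℕ, h = n • h₀ := by
  obtain ⟨n, hn⟩ := exists_nsmul_eq (ha x.1) ((conjTranslation σ h x).2 - x.2)
  refine ⟨n, eq_of_conjTranslation_apply_eq (σ := σ) (x := x) ?_⟩
  rw [conjTranslation_nsmul, hσ, fiberShift_pow]
  refine Prod.ext hx ?_
  rw [fiberShift_apply, Pi.smul_apply, ← hn, add_sub_cancel]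

theorem fst_conjTranslation_apply (ha : ∀ i, a i ≠ 0)
    (hσ : conjTranslation σ h₀ = fiberShift a) (h2 : h + h = 0)
    (x : (ZMod 2 × ZMod 2) × ZMod p) :
    (conjTranslation σ h x).1 = x.1 + (conjTranslation σ h 0).1 := by
  have hpow (n : ℕ) (x) : (conjTranslation σ (n • h₀) x).1 = x.1 := by
    rw [conjTranslation_nsmul, hσ, fiberShift_pow, fiberShift_apply]
  have hblock (i y) : (conjTranslation σ h (i, y)).1 = (conjTranslation σ h (i, 0)).1 := by
    obtain ⟨n, rfl⟩ := exists_nsmul_eq (ha i) y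
    have hy : ((i, n • a i) : (ZMod 2 × ZMod 2) × ZMod p) =
        conjTranslation σ (n • h₀) (i, 0) := by
      rw [conjTranslation_nsmul, hσ, fiberShift_pow]
      simp
    rw [hy, ← Perm.mul_apply, (commute_conjTranslation σ h _).eq, Perm.mul_apply, hpow]
  have hinv (i) :
      (conjTranslation σ h ((conjTranslation σ h (i, 0)).1, 0)).1 = i := by
    rw [← hblock _ (conjTranslation σ h (i, 0)).2, Prod.mk.eta, ← Perm.mul_apply,
      ← conjTranslation_add, h2, conjTranslation_zero, Perm.one_apply]
  have hfix (i) (hi : (conjTranslation σ h (i, 0)).1 = i) (j) :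
      (conjTranslation σ h (j, 0)).1 = j := by
    obtain ⟨n, rfl⟩ := exists_eq_nsmul_of_fst_apply_eq (h := h) ha hσ hi
    exact hpow n _
  have key : ∀ f : Fin 2 × Fin 2 → Fin 2 × Fin 2, (∀ i, f (f i) = i) →
      (∀ i, f i = i → ∀ j, f j = j) → ∀ i, f i = i + f 0 := by
    decide +kernel
  obtain ⟨i, y⟩ := x
  rw [hblock]
  exact key (fun i => (conjTranslation σ h (i, 0)).1) hinv hfix i

theorem exists_complement_map (ha : ∀ i, a i ≠ 0)
    (hσ : conjTranslation σ (0, 1) = fiberShift a) :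
    ∃ κ : ZMod 2 × ZMod 2 →+ ZMod 2 × ZMod 2,
      ∀ t x, (conjTranslation σ (κ t, 0) x).1 = x.1 + t := by
  have h2 (t : ZMod 2 × ZMod 2) : ((t, 0) + (t, 0) : (ZMod 2 × ZMod 2) × ZMod p) = 0 := by
    have ht : t + t = 0 := (by decide : ∀ t : ZMod 2 × ZMod 2, t + t = 0) t
    simp [ht]
  let β : ZMod 2 × ZMod 2 →+ ZMod 2 × ZMod 2 := AddMonoidHom.mk'
    (fun t => (conjTranslation σ (t, 0) 0).1) fun s t => by
      have hst : ((s + t, 0) : (ZMod 2 × ZMod 2) × ZMod p) = (t, 0) + (s, 0) := by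
        simp [add_comm]
      rw [hst, conjTranslation_add, Perm.mul_apply, fst_conjTranslation_apply ha hσ (h2 t)]
  have hβ : Function.Injective β := by
    refine (injective_iff_map_eq_zero β).2 fun t ht => ?_
    obtain ⟨n, hn⟩ := exists_eq_nsmul_of_fst_apply_eq (h := (t, 0)) (x := 0) ha hσ ht
    simpa using congrArg Prod.fst hn
  let e := AddEquiv.ofBijective β (Finite.injective_iff_bijective.1 hβ)
  refine ⟨e.symm, fun t x => ?_⟩
  have ht : β (e.symm t) = t := e.apply_symm_apply t
  rw [fst_conjTranslation_apply ha hσ (h2 _)]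
  exact congrArg _ ht

theorem isConjugating_of_conjTranslation_eq_fiberShift (hp : p ≠ 2)
    {A : Subgroup (Perm ((ZMod 2 × ZMod 2) × ZMod p))} (hA : IsThreeClosed A)
    (hL : ∀ g, Equiv.addLeft g ∈ A) (hσA : ∀ g, conjTranslation σ g ∈ A) (ha : ∀ i, a i ≠ 0)
    (hσ : conjTranslation σ (0, 1) = fiberShift a) : IsConjugating A σ := by
  obtain ⟨κ, hw⟩ := exists_complement_map ha hσ
  obtain ⟨w, hwκ⟩ : ∃ w : ZMod 2 × ZMod 2 → Perm ((ZMod 2 × ZMod 2) × ZMod p),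
      ∀ t, w t = conjTranslation σ (κ t, 0) := ⟨_, fun _ => rfl⟩
  have hmul (s t) : w (s + t) = w s * w t := by
    simp only [hwκ, ← conjTranslation_add, map_add, Prod.mk_add_mk, add_zero]
  have hcomm (t) : Commute (w t) (fiberShift a) := by
    rw [hwκ, ← hσ]
    exact commute_conjTranslation σ _ _
  have hwA (t) : w t ∈ A := hwκ t ▸ hσA _
  have haA : fiberShift a ∈ A := hσ ▸ hσA _
  simp only [← hwκ] at hw
  obtain ⟨T, hTA, hT⟩ := exists_mem_apply_eq hp hA hL ha hwA haA hmul hcomm hw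
  have hTw (i x) : T (i, x) = w i (0, x) := hT (i, x)
  have hcn (t) (n : ℕ) : w t * fiberShift a ^ n = fiberShift a ^ n * w t :=
    ((hcomm t).pow_right n).eq
  refine isConjugating_of_conjTranslation hTA fun g => ?_
  obtain ⟨n, hn⟩ := exists_nsmul_eq (ha 0) g.2
  have hx (x) : ((0, g.2 + x) : (ZMod 2 × ZMod 2) × ZMod p) = (fiberShift a ^ n) (0, x) := by
    rw [fiberShift_pow, fiberShift_apply, Pi.smul_apply, ← hn, add_comm]
  refine ⟨n • (0, 1) + (κ g.1, 0), ?_⟩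
  rw [conjTranslation_add, conjTranslation_nsmul, hσ, ← hwκ]
  refine Equiv.ext fun x => ?_
  have h1 : T (g + x) = w (g.1 + x.1) (0, g.2 + x.2) := hTw _ _
  have h2 : (w g.1) (w x.1 (0, x.2)) = w (g.1 + x.1) (0, x.2) := by rw [hmul, Perm.mul_apply]
  simp only [Perm.mul_apply, Equiv.coe_addLeft]
  rw [h1, hx, hT x]
  rw [← Perm.mul_apply, hcn, Perm.mul_apply, ← h2]

end Blocks

section OddPrime

theorem commute_of_card_orbit_eq {X : Type*} [Finite X] {p : ℕ} [hp : Fact p.Prime]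
    {P : Subgroup (Perm X)} (hP : IsPGroup p P)
    (horb : ∀ x : X, Nat.card (MulAction.orbit P x) = p) {c d : Perm X} (hc : c ∈ P) (hd : d ∈ P) :
    Commute c d := by
  let c' : P := ⟨c, hc⟩
  let d' : P := ⟨d, hd⟩
  suffices ∀ x : X, c' * d' * c'⁻¹ * d'⁻¹ ∈ MulAction.stabilizer P x by
    have h : c * d * c⁻¹ * d⁻¹ = 1 := Equiv.ext fun x => this x
    rw [mul_inv_eq_one, mul_inv_eq_iff_eq_mul] at h
    exact h
  intro x
  have hidx : (MulAction.stabilizer P x).index = p := by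
    rw [MulAction.index_stabilizer, ← horb x]
    rfl
  obtain ⟨n, hn⟩ := IsPGroup.iff_card.1 hP
  have hn0 : n ≠ 0 := by
    rintro rfl
    have := (MulAction.stabilizer P x).index_dvd_card
    rw [hidx, hn, pow_zero, Nat.dvd_one] at this
    exact hp.out.one_lt.ne' this
  have : (MulAction.stabilizer P x).Normal :=
    Subgroup.normal_of_index_eq_minFac_card (by rw [hidx, hn, hp.out.pow_minFac hn0])
  have hcyc : IsCyclic (P ⧸ MulAction.stabilizer P x) := isCyclic_of_prime_card hidx
  rw [← QuotientGroup.eq_one_iff]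
  rw [QuotientGroup.mk_mul, QuotientGroup.mk_mul, QuotientGroup.mk_mul, QuotientGroup.mk_inv,
    QuotientGroup.mk_inv, mul_inv_eq_one, mul_inv_eq_iff_eq_mul]
  exact hcyc.commGroup.mul_comm _ _

theorem isPGroup_zpowers {G : Type*} [Group G] {p : ℕ} {c : G} (hc : c ^ p = 1) :
    IsPGroup p (Subgroup.zpowers c) := by
  rintro ⟨_, m, rfl⟩
  refine ⟨1, Subtype.ext ?_⟩
  simp [← zpow_natCast, ← zpow_mul, mul_comm m]
  simp [zpow_mul, hc]

theorem isConjugating_of_five_le {p : ℕ} [hp : Fact p.Prime] (h5 : 5 ≤ p)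
    {A : Subgroup (Perm ((ZMod 2 × ZMod 2) × ZMod p))} (hA : IsThreeClosed A)
    (hL : ∀ g, Equiv.addLeft g ∈ A) {σ : Perm ((ZMod 2 × ZMod 2) × ZMod p)}
    (hσA : ∀ g, conjTranslation σ g ∈ A) : IsConjugating A σ := by
  have hpow (τ : Perm ((ZMod 2 × ZMod 2) × ZMod p)) : conjTranslation τ (0, 1) ^ p = 1 := by
    rw [← conjTranslation_nsmul, ← conjTranslation_zero τ]
    congr 1
    ext <;> simp
  obtain ⟨b, hb, P, hPA, hP, hQ, hR⟩ := exists_conj_mem_isPGroup p A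
    (Subgroup.zpowers (conjTranslation 1 (0, 1))) (Subgroup.zpowers (conjTranslation σ (0, 1)))
    (by rw [Subgroup.zpowers_le, conjTranslation_one]; exact hL _)
    (by rw [Subgroup.zpowers_le]; exact hσA _)
    (isPGroup_zpowers (hpow 1)) (isPGroup_zpowers (hpow σ))
  refine IsConjugating.of_mul hb ?_
  have hc : conjTranslation (σ * b) (0, 1) ∈ P := by
    rw [conjTranslation_mul]
    exact hR _ (Subgroup.mem_zpowers _)
  have hcA (g) : conjTranslation (σ * b) g ∈ A := by
    rw [conjTranslation_mul]
    exact A.mul_mem (A.mul_mem (A.inv_mem hb) (hσA g)) hb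
  generalize σ * b = τ at hc hcA
  have hd (k : ZMod p) : Equiv.addLeft ((0, k) : (ZMod 2 × ZMod 2) × ZMod p) ∈ P := by
    have h := hQ (Subgroup.pow_mem _ (Subgroup.mem_zpowers _) k.val)
    rw [← conjTranslation_nsmul, conjTranslation_one] at h
    simpa using h
  have hsub (x : (ZMod 2 × ZMod 2) × ZMod p) : {y | y.1 = x.1} ⊆ MulAction.orbit P x := by
    intro y hy
    refine ⟨⟨_, hd (y.2 - x.2)⟩, ?_⟩
    change (0, y.2 - x.2) + x = y
    ext <;> simp [show y.1 = x.1 from hy]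
  have hfib (x : (ZMod 2 × ZMod 2) × ZMod p) :
      {y : (ZMod 2 × ZMod 2) × ZMod p | y.1 = x.1}.ncard = p := by
    have : {y : (ZMod 2 × ZMod 2) × ZMod p | y.1 = x.1} = {x.1} ×ˢ Set.univ := by
      ext; simp
    rw [this, Set.ncard_prod]
    simp
  have horb (x : (ZMod 2 × ZMod 2) × ZMod p) : Nat.card (MulAction.orbit P x) = p := by
    obtain ⟨n, hn⟩ := hP.card_orbit x
    have h1 : p ≤ Nat.card (MulAction.orbit P x) := by
      have := Set.ncard_le_ncard (hsub x)
      rwa [hfib] at this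
    have h2 : Nat.card (MulAction.orbit P x) ≤ 4 * p := by
      have := Set.ncard_le_card (MulAction.orbit P x)
      simpa [Nat.card_prod] using this
    have hn2 : n < 2 := by
      by_contra! h
      have := Nat.pow_le_pow_right hp.out.pos h
      nlinarith
    have hn0 : n ≠ 0 := by
      rintro rfl
      rw [hn, pow_zero] at h1
      omega
    obtain rfl : n = 1 := by omega
    rw [hn, pow_one]
  have hsub' (x : (ZMod 2 × ZMod 2) × ZMod p) : MulAction.orbit P x = {y | y.1 = x.1} :=
    (Set.eq_of_subset_of_ncard_le (hsub x) (by
      rw [hfib]; exact (horb x).le)).symm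
  have hfst (x) : (conjTranslation τ (0, 1) x).1 = x.1 := by
    have : conjTranslation τ (0, 1) x ∈ MulAction.orbit P x := ⟨⟨_, hc⟩, rfl⟩
    rwa [hsub'] at this
  let a (i : ZMod 2 × ZMod 2) : ZMod p := (conjTranslation τ (0, 1) (i, 0)).2
  have ha : conjTranslation τ (0, 1) = fiberShift a := by
    ext1 ⟨i, y⟩
    have h1 := congrArg (fun f : Perm _ => f (i, 0))
      (commute_of_card_orbit_eq hP horb hc (hd y)).eq
    have h2 : Equiv.addLeft ((0, y) : (ZMod 2 × ZMod 2) × ZMod p) (i, 0) = (i, y) := by simp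
    simp only [Perm.mul_apply, h2] at h1
    rw [h1]
    ext <;> simp [hfst, a]
  refine isConjugating_of_conjTranslation_eq_fiberShift (by omega) hA hL hcA (fun i hi => ?_) ha
  have h0 : ((0, 1) : (ZMod 2 × ZMod 2) × ZMod p) = 0 := by
    refine eq_of_conjTranslation_apply_eq (σ := τ) (x := (i, 0)) ?_
    rw [conjTranslation_zero, ha]
    simp [hi]
  simp at h0

end OddPrime

theorem IsThreeClosed.comap_conj {X : Type*} {A : Subgroup (Perm X)} (hA : IsThreeClosed A)
    (θ : Perm X) :
    IsThreeClosed (A.comap (MulAut.conj θ⁻¹).toMonoidHom) := by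
  intro τ hτ
  refine hA _ fun u v w => ?_
  obtain ⟨a, ha, hu, hv, hw⟩ := hτ (θ u) (θ v) (θ w)
  refine ⟨_, ha, ?_, ?_, ?_⟩ <;> simp [hu, hv, hw]

theorem conj_mem_comap_conj {G : Type*} [Group G] {A : Subgroup G} {a : G} (ha : a ∈ A) (θ : G) :
    θ * a * θ⁻¹ ∈ A.comap (MulAut.conj θ⁻¹).toMonoidHom := by
  simpa [mul_assoc] using ha

section Transport

variable {X : Type*} [AddCommGroup X]

theorem conj_addLeft (θ : X ≃+ X) (g : X) :
    θ.toEquiv⁻¹ * Equiv.addLeft (θ g) * θ.toEquiv = Equiv.addLeft g := by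
  refine Equiv.ext fun x => ?_
  change θ.symm (θ g + θ x) = g + x
  rw [← map_add, AddEquiv.symm_apply_apply]

theorem conj_conjTranslation (θ : X ≃+ X) (σ : Perm X) (g : X) :
    conjTranslation (θ.toEquiv * σ * θ.toEquiv⁻¹) (θ g) =
      θ.toEquiv * conjTranslation σ g * θ.toEquiv⁻¹ := by
  rw [conjTranslation, conjTranslation, ← conj_addLeft θ g]
  group

theorem IsConjugating.of_comap_conj {A : Subgroup (Perm X)} {σ : Perm X} (θ : X ≃+ X)
    (h : IsConjugating (A.comap (MulAut.conj θ.toEquiv⁻¹).toMonoidHom)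
      (θ.toEquiv * σ * θ.toEquiv⁻¹)) : IsConjugating A σ := by
  obtain ⟨T, hT, hT'⟩ := h
  refine isConjugating_of_conjTranslation hT fun g => ?_
  obtain ⟨h, hh⟩ := hT' (θ g)
  obtain ⟨h, rfl⟩ := θ.surjective h
  refine ⟨h, ?_⟩
  change T * _ = conjTranslation (θ.toEquiv * σ * θ.toEquiv⁻¹) (θ h) * T at hh
  rw [conj_conjTranslation] at hh
  rw [← conj_addLeft θ g]
  simp only [MulEquiv.toMonoidHom_eq_coe, MonoidHom.coe_coe, MulAut.conj_apply, inv_inv]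
  calc _ = θ.toEquiv⁻¹ * (T * Equiv.addLeft (θ g)) * θ.toEquiv := by group
    _ = _ := by rw [hh]; group

end Transport

section EvenPrime

theorem eq_mul_of_symm_of_translate {e : ZMod 2 × ZMod 2 → ZMod 2 × ZMod 2 → ZMod 2}
    (h0 : ∀ t, e t 0 = 0) (hs : ∀ s t, e s t = e t s) (ht : ∀ t i, e t (i + t) = e t i)
    (t i : ZMod 2 × ZMod 2) : e t i = e (1, 0) (0, 1) * (t.1 * i.2 + t.2 * i.1) := by
  have h0' (t) : e 0 t = 0 := by rw [hs, h0]
  have hd (t) : e t t = 0 := by rw [← h0 t, ← ht t 0, zero_add]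
  have h1 : e (0, 1) (1, 0) = e (1, 0) (0, 1) := hs _ _
  have h2 : e (1, 0) (1, 1) = e (1, 0) (0, 1) := ht (1, 0) (0, 1)
  have h3 : e (0, 1) (1, 1) = e (1, 0) (0, 1) := (ht (0, 1) (1, 0)).trans h1
  have h4 : e (1, 1) (1, 0) = e (1, 0) (0, 1) := (hs _ _).trans h2
  have h5 : e (1, 1) (0, 1) = e (1, 0) (0, 1) := (hs _ _).trans h3
  have key : ∀ t : ZMod 2 × ZMod 2, t = 0 ∨ t = (0, 1) ∨ t = (1, 0) ∨ t = (1, 1) := by decide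
  have h11 : (1 + 1 : ZMod 2) = 0 := by decide
  rcases key t with rfl | rfl | rfl | rfl <;> rcases key i with rfl | rfl | rfl | rfl <;>
    simp [h0, h0', hd, h1, h2, h3, h4, h5, h11]

theorem isConjugating_of_conjTranslation_eq_addLeft
    {A : Subgroup (Perm ((ZMod 2 × ZMod 2) × ZMod 2))} (hA : IsThreeClosed A)
    (hL : ∀ g, Equiv.addLeft g ∈ A) {σ : Perm ((ZMod 2 × ZMod 2) × ZMod 2)}
    (hσA : ∀ g, conjTranslation σ g ∈ A) {h₀ : (ZMod 2 × ZMod 2) × ZMod 2}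
    (hσ : conjTranslation σ h₀ = Equiv.addLeft (0, 1)) : IsConjugating A σ := by
  rw [← fiberShift_const] at hσ
  have hadd : ∀ g : (ZMod 2 × ZMod 2) × ZMod 2, g + g = 0 := by decide
  have hadd' : ∀ t : ZMod 2 × ZMod 2, t + t = 0 := by decide
  choose h hh using fun t : ZMod 2 × ZMod 2 => exists_conjTranslation_apply_eq σ 0 (t, 0)
  obtain ⟨r, hr⟩ : ∃ r : ZMod 2 × ZMod 2 → Perm ((ZMod 2 × ZMod 2) × ZMod 2),
    ∀ t, r t = conjTranslation σ (h t) := ⟨_, fun _ => rfl⟩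
  obtain ⟨e, he⟩ : ∃ e : ZMod 2 × ZMod 2 → ZMod 2 × ZMod 2 → ZMod 2,
    ∀ t i, e t i = (r t (i, 0)).2 := ⟨_, fun _ _ => rfl⟩
  have hform (t i y) : r t (i, y) = (i + t, y + e t i) := by
    obtain ⟨n, rfl⟩ := exists_nsmul_eq one_ne_zero y
    have h1 : ((i, n • 1) : (ZMod 2 × ZMod 2) × ZMod 2) =
        conjTranslation σ (n • h₀) (i, 0) := by
      rw [conjTranslation_nsmul, hσ, fiberShift_pow]
      simp
    rw [h1, hr, ← Perm.mul_apply, (commute_conjTranslation σ _ _).eq, Perm.mul_apply,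
      conjTranslation_nsmul, hσ, fiberShift_pow, ← hr, fiberShift_apply, ← he, hr,
      fst_conjTranslation_apply (fun _ => one_ne_zero) hσ (hadd _), hh]
    simp [add_comm]
  have he0 (t) : e t 0 = 0 := by
    rw [he, hr]
    exact congrArg Prod.snd (hh t)
  have hcomm (s t i) : e s i + e t (i + s) = e t i + e s (i + t) := by
    have h1 := congrArg (fun f : Perm _ => (f (i, 0)).2)
      (commute_conjTranslation σ (h t) (h s)).eq
    simpa [← hr, hform] using h1
  have hs (s t) : e s t = e t s := by
    simpa [he0] using (hcomm s t 0).symm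
  have ht (t i) : e t (i + t) = e t i := by
    have h1 : r t * r t = 1 := by
      rw [hr, ← conjTranslation_add, hadd, conjTranslation_zero]
    have h2 := congrArg (fun f : Perm _ => (f (i, 0)).2) h1
    simp only [Perm.mul_apply, hform, Perm.one_apply, zero_add] at h2
    exact ((by decide : ∀ a b : ZMod 2, a + b = 0 → b = a)) _ _ h2
  have hbil := eq_mul_of_symm_of_translate he0 hs ht
  generalize e (1, 0) (0, 1) = μ at hbil
  have hTA : (fiberShift fun i : ZMod 2 × ZMod 2 => μ * (i.1 * i.2)) ∈ A := by
    refine hA _ fun u v w => ?_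
    obtain ⟨t, γ, hu, hv, hw⟩ := (by decide +kernel : ∀ (μ : ZMod 2) (i j k : ZMod 2 × ZMod 2),
      ∃ (t : ZMod 2 × ZMod 2) (γ : ZMod 2),
        γ + μ * (t.1 * i.2 + t.2 * i.1) = μ * (i.1 * i.2) ∧
        γ + μ * (t.1 * j.2 + t.2 * j.1) = μ * (j.1 * j.2) ∧
        γ + μ * (t.1 * k.2 + t.2 * k.1) = μ * (k.1 * k.2)) μ u.1 v.1 w.1
    have hrt (x : (ZMod 2 × ZMod 2) × ZMod 2) :
        (Equiv.addLeft (-t, 0) * r t * Equiv.addLeft (0, γ) : Perm _) x =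
          (x.1, x.2 + (γ + μ * (t.1 * x.1.2 + t.2 * x.1.1))) := by
      have h1 : Equiv.addLeft ((0, γ) : (ZMod 2 × ZMod 2) × ZMod 2) x = (x.1, γ + x.2) := by
        ext <;> simp
      rw [Perm.mul_apply, Perm.mul_apply, h1, hform, hbil]
      refine Prod.ext ?_ ?_
      · simp
      · simp only [Equiv.coe_addLeft, Prod.snd_add]
        ring
    refine ⟨_, A.mul_mem (A.mul_mem (hL (-t, 0)) (hr t ▸ hσA (h t))) (hL (0, γ)), ?_, ?_, ?_⟩
    · rw [hrt, hu, fiberShift_apply]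
    · rw [hrt, hv, fiberShift_apply]
    · rw [hrt, hw, fiberShift_apply]
  refine isConjugating_of_conjTranslation hTA fun g => ?_
  obtain ⟨n, hn⟩ := exists_nsmul_eq one_ne_zero (g.2 + μ * (g.1.1 * g.1.2))
  refine ⟨n • h₀ + h g.1, ?_⟩
  rw [conjTranslation_add, conjTranslation_nsmul, hσ, fiberShift_pow, ← hr]
  refine Equiv.ext fun x => ?_
  rw [Perm.mul_apply, Perm.mul_apply, Perm.mul_apply, fiberShift_apply (x := x), hform,
    fiberShift_apply, fiberShift_apply, hbil, Pi.smul_apply, ← hn]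
  refine Prod.ext ?_ ?_
  · simp [add_comm]
  · simp only [Equiv.coe_addLeft, Prod.snd_add, Prod.fst_add]
    ring

theorem exists_addEquiv_apply_eq {d : (ZMod 2 × ZMod 2) × ZMod 2} (hd : d ≠ 0) :
    ∃ θ : ((ZMod 2 × ZMod 2) × ZMod 2) ≃+ ((ZMod 2 × ZMod 2) × ZMod 2), θ d = (0, 1) := by
  let f (a b : ZMod 2) (x : (ZMod 2 × ZMod 2) × ZMod 2) : ZMod 2 := a * x.1.1 + b * x.1.2 + x.2
  let F (a b : ZMod 2) (d x : (ZMod 2 × ZMod 2) × ZMod 2) := x + f a b x • (d + (0, 1))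
  obtain ⟨a, b, hFd, hFF⟩ : ∃ a b, F a b d d = (0, 1) ∧ ∀ x, F a b d (F a b d x) = x := by
    revert d
    decide +kernel
  refine ⟨{ toFun := F a b d, invFun := F a b d, left_inv := hFF, right_inv := hFF,
            map_add' := fun x y => ?_ }, hFd⟩
  simp only [F, f, Prod.fst_add, Prod.snd_add]
  module

theorem isConjugating_two {A : Subgroup (Perm ((ZMod 2 × ZMod 2) × ZMod 2))}
    (hA : IsThreeClosed A) (hL : ∀ g, Equiv.addLeft g ∈ A)
    {σ : Perm ((ZMod 2 × ZMod 2) × ZMod 2)} (hσA : ∀ g, conjTranslation σ g ∈ A) :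
    IsConjugating A σ := by
  have hadd : ∀ g : (ZMod 2 × ZMod 2) × ZMod 2, g + g = 0 := by decide
  let R (τ : Perm ((ZMod 2 × ZMod 2) × ZMod 2)) : Subgroup (Perm ((ZMod 2 × ZMod 2) × ZMod 2)) :=
    (MonoidHom.mk' (fun g : Multiplicative ((ZMod 2 × ZMod 2) × ZMod 2) =>
      conjTranslation τ g.toAdd) fun _ _ => conjTranslation_add _ _ _).range
  have hRmem (τ g) : conjTranslation τ g ∈ R τ := ⟨Multiplicative.ofAdd g, rfl⟩
  have hRA (τ) (h : ∀ g, conjTranslation τ g ∈ A) : R τ ≤ A := by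
    rintro _ ⟨g, rfl⟩
    exact h _
  have hRp (τ) : IsPGroup 2 (R τ) := by
    rintro ⟨_, g, rfl⟩
    refine ⟨1, Subtype.ext ?_⟩
    change conjTranslation τ g.toAdd ^ 2 = 1
    rw [sq, ← conjTranslation_add, hadd, conjTranslation_zero]
  obtain ⟨b, hb, P, hPA, hP, hQ, hR⟩ := exists_conj_mem_isPGroup 2 A (R 1) (R σ)
    (hRA 1 fun g => by rw [conjTranslation_one]; exact hL g) (hRA σ hσA) (hRp 1) (hRp σ)
  refine IsConjugating.of_mul hb ?_
  have hcP (g) : conjTranslation (σ * b) g ∈ P := by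
    rw [conjTranslation_mul]
    exact hR _ (hRmem σ g)
  have hcA (g) : conjTranslation (σ * b) g ∈ A := hPA (hcP g)
  generalize σ * b = τ at hcP hcA
  have hdP (g) : conjTranslation 1 g ∈ P := hQ (hRmem 1 g)
  have : Nontrivial P := by
    refine ⟨⟨_, hdP 0⟩, ⟨_, hdP (0, 1)⟩, fun h => ?_⟩
    have h1 := eq_of_conjTranslation_apply_eq (σ := 1) (g := 0) (h := (0, 1)) (x := 0)
      (congrArg (fun f : P => (f : Perm ((ZMod 2 × ZMod 2) × ZMod 2)) 0) h)
    exact absurd h1 (by decide)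
  have := hP.center_nontrivial
  obtain ⟨⟨⟨z, hzP⟩, hzc⟩, hz1⟩ := exists_ne (1 : Subgroup.center P)
  have hzcomm {c} (hc : c ∈ P) : Commute z c :=
    congrArg Subtype.val (Subgroup.mem_center_iff.1 hzc ⟨c, hc⟩).symm
  obtain ⟨d, hd⟩ := exists_eq_conjTranslation fun g => hzcomm (hdP g)
  obtain ⟨h₀, hh₀⟩ := exists_eq_conjTranslation fun g => hzcomm (hcP g)
  have hd0 : d ≠ 0 := by
    rintro rfl
    rw [conjTranslation_zero] at hd
    exact hz1 (Subtype.ext (Subtype.ext hd))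
  obtain ⟨θ, hθ⟩ := exists_addEquiv_apply_eq hd0
  refine IsConjugating.of_comap_conj θ
    (isConjugating_of_conjTranslation_eq_addLeft (hA.comap_conj _) (fun g => ?_) (fun g => ?_)
      (h₀ := θ h₀) ?_)
  · obtain ⟨g, rfl⟩ := θ.surjective g
    have h1 := conj_mem_comap_conj (hL g) θ.toEquiv
    rw [← conj_addLeft θ g] at h1
    convert h1 using 1
    group
  · obtain ⟨g, rfl⟩ := θ.surjective g
    rw [conj_conjTranslation]
    exact conj_mem_comap_conj (hcA g) _
  · rw [conj_conjTranslation, ← hh₀, hd, conjTranslation_one, ← hθ, ← conj_addLeft θ d]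
    group

end EvenPrime

theorem statement_15 (p : ℕ) (hp : p.Prime) :
    IsCIGroupColorTernary (Multiplicative ((ZMod 2 × ZMod 2) × ZMod p)) ↔ p ≠ 3 := by
  have : Fact p.Prime := ⟨hp⟩
  refine ⟨?_, fun h3 => isCIGroupColorTernary_of_isConjugating fun A hA hL σ hσA => ?_⟩
  · rintro h rfl
    exact not_isCIGroupColorTernary_three h
  · by_cases h5 : 5 ≤ p
    · exact isConjugating_of_five_le h5 hA hL hσA
    · obtain rfl : p = 2 := by
        have := hp.two_le
        have : p ≠ 4 := by
          rintro rfl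
          revert hp
          decide
        omega
      exact isConjugating_two hA hL hσA
end

section
/- The elementary abelian group ℤ_2⁵ of order 32 is not a CI-group with respect to ternary relational structures. -/
/-- `σ` is an isomorphism from the ternary relational structure `(V, E)` to `(V, E')`. -/
def IsTernaryIso {V : Type*} (σ : Equiv.Perm V) (E E' : Set (V × V × V)) : Prop :=
  ∀ u v w : V, (σ u, σ v, σ w) ∈ E' ↔ (u, v, w) ∈ E

/-- `(G, E)` is a Cayley ternary relational structure of `G`. -/
def IsCayleyTernary (G : Type*) [Group G] (E : Set (G × G × G)) : Prop :=
  ∀ g : G, IsTernaryIso (Equiv.mulLeft g) E E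

/-- `G` is a CI-group with respect to ternary relational structures. -/
def IsCIGroupTernary (G : Type*) [Group G] : Prop :=
  ∀ E E' : Set (G × G × G), IsCayleyTernary G E → IsCayleyTernary G E' →
    (∃ σ : Equiv.Perm G, IsTernaryIso σ E E') →
    ∃ φ : G ≃* G, IsTernaryIso φ.toEquiv E E'

/-- The ternary relation on `𝔽₂⁵` consisting of the triples `(u, v, w)` for which the differences
`x = v - u` and `y = w - u` satisfy `y₀ = y₁ = 0`, `y₂ = 1` and
`x₂ = x₀ y₄ + x₁ y₃ + k x₀ x₁`. -/
def twistedRel (k : ZMod 2) : Set (Multiplicative (Fin 5 → ZMod 2) ×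
    Multiplicative (Fin 5 → ZMod 2) × Multiplicative (Fin 5 → ZMod 2)) :=
  {t | ((t.2.2 / t.1).toAdd 0 = 0 ∧ (t.2.2 / t.1).toAdd 1 = 0 ∧ (t.2.2 / t.1).toAdd 2 = 1) ∧
    (t.2.1 / t.1).toAdd 2 = (t.2.1 / t.1).toAdd 0 * (t.2.2 / t.1).toAdd 4 +
      (t.2.1 / t.1).toAdd 1 * (t.2.2 / t.1).toAdd 3 +
      k * ((t.2.1 / t.1).toAdd 0 * (t.2.1 / t.1).toAdd 1)}

theorem isCayleyTernary_twistedRel (k : ZMod 2) :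
    IsCayleyTernary (Multiplicative (Fin 5 → ZMod 2)) (twistedRel k) := by
  intro g u v w
  simp only [twistedRel, Set.mem_ofPred_eq, Equiv.coe_mulLeft, mul_div_mul_left_eq_div]

/-- The permutation `(a, b, c, d, e) ↦ (a, b, c + ab, d + ac, e + bc)` of `R⁵`. -/
def twist (R : Type*) [CommRing R] : Equiv.Perm (Multiplicative (Fin 5 → R)) where
  toFun x := .ofAdd ![x.toAdd 0, x.toAdd 1, x.toAdd 2 + x.toAdd 0 * x.toAdd 1,
    x.toAdd 3 + x.toAdd 0 * x.toAdd 2, x.toAdd 4 + x.toAdd 1 * x.toAdd 2]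
  invFun x := .ofAdd ![x.toAdd 0, x.toAdd 1, x.toAdd 2 - x.toAdd 0 * x.toAdd 1,
    x.toAdd 3 - x.toAdd 0 * (x.toAdd 2 - x.toAdd 0 * x.toAdd 1),
    x.toAdd 4 - x.toAdd 1 * (x.toAdd 2 - x.toAdd 0 * x.toAdd 1)]
  left_inv x := by
    apply Multiplicative.toAdd.injective
    funext i
    fin_cases i <;> simp
  right_inv x := by
    apply Multiplicative.toAdd.injective
    funext i
    fin_cases i <;> simp

theorem isTernaryIso_twist :
    IsTernaryIso (twist (ZMod 2)) (twistedRel 0) (twistedRel 1) := by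
  intro u v w
  simp only [twistedRel, twist, Set.mem_ofPred_eq, Equiv.coe_fn_mk, toAdd_div, toAdd_ofAdd,
    Pi.sub_apply, Matrix.cons_val]
  generalize u.toAdd = u, v.toAdd = v, w.toAdd = w
  have base : (w 0 - u 0 = 0 ∧ w 1 - u 1 = 0 ∧ w 2 + w 0 * w 1 - (u 2 + u 0 * u 1) = 1) ↔
      (w 0 - u 0 = 0 ∧ w 1 - u 1 = 0 ∧ w 2 - u 2 = 1) := by
    refine and_congr_right fun h0 => and_congr_right fun h1 => ?_
    rw [sub_eq_zero.1 h0, sub_eq_zero.1 h1, add_sub_add_right_eq_sub]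
  rw [base]
  refine and_congr_right fun ⟨h0, h1, h2⟩ => ?_
  rw [sub_eq_zero.1 h0, sub_eq_zero.1 h1, sub_eq_iff_eq_add.1 h2, ← sub_eq_zero,
    ← sub_eq_zero (a := v 2 - u 2)]
  ring_nf

/-- For `k = 0` the fibres over `w` are closed under addition. -/
theorem mul_mem_twistedRel_zero {x y w : Multiplicative (Fin 5 → ZMod 2)}
    (hx : (1, x, w) ∈ twistedRel 0) (hy : (1, y, w) ∈ twistedRel 0) :
    (1, x * y, w) ∈ twistedRel 0 := by
  simp only [twistedRel, Set.mem_ofPred_eq, div_one, toAdd_mul, Pi.add_apply] at hx hy ⊢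
  exact ⟨hx.1, by linear_combination hx.2 + hy.2⟩

theorem exists_mul_notMem_twistedRel_one : ∃ x y w : Multiplicative (Fin 5 → ZMod 2),
    (1, x, w) ∈ twistedRel 1 ∧ (1, y, w) ∈ twistedRel 1 ∧ (1, x * y, w) ∉ twistedRel 1 :=
  ⟨.ofAdd ![1, 0, 0, 0, 0], .ofAdd ![0, 1, 0, 0, 0], .ofAdd ![0, 0, 1, 0, 0], by
    simp [twistedRel]⟩

theorem statement_16 :
    ¬ IsCIGroupTernary (Multiplicative (Fin 5 → ZMod 2)) := by
  intro h
  obtain ⟨φ, hφ⟩ := h _ _ (isCayleyTernary_twistedRel 0) (isCayleyTernary_twistedRel 1)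
    ⟨_, isTernaryIso_twist⟩
  have key (x w : Multiplicative (Fin 5 → ZMod 2)) :
      (1, x, w) ∈ twistedRel 1 ↔ (1, φ.symm x, φ.symm w) ∈ twistedRel 0 := by
    simpa using hφ 1 (φ.symm x) (φ.symm w)
  obtain ⟨x, y, w, hx, hy, hxy⟩ := exists_mul_notMem_twistedRel_one
  rw [key] at hx hy hxy
  exact hxy (map_mul φ.symm x y ▸ mul_mem_twistedRel_zero hx hy)
end

section
/- Let G be a finite group and k ≥ 1. Then G is a CI-group with respect to color k-ary relational structures if and only if for every Cayley color k-ary relational structure X of G and every permutation φ of G with φ⁻¹G_Lφ ≤ Aut(X), the subgroups G_L and φ⁻¹G_Lφ are conjugate in Aut(X). -/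
/-- `σ` is an isomorphism from the color `k`-ary relational structure `(V, E)`
to `(V, E')`. -/
def IsColorKaryIso {V : Type*} {c k : ℕ} (σ : Equiv.Perm V)
    (E E' : Fin c → Set (Fin k → V)) : Prop :=
  ∀ i : Fin c, ∀ t : Fin k → V, (fun j => σ (t j)) ∈ E' i ↔ t ∈ E i

/-- `(G, E)` is a Cayley color `k`-ary relational structure of `G`. -/
def IsCayleyColorKary (G : Type*) [Group G] {c k : ℕ}
    (E : Fin c → Set (Fin k → G)) : Prop :=
  ∀ g : G, IsColorKaryIso (Equiv.mulLeft g) E E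

/-- `G` is a CI-group with respect to color `k`-ary relational structures. -/
def IsCIGroupColorKary (G : Type*) [Group G] (k : ℕ) : Prop :=
  ∀ (c : ℕ) (E E' : Fin c → Set (Fin k → G)),
    Pairwise (Function.onFun Disjoint E) → Pairwise (Function.onFun Disjoint E') →
    IsCayleyColorKary G E → IsCayleyColorKary G E' →
    (∃ σ : Equiv.Perm G, IsColorKaryIso σ E E') →
    ∃ φ : G ≃* G, IsColorKaryIso φ.toEquiv E E'

/-- The left regular representation of `G` as a subgroup of `Sym(G)`. -/
def leftRegular (G : Type*) [Group G] : Subgroup (Equiv.Perm G) :=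
  (MulAction.toPermHom G G).range

/-- The conjugate subgroup `φ⁻¹ K φ`. -/
def conjBy {Ω : Type*} (φ : Equiv.Perm Ω) (K : Subgroup (Equiv.Perm Ω)) :
    Subgroup (Equiv.Perm Ω) :=
  K.map (MulAut.conj φ⁻¹).toMonoidHom

theorem mem_conjBy {Ω : Type*} {φ x : Equiv.Perm Ω} {K : Subgroup (Equiv.Perm Ω)} :
    x ∈ conjBy φ K ↔ φ * x * φ⁻¹ ∈ K := by
  constructor
  · rintro ⟨y, hy, rfl⟩
    simpa [mul_assoc] using hy
  · intro h
    exact ⟨_, h, by simp [mul_assoc]⟩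

theorem mem_leftRegular {G : Type*} [Group G] {x : Equiv.Perm G} :
    x ∈ leftRegular G ↔ ∃ g : G, ∀ y, x y = g * y := by
  constructor
  · rintro ⟨g, rfl⟩
    exact ⟨g, fun y => rfl⟩
  · rintro ⟨g, hg⟩
    exact ⟨g, Equiv.ext fun y => (hg y).symm⟩

theorem mulLeft_mem_leftRegular {G : Type*} [Group G] (g : G) :
    Equiv.mulLeft g ∈ leftRegular G :=
  mem_leftRegular.2 ⟨g, fun _ => rfl⟩

namespace IsColorKaryIso

variable {V : Type*} {c k : ℕ} {E E' E'' : Fin c → Set (Fin k → V)} {σ τ : Equiv.Perm V}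

theorem mul (hτ : IsColorKaryIso τ E' E'') (hσ : IsColorKaryIso σ E E') :
    IsColorKaryIso (τ * σ) E E'' :=
  fun i t => (hτ i fun j => σ (t j)).trans (hσ i t)

theorem inv (hσ : IsColorKaryIso σ E E') : IsColorKaryIso σ⁻¹ E' E := by
  intro i t
  simpa using (hσ i fun j => σ⁻¹ (t j)).symm

end IsColorKaryIso

/-- A permutation normalizing the left regular representation becomes a group automorphism
after translating the image of `1` back to `1`. -/
theorem exists_mulEquiv_of_normalizes_leftRegular {G : Type*} [Group G] (τ : Equiv.Perm G)
    (h : ∀ g : G, τ * Equiv.mulLeft g * τ⁻¹ ∈ leftRegular G) :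
    ∃ φ : G ≃* G, φ.toEquiv = Equiv.mulLeft (τ 1)⁻¹ * τ := by
  refine ⟨⟨Equiv.mulLeft (τ 1)⁻¹ * τ, fun a b => ?_⟩, rfl⟩
  obtain ⟨g, hg⟩ := mem_leftRegular.1 (h a)
  have hmul (y : G) : τ (a * y) = g * τ y := by simpa using hg (τ y)
  have hone : τ a = g * τ 1 := by simpa using hmul 1
  change (τ 1)⁻¹ * τ (a * b) = (τ 1)⁻¹ * τ a * ((τ 1)⁻¹ * τ b)
  rw [hmul, hone]
  group

theorem conjBy_mulEquiv_leftRegular {G : Type*} [Group G] (α : G ≃* G) :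
    conjBy α.toEquiv (leftRegular G) = leftRegular G := by
  ext x
  rw [mem_conjBy, mem_leftRegular, mem_leftRegular]
  constructor
  · rintro ⟨g, hg⟩
    refine ⟨α.symm g, fun y => α.injective ?_⟩
    simpa using hg (α.toEquiv y)
  · rintro ⟨g, hg⟩
    refine ⟨α g, fun y => ?_⟩
    obtain ⟨z, rfl⟩ := α.toEquiv.surjective y
    simp [hg]

theorem statement_17 (G : Type*) [Group G] [Fintype G] (k : ℕ) (hk : 1 ≤ k) :
    IsCIGroupColorKary G k ↔
      ∀ (c : ℕ) (E : Fin c → Set (Fin k → G)),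
        Pairwise (Function.onFun Disjoint E) →
        IsCayleyColorKary G E →
        ∀ φ : Equiv.Perm G,
          (conjBy φ (leftRegular G) : Set (Equiv.Perm G)) ⊆
            {σ : Equiv.Perm G | IsColorKaryIso σ E E} →
          ∃ σ : Equiv.Perm G, IsColorKaryIso σ E E ∧
            conjBy σ (leftRegular G) = conjBy φ (leftRegular G) := by
  constructor
  · intro hCI c E hdisj hE φ hφ
    let E' : Fin c → Set (Fin k → G) := fun i => {t | (fun j => φ⁻¹ (t j)) ∈ E i}
    have hiso : IsColorKaryIso φ E E' := fun i t => by simp [E']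
    have hdisj' : Pairwise (Function.onFun Disjoint E') := fun i j hij =>
      (hdisj hij).preimage fun (t : Fin k → G) l => φ⁻¹ (t l)
    have hE' : IsCayleyColorKary G E' := fun g => by
      have hmem : φ⁻¹ * Equiv.mulLeft g * φ ∈ conjBy φ (leftRegular G) := by
        rw [mem_conjBy]
        simpa [mul_assoc] using mulLeft_mem_leftRegular g
      have h : IsColorKaryIso (φ⁻¹ * Equiv.mulLeft g * φ) E E := hφ hmem
      simpa [mul_assoc] using (hiso.mul h).mul hiso.inv
    obtain ⟨α, hα⟩ := hCI c E E' hdisj hdisj' hE hE' ⟨φ, hiso⟩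
    have hα' : IsColorKaryIso (α.toEquiv : Equiv.Perm G)⁻¹ E' E := hα.inv
    refine ⟨(α.toEquiv : Equiv.Perm G)⁻¹ * φ, hα'.mul hiso, ?_⟩
    ext x
    rw [mem_conjBy, mem_conjBy, ← conjBy_mulEquiv_leftRegular α, mem_conjBy,
      conjBy_mulEquiv_leftRegular α]
    simp [mul_assoc]
  · rintro h c E E' hdisj - hE hE' ⟨φ, hφ⟩
    have hsub : (conjBy φ (leftRegular G) : Set (Equiv.Perm G)) ⊆
        {σ : Equiv.Perm G | IsColorKaryIso σ E E} := by
      rintro _ ⟨_, ⟨g, rfl⟩, rfl⟩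
      have hg : IsColorKaryIso (φ⁻¹ * Equiv.mulLeft g * φ) E E := (hφ.inv.mul (hE' g)).mul hφ
      exact hg
    obtain ⟨σ, hσ, hconj⟩ := h c E hdisj hE φ hsub
    obtain ⟨α, hα⟩ := exists_mulEquiv_of_normalizes_leftRegular (φ * σ⁻¹) fun g => by
      have hmem : σ⁻¹ * Equiv.mulLeft g * σ ∈ conjBy σ (leftRegular G) := by
        rw [mem_conjBy]
        simpa [mul_assoc] using mulLeft_mem_leftRegular g
      rw [hconj, mem_conjBy] at hmem
      simpa [mul_assoc] using hmem
    refine ⟨α, ?_⟩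
    rw [hα]
    exact (hE' _).mul (hφ.mul hσ.inv)
end

section
/- If a finite group G is a CI-group with respect to ternary relational structures, then G is a CI-group with respect to binary relational structures. -/
/-- `σ` is an isomorphism from the binary relational structure `(V, E)` to `(V, E')`. -/
def IsBinaryIso {V : Type*} (σ : Equiv.Perm V) (E E' : Set (V × V)) : Prop :=
  ∀ u v : V, (σ u, σ v) ∈ E' ↔ (u, v) ∈ E

/-- `(G, E)` is a Cayley binary relational structure of `G`. -/
def IsCayleyBinary (G : Type*) [Group G] (E : Set (G × G)) : Prop :=
  ∀ g : G, IsBinaryIso (Equiv.mulLeft g) E E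

/-- `G` is a CI-group with respect to binary relational structures. -/
def IsCIGroupBinary (G : Type*) [Group G] : Prop :=
  ∀ E E' : Set (G × G), IsCayleyBinary G E → IsCayleyBinary G E' →
    (∃ σ : Equiv.Perm G, IsBinaryIso σ E E') →
    ∃ φ : G ≃* G, IsBinaryIso φ.toEquiv E E'

theorem statement_19 (G : Type*) [Group G] [Fintype G]
    (h : IsCIGroupTernary G) : IsCIGroupBinary G := by
  intro E E' hE hE' ⟨σ, hσ⟩
  obtain ⟨φ, hφ⟩ := h {p | (p.1, p.2.1) ∈ E} {p | (p.1, p.2.1) ∈ E'}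
    (fun g u v _ => hE g u v) (fun g u v _ => hE' g u v) ⟨σ, fun u v _ => hσ u v⟩
  exact ⟨φ, fun u v => hφ u v v⟩
end
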